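/- Let F(s) = ξ(2)·ξ(s+1)ξ(2s)ξ(3s)/(s−2) − ξ(2)·ξ(s−1)ξ(2s−1)ξ(3s−2)/(s+1) − ξ(s+1)ξ(2s)ξ(3s)/(2s−2) + ξ(s−1)ξ(2s−1)ξ(3s−2)/(2s) − ξ(s)ξ(2s)ξ(3s−1)/((3s)(2s−2)) − ξ(s)ξ(2s−1)ξ(3s−2)/((3s−1)(s−2)) − ξ(s)ξ(2s−1)ξ(3s−1)/((3s−3)(2s)) − ξ(s)ξ(2s)ξ(3s)/((3s−2)(s+1)). Then every zero of F lies on the central line: for every complex s with s ∉ {−1, 0, 1/3, 1/2, 2/3, 1, 2}, if F(s) = 0 then Re s = 1/2. -/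

import Mathlib

open Complex

local notation "ξ" => completedRiemannZeta

/-- Weng's zeta function `ξ_ℚ^{G₂/P_long}(s)`. -/
noncomputable def wengG2Plong (s : ℂ) : ℂ :=
  ξ 2 * ξ (s + 1) * ξ (2*s) * ξ (3*s) / (s - 2)
    - ξ 2 * ξ (s - 1) * ξ (2*s - 1) * ξ (3*s - 2) / (s + 1)
    - ξ (s + 1) * ξ (2*s) * ξ (3*s) / (2*s - 2)
    + ξ (s - 1) * ξ (2*s - 1) * ξ (3*s - 2) / (2*s)
    - ξ s * ξ (2*s) * ξ (3*s - 1) / ((3*s) * (2*s - 2))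
    - ξ s * ξ (2*s - 1) * ξ (3*s - 2) / ((3*s - 1) * (s - 2))
    - ξ s * ξ (2*s - 1) * ξ (3*s - 1) / ((3*s - 3) * (2*s))
    - ξ s * ξ (2*s) * ξ (3*s) / ((3*s - 2) * (s + 1))

namespace WengG2

open Set Filter Topology MeasureTheory
open scoped ComplexConjugate Real

/-- The entire function `w (w - 1) ξ(w)`. -/
noncomputable def entireXi (w : ℂ) : ℂ := 1 + w * (w - 1) * completedRiemannZeta₀ w

lemma differentiable_entireXi : Differentiable ℂ entireXi := by
  unfold entireXi
  have := differentiable_completedZeta₀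
  fun_prop

lemma entireXi_one_sub (w : ℂ) : entireXi (1 - w) = entireXi w := by
  simp only [entireXi, completedRiemannZeta₀_one_sub]; ring

@[simp] lemma entireXi_zero : entireXi 0 = 1 := by simp [entireXi]
@[simp] lemma entireXi_one : entireXi 1 = 1 := by simp [entireXi]

lemma entireXi_eq {w : ℂ} (h0 : w ≠ 0) (h1 : w ≠ 1) :
    entireXi w = w * (w - 1) * completedRiemannZeta w := by
  have : (1 : ℂ) - w ≠ 0 := sub_ne_zero.2 h1.symm
  rw [entireXi, completedRiemannZeta_eq]
  field_simp
  ring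

lemma completedRiemannZeta_eq_entireXi {w : ℂ} (h0 : w ≠ 0) (h1 : w ≠ 1) :
    completedRiemannZeta w = entireXi w / (w * (w - 1)) := by
  rw [entireXi_eq h0 h1, mul_div_cancel_left₀ _ (mul_ne_zero h0 (sub_ne_zero.2 h1))]

lemma entireXi_eq_Gamma {w : ℂ} (h0 : 0 < w.re) (h1 : w ≠ 1) :
    entireXi w = 2 * (w - 1) * Gamma (w / 2 + 1) * (π : ℂ) ^ (-w / 2) * riemannZeta w := by
  have hw : w ≠ 0 := by rintro rfl; simp at h0
  rw [entireXi_eq hw h1, riemannZeta_def_of_ne_zero hw, Gammaℝ_def,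
    Gamma_add_one _ (div_ne_zero hw two_ne_zero)]
  have h2 : (π : ℂ) ^ (-w / 2) ≠ 0 := by
    rw [Ne, cpow_eq_zero_iff]; simp [Real.pi_ne_zero]
  have h3 : Gamma (w / 2) ≠ 0 := Gamma_ne_zero_of_re_pos (by simpa using h0)
  field_simp

lemma entireXi_ne_zero {w : ℂ} (hw : 1 ≤ w.re) : entireXi w ≠ 0 := by
  rcases eq_or_ne w 1 with rfl | h1
  · simp
  have h2 : (π : ℂ) ^ (-w / 2) ≠ 0 := by
    rw [Ne, cpow_eq_zero_iff]; simp [Real.pi_ne_zero]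
  have h3 : Gamma (w / 2 + 1) ≠ 0 :=
    Gamma_ne_zero_of_re_pos (by simp; linarith)
  rw [entireXi_eq_Gamma (by linarith) h1]
  have := riemannZeta_ne_zero_of_one_le_re hw
  have h4 := sub_ne_zero.2 h1
  simp only [ne_eq, mul_eq_zero, not_or]
  exact ⟨⟨⟨⟨two_ne_zero, h4⟩, h3⟩, h2⟩, this⟩

lemma pi_cpow_conj (w : ℂ) : (π : ℂ) ^ (conj w) = conj ((π : ℂ) ^ w) := by
  have := cpow_conj (π : ℂ) w (by rw [arg_ofReal_of_nonneg Real.pi_pos.le]; exact Real.pi_pos.ne)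
  simpa using this

lemma entireXi_conj (w : ℂ) : entireXi (conj w) = conj (entireXi w) := by
  have key : ∀ w : ℂ, 0 < w.re → entireXi (conj w) = conj (entireXi w) := by
    intro w hw
    rcases eq_or_ne w 1 with rfl | h1
    · simp
    have h1' : conj w ≠ 1 := fun h => h1 (by simpa using congrArg conj h)
    rw [entireXi_eq_Gamma hw h1, entireXi_eq_Gamma (by simpa using hw) h1', riemannZeta_conj]
    have e1 : conj w / 2 + 1 = conj (w / 2 + 1) := by simp [Complex.conj_ofNat]
    have e2 : - conj w / 2 = conj (-w / 2) := by simp [Complex.conj_ofNat]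
    rw [e1, e2, Gamma_conj, pi_cpow_conj]
    simp [Complex.conj_ofNat]
  rcases lt_or_ge 0 w.re with h | h
  · exact key w h
  · have := key (1 - w) (by simp; linarith)
    rw [entireXi_one_sub] at this
    rw [← this, ← entireXi_one_sub (conj w)]
    simp

lemma entireXi_two : entireXi 2 = π / 3 := by
  rw [entireXi_eq_Gamma (by simp) (by norm_num), riemannZeta_two]
  have : (π : ℂ) ^ (-2 / 2 : ℂ) = (π : ℂ)⁻¹ := by
    rw [show (-2 / 2 : ℂ) = -1 by norm_num, cpow_neg_one]
  rw [this, show (2 / 2 + 1 : ℂ) = ((1 : ℕ) : ℂ) + 1 by norm_num, Gamma_nat_eq_factorial]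
  have := Real.pi_ne_zero
  have : (π : ℂ) ≠ 0 := by exact_mod_cast this
  field_simp
  norm_num

lemma entireXi_ofReal_im (x : ℝ) : (entireXi x).im = 0 := by
  have := entireXi_conj x
  rw [conj_ofReal] at this
  exact conj_eq_iff_im.1 this.symm

/-- `∑_{n ≠ 0} exp (-π n² x)`. -/
noncomputable def thetaTail (x : ℝ) : ℝ := HurwitzZeta.cosKernel 0 x - 1

lemma hasSum_thetaTail {x : ℝ} (hx : 0 < x) :
    HasSum (fun n : ℕ ↦ 2 * Real.exp (-π * (n + 1) ^ 2 * x)) (thetaTail x) := by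
  simpa [thetaTail] using HurwitzZeta.hasSum_nat_cosKernel₀ 0 hx

lemma thetaTail_bound (N : ℕ) {x : ℝ} (hx : 1 ≤ x) :
    0 ≤ thetaTail x - ∑ n ∈ Finset.range N, 2 * Real.exp (-π * (n + 1) ^ 2 * x) ∧
    thetaTail x - ∑ n ∈ Finset.range N, 2 * Real.exp (-π * (n + 1) ^ 2 * x)
      ≤ 3 * Real.exp (-π * (N + 1) ^ 2 * x) := by
  have h := (hasSum_nat_add_iff' N).2 (hasSum_thetaTail (by linarith : 0 < x))
  refine ⟨h.nonneg fun n => by positivity, ?_⟩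
  have hr : Real.exp (-2) ≤ 1 / 3 := by
    rw [Real.exp_neg, ← one_div]
    apply one_div_le_one_div_of_le (by norm_num)
    have := Real.add_one_le_exp (2 : ℝ)
    linarith
  have hg : HasSum (fun n : ℕ => 2 * Real.exp (-π * (N + 1) ^ 2 * x) * (1 / 3 : ℝ) ^ n)
      (2 * Real.exp (-π * (N + 1) ^ 2 * x) * (1 - 1 / 3)⁻¹) :=
    (hasSum_geometric_of_lt_one (by norm_num) (by norm_num)).mul_left _
  have e : 2 * Real.exp (-π * (N + 1) ^ 2 * x) * (1 - 1 / 3)⁻¹ =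
    3 * Real.exp (-π * (N + 1) ^ 2 * x) := by ring
  rw [← e]
  refine hasSum_le (fun n => ?_) h hg
  rw [mul_assoc 2 (Real.exp (-π * (N + 1) ^ 2 * x))]
  refine mul_le_mul_of_nonneg_left ?_ (zero_le_two (α := ℝ))
  calc Real.exp (-π * ((n + N : ℕ) + 1) ^ 2 * x)
      ≤ Real.exp (-π * (N + 1) ^ 2 * x + n * (-2)) := by
        apply Real.exp_le_exp.2
        push_cast
        have h3 := Real.pi_gt_three
        have hn : (0 : ℝ) ≤ n := Nat.cast_nonneg n
        have hN : (0 : ℝ) ≤ N := Nat.cast_nonneg N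
        have : (2 : ℝ) * n ≤ π * (((n : ℝ) + N + 1) ^ 2 - (N + 1) ^ 2) * x := by
          have h1 : (n : ℝ) * 2 ≤ ((n : ℝ) + N + 1) ^ 2 - (N + 1) ^ 2 := by
            nlinarith [mul_nonneg hn hN]
          calc (2 : ℝ) * n ≤ 1 * (((n : ℝ) + N + 1) ^ 2 - (N + 1) ^ 2) * 1 := by linarith
            _ ≤ _ := by gcongr <;> nlinarith
        nlinarith
    _ = Real.exp (-π * (N + 1) ^ 2 * x) * (Real.exp (-2)) ^ n := by
        rw [Real.exp_add, Real.exp_nat_mul]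
    _ ≤ _ := by gcongr

/-- The even function whose Fourier–Laplace transform is the entire part of `ξ`. -/
noncomputable def thetaF (v : ℝ) : ℝ := thetaTail (Real.exp (2 * |v|)) * Real.exp (|v| / 2)

lemma thetaF_neg (v : ℝ) : thetaF (-v) = thetaF v := by simp [thetaF]

lemma continuous_thetaF : Continuous thetaF := by
  unfold thetaF thetaTail
  refine Continuous.mul (Continuous.sub ?_ continuous_const) (by fun_prop)
  exact (HurwitzZeta.continuousOn_cosKernel 0).comp_continuous (by fun_prop)
    (fun v => Real.exp_pos _)

lemma thetaF_nonneg (v : ℝ) : 0 ≤ thetaF v := by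
  have h1 : (1 : ℝ) ≤ Real.exp (2 * |v|) := Real.one_le_exp (by positivity)
  have := (thetaTail_bound 0 h1).1
  simp only [Finset.range_zero, Finset.sum_empty, sub_zero] at this
  exact mul_nonneg this (Real.exp_pos _).le

lemma thetaF_le' (v : ℝ) :
    thetaF v ≤ 3 * Real.exp (-π * Real.exp (2 * |v|) + |v| / 2) := by
  have h1 : (1 : ℝ) ≤ Real.exp (2 * |v|) := Real.one_le_exp (by positivity)
  have := (thetaTail_bound 0 h1).2
  simp only [Finset.range_zero, Finset.sum_empty, sub_zero, CharP.cast_eq_zero, zero_add,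
    one_pow, mul_one] at this
  rw [Real.exp_add, ← mul_assoc]
  exact mul_le_mul_of_nonneg_right this (Real.exp_pos _).le

lemma thetaF_le (v : ℝ) : thetaF v ≤ 3 * Real.exp (-6 * v ^ 2 + |v| / 2) := by
  refine (thetaF_le' v).trans (mul_le_mul_of_nonneg_left (Real.exp_le_exp.2 ?_) (by norm_num))
  have h2 : 2 * v ^ 2 ≤ Real.exp (2 * |v|) := by
    have := Real.quadratic_le_exp_of_nonneg (show 0 ≤ 2 * |v| by positivity)
    have h3 := sq_abs v
    nlinarith [abs_nonneg v]
  nlinarith [Real.pi_gt_three, sq_nonneg v]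

lemma norm_thetaF_mul_exp_le {R : ℝ} {z : ℂ} (hz : |z.re| ≤ R) (v : ℝ) :
    ‖(thetaF v : ℂ) * cexp (z * v)‖ ≤ 3 * Real.exp ((1 / 2 + R) ^ 2 / 4) * Real.exp
        (-5 * v ^ 2) := by
  rw [norm_mul, norm_real, Real.norm_of_nonneg (thetaF_nonneg v), Complex.norm_exp]
  have hre : (z * v).re ≤ R * |v| := by
    simp only [mul_re, ofReal_re, ofReal_im, mul_zero, sub_zero]
    calc z.re * v ≤ |z.re * v| := le_abs_self _
      _ = |z.re| * |v| := abs_mul _ _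
      _ ≤ _ := by gcongr
  calc thetaF v * Real.exp (z * v).re
      ≤ (3 * Real.exp (-6 * v ^ 2 + |v| / 2)) * Real.exp (R * |v|) := by
        gcongr; exact thetaF_le v
    _ = 3 * Real.exp (-6 * v ^ 2 + |v| / 2 + R * |v|) := by rw [mul_assoc, ← Real.exp_add]
    _ ≤ 3 * Real.exp ((1 / 2 + R) ^ 2 / 4 + -5 * v ^ 2) := by
        refine mul_le_mul_of_nonneg_left (Real.exp_le_exp.2 ?_) (by norm_num)
        have := sq_abs v
        nlinarith [sq_nonneg (|v| - (1 / 2 + R) / 2)]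
    _ = _ := by rw [Real.exp_add, mul_assoc]

lemma completedRiemannZeta₀_eq_integral (z : ℂ) :
    completedRiemannZeta₀ (1 / 2 + z) = ∫ v : ℝ, (thetaF v : ℂ) * cexp (z * v) := by
  have hm : completedRiemannZeta₀ (1 / 2 + z) =
      mellin (HurwitzZeta.hurwitzEvenFEPair 0).f_modif ((1 / 2 + z) / 2) / 2 := rfl
  have hE : ∀ f : ℝ → ℂ, ∀ s : ℂ, mellin f s = ∫ u : ℝ, cexp (-s * u) • f (Real.exp (-u)) := by
    intro f s
    rw [mellin_eq_fourier, Real.fourier_eq']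
    congr 1; ext u
    simp only [RCLike.inner_apply, conj_trivial, smul_eq_mul, real_smul]
    rw [← mul_assoc, ofReal_exp, ← Complex.exp_add]
    congr 2
    have : (π : ℂ) ≠ 0 := by exact_mod_cast Real.pi_ne_zero
    push_cast
    field_simp
    conv_rhs => rw [← re_add_im s]
    ring
  rw [hm, hE]
  have hae : (fun u : ℝ => cexp (-((1 / 2 + z) / 2) * u) •
      (HurwitzZeta.hurwitzEvenFEPair 0).f_modif (Real.exp (-u))) =ᵐ[volume]
      fun u : ℝ => (fun v : ℝ => (thetaF v : ℂ) * cexp (z * v)) ((-1 / 2) * u) := by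
    have h0 : ∀ᵐ u : ℝ, u ≠ 0 := by
      simp [ae_iff, measure_singleton]
    filter_upwards [h0] with u hu
    rcases lt_or_gt_of_ne hu with h | h
    · have h1 : 1 < Real.exp (-u) := Real.one_lt_exp_iff.2 (by linarith)
      have h2 : |(-1 / 2) * u| = -u / 2 := by rw [abs_of_pos (by linarith)]; ring
      have h3 : 2 * (-u / 2) = -u := by ring
      have : (HurwitzZeta.hurwitzEvenFEPair 0).f_modif (Real.exp (-u)) =
          ((thetaTail (Real.exp (-u)) : ℝ) : ℂ) := by
        simp only [WeakFEPair.f_modif, Pi.add_apply]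
        rw [indicator_of_mem (by simpa using h1), indicator_of_notMem (by simp; intros; linarith)]
        simp [HurwitzZeta.hurwitzEvenFEPair, thetaTail, HurwitzZeta.evenKernel_eq_cosKernel_of_zero]
      rw [this]
      simp only [thetaF, h2, h3, smul_eq_mul]
      push_cast
      rw [mul_comm, mul_assoc, ← Complex.exp_add]
      congr 2
      ring
    · have h1 : Real.exp (-u) < 1 := by rw [Real.exp_lt_one_iff]; linarith
      have h2 : |(-1 / 2) * u| = u / 2 := by rw [abs_of_neg (by linarith)]; ring
      have h3 : 2 * (u / 2) = u := by ring
      have hp := Real.exp_pos (-u)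
      have hr : (Real.exp (-u)) ^ (-(1 / 2) : ℝ) = Real.exp (u / 2) := by
        rw [← Real.exp_mul]; ring_nf
      have hr' : 1 / (Real.exp (-u)) ^ ((1 / 2) : ℝ) = Real.exp (u / 2) := by
        rw [← hr, Real.rpow_neg hp.le, one_div]
      have : (HurwitzZeta.hurwitzEvenFEPair 0).f_modif (Real.exp (-u)) =
          ((thetaTail (Real.exp u) * Real.exp (u / 2) : ℝ) : ℂ) := by
        simp only [WeakFEPair.f_modif, Pi.add_apply]
        rw [indicator_of_notMem (by simp; linarith), indicator_of_mem
            (show _ ∈ Ioo (0 : ℝ) 1 from ⟨hp, h1⟩)]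
        simp only [HurwitzZeta.hurwitzEvenFEPair, Function.comp_apply, thetaTail, smul_eq_mul,
          mul_one, one_mul, zero_add, hr]
        rw [HurwitzZeta.evenKernel_functional_equation, hr', one_div, ← Real.exp_neg, neg_neg]
        push_cast
        ring
      rw [this]
      simp only [thetaF, h2, h3, smul_eq_mul]
      push_cast
      have e : cexp (-((1 / 2 + z) / 2) * u) * cexp (u / 2) =
          cexp (u / 2 / 2) * cexp (z * (-1 / 2 * u)) := by
        rw [← Complex.exp_add, ← Complex.exp_add]; congr 1; ring
      linear_combination (thetaTail (Real.exp u) : ℂ) * e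
  rw [integral_congr_ae hae, Measure.integral_comp_mul_left
    (fun v : ℝ => (thetaF v : ℂ) * cexp (z * v))]
  norm_num

lemma norm_completedRiemannZeta₀_le {R : ℝ} :
    ∃ C, ∀ w : ℂ, |w.re| ≤ R → ‖completedRiemannZeta₀ w‖ ≤ C := by
  refine ⟨∫ v : ℝ, 3 * Real.exp ((1 / 2 + (R + 1 / 2)) ^ 2 / 4) * Real.exp (-5 * v ^ 2),
    fun w hw => ?_⟩
  rw [show w = 1 / 2 + (w - 1 / 2) by ring, completedRiemannZeta₀_eq_integral]
  refine norm_integral_le_of_norm_le ((integrable_exp_neg_mul_sq (b := 5) (by norm_num)).const_mul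
    _) (Eventually.of_forall fun v => norm_thetaF_mul_exp_le ?_ v)
  have : (w - 1 / 2).re = w.re - 1 / 2 := by simp
  rw [this]
  rw [abs_le] at *
  constructor <;> linarith

/-- Polynomial growth of the entire function in vertical strips. -/
lemma norm_entireXi_growth (R : ℝ) :
    ∃ C, 0 ≤ C ∧ ∀ w : ℂ, |w.re| ≤ R → ‖entireXi w‖ ≤ C * (1 + ‖w‖) ^ 2 := by
  obtain ⟨C, hC⟩ := norm_completedRiemannZeta₀_le (R := R)
  refine ⟨1 + |C|, by positivity, fun w hw => ?_⟩
  have h1 : ‖w - 1‖ ≤ 1 + ‖w‖ := by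
    calc ‖w - 1‖ ≤ ‖w‖ + ‖(1 : ℂ)‖ := norm_sub_le _ _
      _ = _ := by simp [add_comm]
  have h2 := (hC w hw).trans (le_abs_self C)
  have h0 := norm_nonneg w
  calc ‖entireXi w‖ ≤ ‖(1 : ℂ)‖ + ‖w * (w - 1) * completedRiemannZeta₀ w‖ := norm_add_le _ _
    _ = 1 + ‖w‖ * ‖w - 1‖ * ‖completedRiemannZeta₀ w‖ := by simp
    _ ≤ 1 + (1 + ‖w‖) * (1 + ‖w‖) * |C| := by gcongr; linarith
    _ ≤ _ := by nlinarith [abs_nonneg C]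

lemma norm_Gamma_le {a : ℂ} (ha : 0 < a.re) : ‖Gamma a‖ ≤ Real.Gamma a.re := by
  rw [Gamma_eq_integral ha, Real.Gamma_eq_integral ha, GammaIntegral]
  refine (norm_integral_le_integral_norm _).trans (le_of_eq ?_)
  refine setIntegral_congr_fun measurableSet_Ioi fun t ht => ?_
  simp only [norm_mul, norm_real, norm_cpow_eq_rpow_re_of_pos (mem_Ioi.1 ht)]
  rw [Real.norm_of_nonneg (Real.exp_pos _).le]
  simp

lemma sq_norm_Gamma_one_add_mul_I {t : ℝ} (ht : 0 < t) :
    ‖Gamma (1 + t * I)‖ ^ 2 ≤ (1 + 2 * π * t) * Real.exp (-π * t) := by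
  have htI : (t : ℂ) * I ≠ 0 := mul_ne_zero (by exact_mod_cast ht.ne') I_ne_zero
  have h1 := Gamma_mul_Gamma_one_sub (t * I)
  have hconj : ‖Gamma (1 - t * I)‖ = ‖Gamma (1 + t * I)‖ := by
    rw [← RCLike.norm_conj (Gamma (1 + t * I)), ← Gamma_conj]
    congr 2; simp [sub_eq_add_neg]
  have h2 : ‖Gamma (1 + t * I)‖ ^ 2 = π * t / Real.sinh (π * t) := by
    rw [sq]
    nth_rewrite 2 [← hconj]
    rw [add_comm (1 : ℂ), Gamma_add_one _ htI, ← norm_mul, mul_assoc, h1, ← mul_assoc,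
      sin_mul_I, ← ofReal_mul, ← ofReal_sinh, norm_mul, norm_div, norm_mul, norm_mul, norm_I,
      norm_real, norm_real, norm_real, Real.norm_of_nonneg ht.le,
          Real.norm_of_nonneg Real.pi_pos.le,
      Real.norm_of_nonneg (Real.sinh_nonneg_iff.2 (by positivity))]
    ring
  have hx : 0 < π * t := by positivity
  rw [h2, div_le_iff₀ (Real.sinh_pos_iff.2 hx), Real.sinh_eq]
  have h3 : Real.exp (-π * t) * Real.exp (π * t) = 1 := by rw [← Real.exp_add]; simp
  have h4 : Real.exp (-(π * t)) = Real.exp (-π * t) := by congr 1; ring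
  have h5 : Real.exp (-π * t) * Real.exp (-π * t) * (1 + 2 * π * t) ≤ 1 := by
    have := Real.add_one_le_exp (2 * π * t)
    calc _ ≤ Real.exp (-π * t) * Real.exp (-π * t) * Real.exp (2 * π * t) := by gcongr; linarith
      _ = 1 := by rw [← Real.exp_add, ← Real.exp_add]; ring_nf; simp
  rw [h4]
  nlinarith

lemma norm_Gamma_five_le_exp {w : ℂ} (hw : w.re = 5) :
    ‖Gamma w‖ ≤ 1900 * Real.exp (-|w.im|) := by
  have key : ∀ t : ℝ, 0 < t → ‖Gamma (5 + t * I)‖ ≤ 1900 * Real.exp (-t) := by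
    intro t ht
    have hk : ∀ k : ℕ, 0 < k → (k : ℂ) + t * I ≠ 0 := fun k hk h => by
      have := congrArg re h; simp at this; omega
    have e : Gamma (5 + t * I) = ((4 : ℕ) + t * I) * (((3 : ℕ) + t * I) * (((2 : ℕ) + t * I) *
        (((1 : ℕ) + t * I) * Gamma (1 + t * I)))) := by
      have h1 := Gamma_add_one _ (hk 1 (by norm_num))
      have h2 := Gamma_add_one _ (hk 2 (by norm_num))
      have h3 := Gamma_add_one _ (hk 3 (by norm_num))
      have h4 := Gamma_add_one _ (hk 4 (by norm_num))
      rw [show (5 : ℂ) + t * I = (4 : ℕ) + t * I + 1 by push_cast; ring, h4,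
        show ((4 : ℕ) : ℂ) + t * I = (3 : ℕ) + t * I + 1 by push_cast; ring, h3,
        show ((3 : ℕ) : ℂ) + t * I = (2 : ℕ) + t * I + 1 by push_cast; ring, h2,
        show ((2 : ℕ) : ℂ) + t * I = (1 : ℕ) + t * I + 1 by push_cast; ring, h1]
      simp
    have hn : ∀ k : ℕ, ‖(k : ℂ) + t * I‖ ^ 2 = (k : ℝ) ^ 2 + t ^ 2 := fun k => by
      rw [Complex.sq_norm, normSq_apply]; simp; ring
    have hG := sq_norm_Gamma_one_add_mul_I ht
    refine le_of_sq_le_sq ?_ (by positivity)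
    rw [e]
    simp only [norm_mul, mul_pow, hn]
    have hpow : ∀ n : ℕ, t ^ n ≤ n.factorial * Real.exp t := fun n => by
      have := Real.pow_div_factorial_le_exp t ht.le n
      rw [div_le_iff₀ (by positivity)] at this
      linarith
    have p9 := hpow 9
    have p8 := hpow 8
    have p7 := hpow 7
    have p6 := hpow 6
    have p5 := hpow 5
    have p4 := hpow 4
    have p3 := hpow 3
    have p2 := hpow 2
    have p1 := hpow 1
    have p0 := Real.one_le_exp ht.le
    simp only [Nat.factorial] at p9 p8 p7 p6 p5 p4 p3 p2 p1
    norm_num at p9 p8 p7 p6 p5 p4 p3 p2 p1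
    have hpi := Real.pi_lt_d2
    have hQ : (4 ^ 2 + t ^ 2) * (3 ^ 2 + t ^ 2) * (2 ^ 2 + t ^ 2) * (1 ^ 2 + t ^ 2) *
        (1 + 2 * π * t) ≤ 1900 ^ 2 * Real.exp t := by
      calc _ ≤ (4 ^ 2 + t ^ 2) * (3 ^ 2 + t ^ 2) * (2 ^ 2 + t ^ 2) * (1 ^ 2 + t ^ 2) *
          (1 + 2 * 3.15 * t) := by gcongr
        _ ≤ _ := by
          linarith
    calc _ ≤ ((4 : ℕ) ^ 2 + t ^ 2) * (((3 : ℕ) ^ 2 + t ^ 2) * (((2 : ℕ) ^ 2 + t ^ 2) *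
        (((1 : ℕ) ^ 2 + t ^ 2) * ((1 + 2 * π * t) * Real.exp (-π * t))))) := by gcongr
      _ = (4 ^ 2 + t ^ 2) * (3 ^ 2 + t ^ 2) * (2 ^ 2 + t ^ 2) * (1 ^ 2 + t ^ 2) *
        (1 + 2 * π * t) * Real.exp (-π * t) := by push_cast; ring
      _ ≤ (1900 ^ 2 * Real.exp t) * Real.exp (-3 * t) := by
        have := Real.pi_gt_three
        gcongr
      _ = 1900 ^ 2 * (Real.exp (-t)) ^ 2 := by
        rw [mul_assoc, ← Real.exp_add, ← Real.exp_nat_mul]; push_cast; ring_nf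
  rcases lt_trichotomy w.im 0 with h | h | h
  · have h1 := key (-w.im) (by linarith)
    have e : (5 : ℂ) + (-w.im : ℝ) * I = conj w := by apply Complex.ext <;> simp [hw]
    rwa [e, Gamma_conj, RCLike.norm_conj, ← abs_of_neg h] at h1
  · rw [h]
    have h1 : w = ((4 : ℕ) : ℂ) + 1 := by apply Complex.ext <;> simp [hw, h]; norm_num
    rw [h1, Gamma_nat_eq_factorial]
    norm_num [Nat.factorial]
  · have h1 := key w.im h
    have e : (5 : ℂ) + (w.im : ℝ) * I = w := by apply Complex.ext <;> simp [hw]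
    rwa [e, ← abs_of_pos h, ← abs_of_pos h, abs_abs] at h1

lemma norm_pi_cpow (w : ℂ) : ‖(π : ℂ) ^ w‖ = π ^ w.re :=
  norm_cpow_eq_rpow_re_of_pos Real.pi_pos w

lemma norm_riemannZeta_le {w : ℂ} {k : ℕ} {S : ℝ} (hk : 1 < k) (hw : k ≤ w.re)
    (hS : HasSum (fun n : ℕ => 1 / (n : ℝ) ^ k) S) : ‖riemannZeta w‖ ≤ S := by
  have h1 : (1 : ℝ) < k := by exact_mod_cast hk
  rw [zeta_eq_tsum_one_div_nat_cpow (by linarith)]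
  refine tsum_of_norm_bounded hS fun n => ?_
  rcases Nat.eq_zero_or_pos n with rfl | hn
  · have : w ≠ 0 := by rintro rfl; simp at hw; linarith
    rw [Nat.cast_zero, zero_cpow this]; simp
  · rw [norm_div, norm_one, norm_natCast_cpow_of_pos hn, ← Real.rpow_natCast]
    gcongr
    exact_mod_cast hn

lemma norm_entireXi_six {w : ℂ} (hw : w.re = 6) :
    ‖entireXi w‖ ≤ 2 * π / 45 * ‖Gamma (w / 2 + 2)‖ := by
  have hw1 : w ≠ 1 := by rintro rfl; norm_num at hw
  have h0 : w / 2 + 1 ≠ 0 := by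
    intro h; have := congrArg re h; simp [hw] at this; norm_num at this
  have e : entireXi w = 2 * ((w - 1) / (w / 2 + 1)) * Gamma (w / 2 + 2) * (π : ℂ) ^ (-w / 2)
      * riemannZeta w := by
    rw [show w / 2 + 2 = w / 2 + 1 + 1 by ring, entireXi_eq_Gamma (by linarith) hw1,
      Gamma_add_one _ h0, mul_div_assoc', div_mul_eq_mul_div, mul_comm (w / 2 + 1), ← mul_assoc,
      mul_div_cancel_right₀ _ h0]
  have hZ : ‖riemannZeta w‖ ≤ π ^ 4 / 90 :=
    norm_riemannZeta_le (k := 4) (by norm_num) (by rw [hw]; norm_num) hasSum_zeta_four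
  have hP : ‖(π : ℂ) ^ (-w / 2)‖ = (π ^ 3)⁻¹ := by
    rw [norm_pi_cpow]
    have : (-w / 2).re = -((3 : ℕ) : ℝ) := by simp [hw]; norm_num
    rw [this, Real.rpow_neg Real.pi_pos.le, Real.rpow_natCast]
  have hR : ‖(w - 1) / (w / 2 + 1)‖ ≤ 2 := by
    rw [norm_div, div_le_iff₀ (norm_pos_iff.2 h0)]
    refine le_of_sq_le_sq ?_ (by positivity)
    rw [mul_pow, Complex.sq_norm, Complex.sq_norm, normSq_apply, normSq_apply]
    simp [hw]
    nlinarith [sq_nonneg w.im]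
  rw [e, norm_mul, norm_mul, norm_mul, norm_mul, hP]
  calc ‖(2 : ℂ)‖ * ‖(w - 1) / (w / 2 + 1)‖ * ‖Gamma (w / 2 + 2)‖ * (π ^ 3)⁻¹ * ‖riemannZeta w‖
      ≤ 2 * 2 * ‖Gamma (w / 2 + 2)‖ * (π ^ 3)⁻¹ * (π ^ 4 / 90) := by
        gcongr
        simp
    _ = _ := by
      have := Real.pi_ne_zero
      field_simp
      ring

lemma entireXi_strip_of_edge {θ C : ℝ} (hθ : |θ| ≤ 1)
    (h6 : ∀ w : ℂ, w.re = 6 → ‖entireXi w‖ * Real.exp (θ * w.im / 2) ≤ C)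
    {w : ℂ} (h1 : -5 ≤ w.re) (h2 : w.re ≤ 6) :
    ‖entireXi w‖ * Real.exp (θ * w.im / 2) ≤ C := by
  have hd : Differentiable ℂ fun w => entireXi w * cexp (-(θ * I) * w / 2) := by
    have := differentiable_entireXi
    fun_prop
  have hn : ∀ w : ℂ, ‖entireXi w * cexp (-(θ * I) * w / 2)‖ =
      ‖entireXi w‖ * Real.exp (θ * w.im / 2) := by
    intro w
    rw [norm_mul, Complex.norm_exp]
    congr 2
    simp
  have h6' : ∀ z : ℂ, z.re = 6 → ‖entireXi z * cexp (-(θ * I) * z / 2)‖ ≤ C := by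
    intro z hz
    rw [hn]; exact h6 z hz
  have h5 : ∀ z : ℂ, z.re = -5 → ‖entireXi z * cexp (-(θ * I) * z / 2)‖ ≤ C := by
    intro z hz
    have := h6' (1 - conj z) (by simp [hz]; norm_num)
    rw [hn] at this ⊢
    rw [entireXi_one_sub, entireXi_conj, RCLike.norm_conj] at this
    simpa using this
  have key := PhragmenLindelof.vertical_strip (a := -5) (b := 6) (z := w) hd.diffContOnCl
    ?_ h5 h6' h1 h2
  · rwa [hn] at key
  · refine ⟨1 / 6, ?_, 18, ?_⟩
    · have := Real.pi_gt_three
      rw [lt_div_iff₀] <;> norm_num; linarith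
    · obtain ⟨C, hC0, hC⟩ := norm_entireXi_growth 6
      refine Asymptotics.IsBigO.of_bound C ?_
      refine eventually_inf_principal.2 (Eventually.of_forall fun z hz => ?_)
      simp only [mem_preimage, mem_Ioo] at hz
      have hz6 : |z.re| ≤ 6 := by rw [abs_le]; constructor <;> linarith
      rw [hn, Real.norm_of_nonneg (Real.exp_pos _).le]
      have hnz : 1 + ‖z‖ ≤ 7 + |z.im| := by linarith [norm_le_abs_re_add_abs_im z]
      have ht : θ * z.im / 2 ≤ |z.im| := by
        have h1 : θ * z.im ≤ |θ| * |z.im| := (le_abs_self _).trans (abs_mul _ _).le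
        nlinarith [abs_nonneg z.im]
      calc ‖entireXi z‖ * Real.exp (θ * z.im / 2)
          ≤ (C * (1 + ‖z‖) ^ 2) * Real.exp |z.im| := by
            gcongr; exact hC z hz6
        _ ≤ (C * (Real.exp (7 + |z.im|)) ^ 2) * Real.exp |z.im| := by
            gcongr
            linarith [Real.add_one_le_exp (7 + |z.im|)]
        _ = C * Real.exp (2 * (7 + |z.im|) + |z.im|) := by
            rw [Real.exp_add (2 * _), ← Real.exp_nat_mul]; push_cast; ring
        _ ≤ _ := by
            gcongr
            linarith [Real.add_one_le_exp (1 / 6 * |z.im|)]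

lemma norm_entireXi_le {w : ℂ} (h1 : -5 ≤ w.re) (h2 : w.re ≤ 6) :
    ‖entireXi w‖ ≤ 16 * π / 15 := by
  have := entireXi_strip_of_edge (θ := 0) (C := 16 * π / 15) (by simp) (fun z hz => ?_) h1 h2
  · simpa using this
  · have h5 : (z / 2 + 2).re = 5 := by simp [hz]; norm_num
    have hG := norm_Gamma_le (a := z / 2 + 2) (by rw [h5]; norm_num)
    have hG5 : Real.Gamma 5 = 24 := by
      rw [show (5 : ℝ) = ((4 : ℕ) : ℝ) + 1 by norm_num, Real.Gamma_nat_eq_factorial]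
      norm_num [Nat.factorial]
    rw [h5, hG5] at hG
    have := norm_entireXi_six hz
    simp only [zero_mul, zero_div, Real.exp_zero, mul_one]
    nlinarith [Real.pi_pos]

/-- Exponential decay in the strip. -/
lemma norm_entireXi_le_exp {w : ℂ} (h1 : -5 ≤ w.re) (h2 : w.re ≤ 6) :
    ‖entireXi w‖ ≤ 270 * Real.exp (-|w.im| / 2) := by
  have edge : ∀ θ : ℝ, |θ| = 1 → ∀ z : ℂ, z.re = 6 →
      ‖entireXi z‖ * Real.exp (θ * z.im / 2) ≤ 270 := by
    intro θ hθ z hz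
    have hG := norm_Gamma_five_le_exp (w := z / 2 + 2) (by simp [hz]; norm_num)
    have hb := norm_entireXi_six hz
    have him : |(z / 2 + 2).im| = |z.im| / 2 := by simp [abs_div]
    rw [him] at hG
    have ht : θ * z.im ≤ |z.im| := by
      calc θ * z.im ≤ |θ * z.im| := le_abs_self _
        _ = |z.im| := by rw [abs_mul, hθ, one_mul]
    calc _ ≤ 2 * 3.15 / 45 * (1900 * Real.exp (-(|z.im| / 2))) * Real.exp (|z.im| / 2) := by
          gcongr
          refine hb.trans ?_
          gcongr
          exact Real.pi_lt_d2.le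
      _ = 2 * 3.15 / 45 * 1900 := by
          rw [mul_assoc, mul_assoc, ← Real.exp_add]; simp
      _ ≤ _ := by norm_num
  have fin : ∀ θ : ℝ, |θ| = 1 → ‖entireXi w‖ ≤ 270 * Real.exp (-(θ * w.im / 2)) := by
    intro θ hθ
    have := entireXi_strip_of_edge hθ.le (edge θ hθ) h1 h2
    rwa [Real.exp_neg, ← div_eq_mul_inv, le_div_iff₀ (Real.exp_pos _)]
  rcases le_total 0 w.im with h | h
  · have := fin 1 (by simp)
    rw [abs_of_nonneg h]
    convert this using 3; ring
  · have := fin (-1) (by simp)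
    rw [abs_of_nonpos h]
    convert this using 3; ring

lemma hasSum_int_of_pairs {f : ℤ → ℂ} {S : ℂ} (hf : Summable f)
    (h : ∑' n : ℕ, (f (n + 1) + f (-(n + 1))) = S) : HasSum f (f 0 + S) := by
  have h1 := hf.hasSum.nat_add_neg
  rw [← hasSum_nat_add_iff' 1] at h1
  have h2 := h1.tsum_eq
  simp only [Nat.cast_add, Nat.cast_one, h, Finset.range_one, Finset.sum_singleton, Nat.cast_zero,
    neg_zero] at h2
  rw [show f 0 + S = ∑' k, f k by rw [h2]; ring]
  exact hf.hasSum

lemma hasSum_inv_sub_inv {x y : ℂ} (hx : x ∈ integerComplement) (hy : y ∈ integerComplement) :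
    HasSum (fun k : ℤ => 1 / (x + k) - 1 / (y + k)) (π * cot (π * x) - π * cot (π * y)) := by
  have hx' := fun k : ℤ => integerComplement_add_ne_zero hx k
  have hy' := fun k : ℤ => integerComplement_add_ne_zero hy k
  have hs : Summable (fun k : ℤ => 1 / (x + k) - 1 / (y + k)) := by
    have h : Summable fun k : ℤ => ((x + k) * (y + k))⁻¹ := by
      apply EisensteinSeries.summable_inv_of_isBigO_rpow_inv (a := 2) (by norm_num)
      simpa [pow_two] using (EisensteinSeries.linear_inv_isBigO_right 1 y).mul
        (EisensteinSeries.linear_inv_isBigO_right 1 x)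
    refine (h.mul_left (y - x)).congr fun k => ?_
    field_simp [hx' k, hy' k]
    ring
  have hcx := cot_series_rep' hx
  have hcy := cot_series_rep' hy
  have := hasSum_int_of_pairs hs (S := (π * cot (π * x) - 1 / x) - (π * cot (π * y) - 1 / y)) (by
    rw [hcx, hcy]
    have e1 := (summable_cotTerm hx)
    have e2 := (summable_cotTerm hy)
    unfold cotTerm at e1 e2
    rw [← e1.tsum_sub e2]
    congr 1; ext n
    push_cast
    ring)
  convert this using 1
  push_cast
  ring


lemma integerComplement_I_mul_div {w : ℂ} {c : ℝ} (hc : 0 < c) (hw : w ≠ 0) (hwc : |w.im| < c) :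
    I * w / c ∈ integerComplement := by
  rintro ⟨n, hn⟩
  have hc' : (c : ℂ) ≠ 0 := by exact_mod_cast hc.ne'
  have h : w = -I * (n * c) := by
    have := congrArg (fun x => -I * (x * c)) hn
    rw [this, div_mul_cancel₀ _ hc', ← mul_assoc]
    simp
  have him : w.im = -(n * c) := by
    rw [h]; simp
  rw [him, abs_neg, abs_mul, abs_of_pos hc] at hwc
  have : |(n : ℝ)| < 1 := by nlinarith
  have h0 : n = 0 := by
    rw [← Int.cast_abs] at this
    exact Int.abs_lt_one_iff.1 (by exact_mod_cast this)
  exact hw (by rw [h, h0]; simp)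

lemma hasSum_polar {w : ℂ} {h : ℝ} (hh : 0 < h) (h0 : w ≠ 0) (h1 : w ≠ 1)
    (hw : |w.im| < 2 * π / h) :
    HasSum (fun k : ℤ => 1 / ((w - I * k * (2 * π / h)) * (w - I * k * (2 * π / h) - 1)))
      (h * (sinh (h / 2) / (cosh ((w - 1 / 2) * h) - cosh (h / 2)))) := by
  set c : ℝ := 2 * π / h with hc
  have hcpos : 0 < c := by positivity
  have hc' : (c : ℂ) ≠ 0 := by exact_mod_cast hcpos.ne'
  have hh' : (h : ℂ) ≠ 0 := by exact_mod_cast hh.ne'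
  have hpi : (π : ℂ) ≠ 0 := by exact_mod_cast Real.pi_ne_zero
  have hx := integerComplement_I_mul_div hcpos h0 hw
  have hy := integerComplement_I_mul_div (w := w - 1) hcpos (sub_ne_zero.2 h1) (by simpa using hw)
  have hS := (hasSum_inv_sub_inv hy hx).mul_left (I / c)
  have hcc : (2 * π / h : ℂ) = c := by rw [hc]; push_cast; rfl
  have hsx : Complex.sin (π * (I * w / c)) ≠ 0 := Complex.sin_ne_zero_iff.2 (by
    intro k hk
    refine hx ⟨k, mul_left_cancel₀ hpi ?_⟩
    rw [hk]; ring)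
  have hsy : Complex.sin (π * (I * (w - 1) / c)) ≠ 0 := Complex.sin_ne_zero_iff.2 (by
    intro k hk
    refine hy ⟨k, mul_left_cancel₀ hpi ?_⟩
    rw [hk]; ring)
  suffices e2 : h * (sinh (h / 2) / (cosh ((w - 1 / 2) * h) - cosh (h / 2))) =
      I / c * (π * cot (π * (I * (w - 1) / c)) - π * cot (π * (I * w / c))) by
    rw [e2]
    have e3 : ∀ k : ℤ, 1 / ((w - I * k * (2 * π / h)) * (w - I * k * (2 * π / h) - 1)) =
        I / c * (1 / (I * (w - 1) / c + k) - 1 / (I * w / c + k)) := by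
      intro k
      have hx' := integerComplement_add_ne_zero hx k
      have hy' := integerComplement_add_ne_zero hy k
      rw [hcc]
      have ex : I * w / c + k = (I / c) * (w - I * k * c) := by
        field_simp; linear_combination ((k : ℂ) * c) * I_sq
      have ey : I * (w - 1) / c + k = (I / c) * (w - I * k * c - 1) := by
        field_simp; linear_combination ((k : ℂ) * c) * I_sq
      rw [ex] at hx' ⊢
      rw [ey] at hy' ⊢
      have hx2 := right_ne_zero_of_mul hx'
      have hy2 := right_ne_zero_of_mul hy'
      have hI := I_ne_zero
      field_simp
      ring
    simpa only [e3] using hS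
  have ax : (π * (I * w / c) : ℂ) = (w * h / 2) * I := by
    rw [← hcc]; field_simp
  have ay : (π * (I * (w - 1) / c) : ℂ) = ((w - 1) * h / 2) * I := by
    rw [← hcc]; field_simp
  have hpc : (I / c : ℂ) * π = I * h / 2 := by rw [← hcc]; field_simp
  rw [ax] at hsx ⊢
  rw [ay] at hsy ⊢
  rw [← mul_sub, ← mul_assoc, hpc, cot, cot]
  rw [div_sub_div _ _ hsy hsx]
  rw [Complex.sin_mul_I] at hsx hsy
  have hsx := left_ne_zero_of_mul hsx
  have hsy := left_ne_zero_of_mul hsy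
  have key : cosh ((w - 1 / 2) * h) - cosh (h / 2) = 2 * sinh ((w - 1) * h / 2) *
      sinh (w * h / 2) := by
    rw [show (w - 1 / 2) * h = w * h / 2 + (w - 1) * h / 2 by ring,
      show (h / 2 : ℂ) = w * h / 2 - (w - 1) * h / 2 by ring, cosh_add, cosh_sub]
    ring
  have key2 : sinh ((h : ℂ) / 2) = sinh (w * h / 2) * cosh ((w - 1) * h / 2) -
      cosh (w * h / 2) * sinh ((w - 1) * h / 2) := by
    rw [show (h / 2 : ℂ) = w * h / 2 - (w - 1) * h / 2 by ring, sinh_sub]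
  rw [key, key2]
  simp only [Complex.sin_mul_I, Complex.cos_mul_I]
  have hI := I_ne_zero
  field_simp

lemma completedRiemannZeta₀_eq_entireXi {w : ℂ} (h0 : w ≠ 0) (h1 : w ≠ 1) :
    completedRiemannZeta₀ w = entireXi w / (w * (w - 1)) - 1 / (w * (w - 1)) := by
  have := sub_ne_zero.2 h1
  rw [entireXi]
  field_simp
  ring

lemma fourier_thetaF {h : ℝ} (hh : 0 < h) (w : ℂ) (k : ℝ) :
    FourierTransform.fourier (fun v : ℝ => (thetaF (h * v) : ℂ) * cexp ((w - 1 / 2) * (h * v))) k =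
      completedRiemannZeta₀ (w - I * k * (2 * π / h)) / h := by
  have hh' : (h : ℂ) ≠ 0 := by exact_mod_cast hh.ne'
  have e := completedRiemannZeta₀_eq_integral (w - I * k * (2 * π / h) - 1 / 2)
  rw [show 1 / 2 + (w - I * k * (2 * π / h) - 1 / 2) = w - I * k * (2 * π / h) by ring] at e
  rw [e, Real.fourier_eq']
  have := Measure.integral_comp_mul_left (fun v : ℝ => (thetaF v : ℂ) *
    cexp ((w - I * k * (2 * π / h) - 1 / 2) * v)) h
  rw [abs_of_pos (inv_pos.2 hh)] at this
  have e3 : ∀ x : ℂ, x / h = h⁻¹ • x := fun x => by rw [real_smul]; push_cast; ring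
  rw [e3, ← this]
  congr 1; ext v
  simp only [RCLike.inner_apply, conj_trivial, smul_eq_mul]
  rw [mul_left_comm, ← Complex.exp_add]
  congr 2
  push_cast
  field_simp
  ring

lemma isBigO_thetaF {h : ℝ} (hh : 0 < h) (w : ℂ) :
    (fun v : ℝ => (thetaF (h * v) : ℂ) * cexp ((w - 1 / 2) * (h * v))) =O[cocompact ℝ]
      fun x : ℝ => |x| ^ (-2 : ℝ) := by
  refine Asymptotics.IsBigO.of_bound (3 * Real.exp ((1 / 2 + |(w - 1 / 2).re|) ^ 2 / 4) *
    (5 * h ^ 2)⁻¹) ?_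
  filter_upwards [(isCompact_singleton (x := (0 : ℝ))).compl_mem_cocompact] with v hv
  have hv : v ≠ 0 := by simpa using hv
  have := norm_thetaF_mul_exp_le (z := w - 1 / 2) le_rfl (h * v)
  push_cast at this
  refine this.trans ?_
  rw [mul_assoc (_ * _)]
  refine mul_le_mul_of_nonneg_left ?_ (by positivity)
  rw [Real.norm_of_nonneg (by positivity), Real.rpow_neg (abs_nonneg _), Real.rpow_two, sq_abs,
    ← mul_inv, show -5 * (h * v) ^ 2 = -(5 * h ^ 2 * v ^ 2) by ring, Real.exp_neg]
  have : 0 < 5 * h ^ 2 * v ^ 2 := by positivity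
  gcongr
  linarith [Real.add_one_le_exp (5 * h ^ 2 * v ^ 2)]

lemma summable_thetaF {h : ℝ} (hh : 0 < h) (w : ℂ) :
    Summable fun n : ℤ => (thetaF (h * n) : ℂ) * cexp ((w - 1 / 2) * (h * n)) := by
  have := summable_of_isBigO (Real.summable_abs_int_rpow one_lt_two)
    ((isBigO_thetaF hh w).comp_tendsto Int.tendsto_coe_cofinite)
  refine this.congr fun n => ?_
  simp

/-- Poisson summation for the trapezoidal sum with step `h`. -/
lemma hasSum_entireXi_trapezoid {w : ℂ} {h : ℝ} (hh : 0 < h) (h0 : w ≠ 0) (h1 : w ≠ 1)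
    (hw : |w.im| < 2 * π / h) (hl : -5 ≤ w.re) (hr : w.re ≤ 6) :
    HasSum (fun k : ℤ => entireXi (w - I * k * (2 * π / h)) /
        ((w - I * k * (2 * π / h)) * (w - I * k * (2 * π / h) - 1)))
      (h * (∑' n : ℤ, (thetaF (h * n) : ℂ) * cexp ((w - 1 / 2) * (h * n)))
        + h * (sinh (h / 2) / (cosh ((w - 1 / 2) * h) - cosh (h / 2)))) := by
  have hh' : (h : ℂ) ≠ 0 := by exact_mod_cast hh.ne'
  have hp := hasSum_polar hh h0 h1 hw
  have hre : ∀ k : ℤ, (w - I * k * (2 * π / h)).re = w.re := by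
    intro k
    have : (2 * π / h : ℂ) = ((2 * π / h : ℝ) : ℂ) := by push_cast; rfl
    rw [this]; simp [mul_re]
  have him : ∀ k : ℤ, (w - I * k * (2 * π / h)).im = w.im - k * (2 * π / h) := by
    intro k
    have : (2 * π / h : ℂ) = ((2 * π / h : ℝ) : ℂ) := by push_cast; rfl
    rw [this]; simp [mul_im]
  have hne : ∀ k : ℤ, k ≠ 0 → (w - I * k * (2 * π / h)).im ≠ 0 := by
    intro k hk h2
    rw [him] at h2
    have hc : 0 < 2 * π / h := by positivity
    have : |w.im| = |(k : ℝ)| * (2 * π / h) := by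
      rw [sub_eq_zero.1 h2, abs_mul, abs_of_pos hc]
    have hk1 : (1 : ℝ) ≤ |(k : ℝ)| := by exact_mod_cast Int.one_le_abs hk
    nlinarith
  have hk0 : ∀ k : ℤ, w - I * k * (2 * π / h) ≠ 0 := by
    intro k
    by_cases hk : k = 0
    · simpa [hk] using h0
    · intro h2; exact hne k hk (by rw [h2]; simp)
  have hk1 : ∀ k : ℤ, w - I * k * (2 * π / h) ≠ 1 := by
    intro k
    by_cases hk : k = 0
    · simpa [hk] using h1
    · intro h2; exact hne k hk (by rw [h2]; simp)
  have hsum : Summable (fun k : ℤ => entireXi (w - I * k * (2 * π / h)) /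
        ((w - I * k * (2 * π / h)) * (w - I * k * (2 * π / h) - 1))) := by
    refine Summable.of_norm_bounded (hp.summable.norm.mul_left (16 * π / 15)) fun k => ?_
    rw [div_eq_mul_one_div, norm_mul]
    exact mul_le_mul_of_nonneg_right (norm_entireXi_le (by rw [hre]; exact hl)
      (by rw [hre]; exact hr)) (norm_nonneg _)
  have hL : ∀ k : ℤ, completedRiemannZeta₀ (w - I * k * (2 * π / h)) =
      entireXi (w - I * k * (2 * π / h)) /
        ((w - I * k * (2 * π / h)) * (w - I * k * (2 * π / h) - 1)) -
      1 / ((w - I * k * (2 * π / h)) * (w - I * k * (2 * π / h) - 1)) := fun k =>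
    completedRiemannZeta₀_eq_entireXi (hk0 k) (hk1 k)
  set f : ℝ → ℂ := fun v : ℝ => (thetaF (h * v) : ℂ) * cexp ((w - 1 / 2) * (h * v)) with hf
  have hF : ∀ k : ℤ, FourierTransform.fourier f k =
      (entireXi (w - I * k * (2 * π / h)) /
        ((w - I * k * (2 * π / h)) * (w - I * k * (2 * π / h) - 1)) -
      1 / ((w - I * k * (2 * π / h)) * (w - I * k * (2 * π / h) - 1))) / h := by
    intro k
    rw [hf, fourier_thetaF hh, ← hL]
    simp
  have hdec : f =O[cocompact ℝ] fun x : ℝ => |x| ^ (-2 : ℝ) := isBigO_thetaF hh w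
  have hcont : Continuous f := by
    have := continuous_thetaF
    simp only [hf]
    fun_prop
  have hP := Real.tsum_eq_tsum_fourier_of_rpow_decay_of_summable hcont one_lt_two hdec
    (by simp only [hF]; exact ((hsum.sub hp.summable).div_const _)) 0
  simp only [zero_add, hF] at hP
  have h2 : HasSum (fun k : ℤ => entireXi (w - I * k * (2 * π / h)) /
        ((w - I * k * (2 * π / h)) * (w - I * k * (2 * π / h) - 1)) -
      1 / ((w - I * k * (2 * π / h)) * (w - I * k * (2 * π / h) - 1)))
      (h * ∑' n : ℤ, f n) := by
    have e4 := (hsum.sub hp.summable).hasSum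
    rw [hP, ← tsum_mul_left]
    simpa [mul_div_cancel₀ _ hh'] using e4
  have h3 := h2.add hp
  simp only [sub_add_cancel] at h3
  simpa [hf] using h3

lemma HasSum.int_pairs {f : ℤ → ℂ} {S : ℂ} (hf : HasSum f S) :
    HasSum (fun n : ℕ => f (n + 1) + f (-(n + 1))) (S - f 0) := by
  have h1 := hf.nat_add_neg
  rw [← hasSum_nat_add_iff' 1] at h1
  have e : S + f 0 - ∑ i ∈ Finset.range 1, (f i + f (-(i : ℤ))) = S - f 0 := by simp
  rw [e] at h1
  simpa using h1

lemma exp_neg_17_lt : Real.exp (-(71 / 4)) ≤ 0.0000000196 := by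
  have h := Real.exp_one_gt_d9
  have : Real.exp (-(71 / 4)) ^ 4 ≤ (0.0000000196) ^ 4 := by
    rw [← Real.exp_nat_mul, show ((4 : ℕ) : ℝ) * -(71 / 4) = -((71 : ℕ) * 1) by norm_num,
      Real.exp_neg, Real.exp_nat_mul]
    rw [inv_le_comm₀ (by positivity) (by norm_num)]
    calc ((0.0000000196 : ℝ) ^ 4)⁻¹ ≤ 2.7182818283 ^ 71 := by norm_num
      _ ≤ _ := by gcongr
  exact le_of_pow_le_pow_left₀ (by norm_num) (by norm_num) this

lemma norm_mul_sub_one_le {w : ℂ} (hl : 0 ≤ w.re) (hr : w.re ≤ 2) (hi : |w.im| ≤ 59 / 4) :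
    ‖w * (w - 1)‖ ≤ 225 := by
  have h2 : w.im ^ 2 ≤ (59 / 4) ^ 2 := sq_le_sq' (abs_le.1 hi).1 (abs_le.1 hi).2
  have a1 : ‖w‖ ≤ 15 := by
    refine le_of_pow_le_pow_left₀ two_ne_zero (by norm_num) ?_
    rw [Complex.sq_norm, normSq_apply]; nlinarith
  have a2 : ‖w - 1‖ ≤ 15 := by
    refine le_of_pow_le_pow_left₀ two_ne_zero (by norm_num) ?_
    rw [Complex.sq_norm, normSq_apply]; simp; nlinarith
  rw [norm_mul]
  nlinarith [norm_nonneg w, norm_nonneg (w - 1)]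

lemma norm_alias_term {w : ℂ} (hl : 0 ≤ w.re) (hr : w.re ≤ 2) (hi : |w.im| ≤ 59 / 4) {k : ℤ}
    (hk : k ≠ 0) (u : ℂ) (hu : u = w - I * k * (2 * π / ((1 / 8 : ℝ) : ℂ))) :
    ‖entireXi u / (u * (u - 1))‖ ≤ 0.0000000043 * (1 / (k : ℝ) ^ 2) := by
  have hc : (2 * π / ((1 / 8 : ℝ) : ℂ)) = ((16 * π : ℝ) : ℂ) := by push_cast; ring
  rw [hc] at hu
  have hre : u.re = w.re := by rw [hu]; simp [mul_re]
  have him : u.im = w.im - k * (16 * π) := by rw [hu]; simp [mul_im]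
  have hk1 : (1 : ℝ) ≤ |(k : ℝ)| := by exact_mod_cast Int.one_le_abs hk
  have hpi := Real.pi_gt_d6
  have hy : 35.5 * |(k : ℝ)| ≤ |u.im| := by
    rw [him]
    have h1 : |(k : ℝ) * (16 * π)| = |(k : ℝ)| * (16 * π) := by
      rw [abs_mul, abs_of_pos (by positivity : 0 < 16 * π)]
    have h2 := abs_sub_abs_le_abs_sub ((k : ℝ) * (16 * π)) w.im
    rw [abs_sub_comm, h1] at h2
    nlinarith
  have hE := norm_entireXi_le_exp (w := u) (by linarith) (by linarith)
  have hE2 : ‖entireXi u‖ ≤ 270 * 0.0000000196 := by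
    refine hE.trans (mul_le_mul_of_nonneg_left ((Real.exp_le_exp.2 ?_).trans exp_neg_17_lt)
      (by norm_num))
    linarith
  have hden : 35.5 ^ 2 * (k : ℝ) ^ 2 ≤ ‖u * (u - 1)‖ := by
    have b1 : |u.im| ≤ ‖u‖ := abs_im_le_norm u
    have b2 : |u.im| ≤ ‖u - 1‖ := by simpa using abs_im_le_norm (u - 1)
    rw [norm_mul, ← sq_abs (k : ℝ), ← mul_pow, sq]
    gcongr <;> linarith
  have hk2 : 0 < (k : ℝ) ^ 2 := by positivity
  rw [norm_div]
  calc _ ≤ 270 * 0.0000000196 / (35.5 ^ 2 * (k : ℝ) ^ 2) := by gcongr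
    _ ≤ _ := by
      rw [← div_div, div_eq_mul_one_div]
      gcongr
      norm_num

lemma exp_neg_tail : Real.exp (-21) ≤ 0.00000000076 := by
  have h := Real.exp_one_gt_d9
  rw [show (-21 : ℝ) = -((21 : ℕ) * 1) by norm_num, Real.exp_neg, Real.exp_nat_mul]
  rw [inv_le_comm₀ (by positivity) (by norm_num)]
  calc (0.00000000076 : ℝ)⁻¹ ≤ 2.7182818283 ^ 21 := by norm_num
    _ ≤ _ := by gcongr

lemma thetaF_le_of_one_le {v : ℝ} (hv : 1 ≤ v) : thetaF v ≤ 3 * Real.exp (23 - 45.5 * v) := by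
  refine (thetaF_le' v).trans (mul_le_mul_of_nonneg_left (Real.exp_le_exp.2 ?_) (by norm_num))
  rw [abs_of_pos (by linarith)]
  have h := Real.exp_one_gt_d9
  have h1 : Real.exp (2 * v) = Real.exp 1 ^ 2 * Real.exp (2 * (v - 1)) := by
    rw [← Real.exp_nat_mul, ← Real.exp_add]; congr 1; push_cast; ring
  have h2 := Real.add_one_le_exp (2 * (v - 1))
  have h3 : 7.38 ≤ Real.exp 1 ^ 2 := by nlinarith
  have h4 : 7.38 * (2 * v - 1) ≤ Real.exp (2 * v) := by
    rw [h1]; apply mul_le_mul h3 <;> linarith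
  have hpi := Real.pi_gt_d2
  nlinarith [mul_le_mul hpi.le h4 (by linarith) Real.pi_pos.le]

lemma norm_cosh_le (z : ℂ) : ‖cosh z‖ ≤ Real.exp |z.re| := by
  rw [cosh, norm_div]
  have a : ‖cexp z‖ ≤ Real.exp |z.re| := by
    rw [Complex.norm_exp]; exact Real.exp_le_exp.2 (le_abs_self _)
  have b : ‖cexp (-z)‖ ≤ Real.exp |z.re| := by
    rw [Complex.norm_exp]; exact Real.exp_le_exp.2 (by simpa using neg_le_abs z.re)
  have := norm_add_le (cexp z) (cexp (-z))
  simp only [RCLike.norm_ofNat]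
  linarith

noncomputable def trapezoidTerm (z : ℂ) (m : ℕ) : ℂ := 2 * thetaF (m / 8) * cosh (z * (m / 8))

lemma norm_trapezoidTerm_le {z : ℂ} (hz : |z.re| ≤ 3 / 2) {m : ℕ} (hm : 8 ≤ m) :
    ‖trapezoidTerm z m‖ ≤ 6 * Real.exp (-21) * (1 / 2) ^ (m - 8) := by
  have hv : (1 : ℝ) ≤ m / 8 := by
    have : (8 : ℝ) ≤ m := by exact_mod_cast hm
    linarith
  rw [trapezoidTerm, norm_mul, norm_mul, norm_real, Real.norm_of_nonneg (thetaF_nonneg _)]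
  have hre : (z * (m / 8)).re = z.re * (m / 8) := by
    have : (m / 8 : ℂ) = ((m / 8 : ℝ) : ℂ) := by push_cast; rfl
    rw [this, re_mul_ofReal]
  have hc := norm_cosh_le (z * (m / 8))
  rw [hre, abs_mul, abs_of_nonneg (by linarith : (0 : ℝ) ≤ m / 8)] at hc
  have hc2 : ‖cosh (z * (m / 8))‖ ≤ Real.exp (3 / 2 * (m / 8)) :=
    hc.trans (Real.exp_le_exp.2 (by gcongr))
  have hlog : Real.exp (-1) ≤ 1 / 2 := by
    rw [Real.exp_neg, one_div]
    have := Real.exp_one_gt_d9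
    gcongr; linarith
  calc _ ≤ 2 * (3 * Real.exp (23 - 45.5 * (m / 8))) * Real.exp (3 / 2 * (m / 8)) := by
        have := thetaF_le_of_one_le hv
        rw [RCLike.norm_ofNat]
        gcongr
    _ = 6 * (Real.exp (23 - 45.5 * (m / 8)) * Real.exp (3 / 2 * (m / 8))) := by ring
    _ = 6 * Real.exp (-21 + -(44 * (m / 8 - 1))) := by rw [← Real.exp_add]; ring_nf
    _ ≤ 6 * (Real.exp (-21) * Real.exp ((m - 8 : ℕ) * -1)) := by
        rw [← Real.exp_add]
        refine mul_le_mul_of_nonneg_left (Real.exp_le_exp.2 ?_) (by norm_num)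
        push_cast [Nat.cast_sub hm]
        linarith
    _ ≤ _ := by
        rw [← mul_assoc, Real.exp_nat_mul]
        gcongr

/-- The trapezoidal approximation, with an explicit error. -/
lemma entireXi_approx {w : ℂ} (hl : 0 ≤ w.re) (hr : w.re ≤ 2) (hi : |w.im| ≤ 59 / 4)
    (h0 : w ≠ 0) (h1 : w ≠ 1) :
    ‖entireXi w - w * (w - 1) * (1 / 8) * (thetaF 0 +
      ∑ m ∈ Finset.range 7, trapezoidTerm (w - 1 / 2) (m + 1) +
      sinh (1 / 16) / (cosh ((w - 1 / 2) / 8) - cosh (1 / 16)))‖ ≤ 0.000004 := by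
  have hpi := Real.pi_gt_d6
  have hS := hasSum_entireXi_trapezoid (h := 1 / 8) (by norm_num) h0 h1 (by linarith)
    (by linarith) (by linarith)
  have hA := HasSum.int_pairs hS
  have hT := HasSum.int_pairs (summable_thetaF (h := 1 / 8) (by norm_num) w).hasSum
  set z := w - 1 / 2 with hz
  set A : ℂ := ∑' n : ℤ, (thetaF (1 / 8 * n) : ℂ) * cexp (z * (((1 / 8 : ℝ) : ℂ) * n)) with hAdef
  have hT' : HasSum (fun n : ℕ => trapezoidTerm z (n + 1)) (A - thetaF 0) := by
    convert hT using 1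
    · ext n
      have e1 : (1 / 8 * ((-((n : ℤ) + 1) : ℤ) : ℝ)) = -(((n + 1 : ℕ) : ℝ) / 8) := by
        push_cast; ring
      have e2 : (1 / 8 * (((n : ℤ) + 1 : ℤ) : ℝ)) = (((n + 1 : ℕ) : ℝ) / 8) := by
        push_cast; ring
      rw [e1, e2, thetaF_neg, trapezoidTerm, cosh]
      push_cast
      ring_nf
    · simp
  have hzre : |z.re| ≤ 3 / 2 := by
    rw [hz, abs_le]; constructor <;> simp <;> linarith
  have hTt : ‖A - thetaF 0 - ∑ m ∈ Finset.range 7, trapezoidTerm z (m + 1)‖ ≤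
      6 * Real.exp (-21) * 2 := by
    rw [← hasSum_nat_add_iff' 7] at hT'
    refine tsum_of_norm_bounded (f := fun n : ℕ => trapezoidTerm z (n + 7 + 1))
      (g := fun n : ℕ => 6 * Real.exp (-21) * (1 / 2) ^ n)
      (hasSum_geometric_two.mul_left _) (fun n => ?_) |>.trans' (le_of_eq ?_)
    · simpa using norm_trapezoidTerm_le hzre (m := n + 7 + 1) (by omega)
    · rw [hT'.tsum_eq]
  have hz2 : HasSum (fun n : ℕ => 2 * 0.0000000043 * (1 / ((n : ℝ) + 1) ^ 2))
      (2 * 0.0000000043 * (π ^ 2 / 6)) := by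
    have := hasSum_zeta_two
    rw [← hasSum_nat_add_iff' 1] at this
    simpa using this.mul_left (2 * 0.0000000043)
  have hAl := tsum_of_norm_bounded hz2 (fun n => by
    have a1 := norm_alias_term hl hr hi (k := n + 1) (by omega) _ rfl
    have a2 := norm_alias_term hl hr hi (k := -(n + 1)) (by omega) _ rfl
    refine (norm_add_le _ _).trans ((add_le_add a1 a2).trans (le_of_eq ?_))
    push_cast
    ring)
  rw [hA.tsum_eq] at hAl
  simp only [Int.cast_zero, mul_zero, zero_mul, sub_zero] at hAl
  have h1' := sub_ne_zero.2 h1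
  have hb := norm_mul_sub_one_le hl hr hi
  have e : entireXi w - w * (w - 1) * (1 / 8) * (thetaF 0 +
      ∑ m ∈ Finset.range 7, trapezoidTerm z (m + 1) +
      sinh (1 / 16) / (cosh (z / 8) - cosh (1 / 16))) =
      w * (w - 1) * (1 / 8 * (A - thetaF 0 - ∑ m ∈ Finset.range 7, trapezoidTerm z (m + 1)) -
      (((1 / 8 : ℝ) : ℂ) * A + ((1 / 8 : ℝ) : ℂ) * (sinh (((1 / 8 : ℝ) : ℂ) / 2) /
        (cosh (z * ((1 / 8 : ℝ) : ℂ)) - cosh (((1 / 8 : ℝ) : ℂ) / 2))) -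
        entireXi w / (w * (w - 1)))) := by
    have c1 : (((1 / 8 : ℝ) : ℂ) / 2) = 1 / 16 := by push_cast; norm_num
    have c2 : z * ((1 / 8 : ℝ) : ℂ) = z / 8 := by push_cast; ring
    rw [c1, c2]
    push_cast
    generalize sinh (1 / 16) / (cosh (z / 8) - cosh (1 / 16)) = q
    field_simp
    ring
  rw [e, norm_mul]
  have hpi2 : π ^ 2 / 6 ≤ 1.65 := by nlinarith [Real.pi_lt_d6]
  have ht := exp_neg_tail
  have f1 : ‖(1 / 8 : ℂ) * (A - thetaF 0 - ∑ m ∈ Finset.range 7, trapezoidTerm z (m + 1))‖ ≤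
      1 / 8 * (6 * 0.00000000076 * 2) := by
    rw [norm_mul]
    have : ‖(1 / 8 : ℂ)‖ = 1 / 8 := by norm_num
    rw [this]
    linarith
  have f2 := (norm_sub_le _ _).trans (add_le_add f1 hAl)
  refine (mul_le_mul hb f2 (norm_nonneg _) (by norm_num)).trans ?_
  linarith

lemma norm_sub_lineMap_le {f f' f'' : ℝ → ℂ} {K θ : ℝ} (h1 : ∀ x, HasDerivAt f (f' x) x)
    (h2 : ∀ x, HasDerivAt f' (f'' x) x) (hK : ∀ x, ‖f'' x‖ ≤ K) (h0 : 0 ≤ θ) (hθ : θ ≤ 1) :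
    ‖f θ - ((1 - θ) * f 0 + θ * f 1)‖ ≤ K / 8 := by
  set e : ℂ := f θ - ((1 - θ) * f 0 + θ * f 1) with he
  rcases eq_or_ne e 0 with h | hne
  · rw [h, norm_zero]; have := (norm_nonneg _).trans (hK 0); positivity
  set u : ℂ := conj e / ‖e‖ with hu
  have hun : ‖u‖ = 1 := by
    rw [hu, norm_div, norm_conj, norm_real, norm_norm, div_self (norm_ne_zero_iff.2 hne)]
  have hue : u * e = ‖e‖ := by
    have : (‖e‖ : ℂ) ≠ 0 := by exact_mod_cast norm_ne_zero_iff.2 hne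
    rw [hu, div_mul_eq_mul_div, mul_comm, mul_conj, normSq_eq_norm_sq]
    field_simp; push_cast; ring
  have hre (g g' : ℝ → ℂ) (h : ∀ x, HasDerivAt g (g' x) x) (x : ℝ) :
      HasDerivAt (fun x => (u * g x).re) ((u * g' x).re) x :=
    Complex.reCLM.hasFDerivAt.comp_hasDerivAt x ((h x).const_mul u)
  have hconv : ConvexOn ℝ univ (fun x => (u * f x).re + K * x ^ 2 / 2) := by
    refine convexOn_of_hasDerivWithinAt2_nonneg (f' := fun x => (u * f' x).re + K * x)
      (f'' := fun x => (u * f'' x).re + K) convex_univ ?_ ?_ ?_ ?_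
    · exact fun x _ => ((hre _ _ h1 x).continuousAt.add (by fun_prop)).continuousWithinAt
    · intro x _
      have h := (hre _ _ h1 x).add ((((hasDerivAt_id x).pow 2).const_mul (K / 2)))
      refine (h.congr_deriv ?_).congr_of_eventuallyEq ?_ |>.hasDerivWithinAt
      · simp; ring
      · filter_upwards with y; simp; ring
    · intro x _
      have h := (hre _ _ h2 x).add ((((hasDerivAt_id x)).const_mul K))
      refine (h.congr_deriv ?_).congr_of_eventuallyEq ?_ |>.hasDerivWithinAt
      · simp
      · filter_upwards with y; simp
    · intro x _
      have := (abs_re_le_norm (u * f'' x))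
      rw [norm_mul, hun, one_mul] at this
      have := (abs_le.1 this).1
      have := hK x
      linarith
  have h := hconv.2 (mem_univ 0) (mem_univ 1) (sub_nonneg.2 hθ) h0 (by ring)
  simp only [smul_eq_mul, mul_zero, zero_add, mul_one] at h
  have h3 : (u * e).re = ‖e‖ := by rw [hue, ofReal_re]
  have h4 : (u * e).re = (u * f θ).re - ((1 - θ) * (u * f 0).re + θ * (u * f 1).re) := by
    rw [he, mul_sub, mul_add, sub_re, add_re]
    congr 2
    · rw [mul_left_comm, ← ofReal_one, ← ofReal_sub, re_ofReal_mul]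
    · rw [mul_left_comm, re_ofReal_mul]
  have hK0 := (norm_nonneg _).trans (hK 0)
  nlinarith [mul_nonneg hK0 (sq_nonneg (2 * θ - 1))]

lemma norm_deriv_deriv_entireXi_le {w : ℂ} (h0 : 0 ≤ w.re) (h1 : w.re ≤ 3 / 2) :
    ‖deriv (deriv entireXi) w‖ ≤ 1 / 3 := by
  have h := norm_iteratedDeriv_le_of_forall_mem_sphere_norm_le (c := w) (R := 9 / 2)
    (C := 16 * π / 15) 2 (f := entireXi) (by norm_num)
    differentiable_entireXi.diffContOnCl (by
      intro z hz
      have := (abs_re_le_norm (z - w)).trans_eq (mem_sphere_iff_norm.1 hz)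
      rw [sub_re, abs_le] at this
      exact norm_entireXi_le (by linarith) (by linarith))
  rw [iteratedDeriv_succ, iteratedDeriv_one] at h
  refine h.trans ?_
  norm_num
  nlinarith [Real.pi_lt_d4]

lemma hasDerivAt_comp_vertical {f : ℂ → ℂ} (hf : Differentiable ℂ f) (w : ℂ) (d x : ℝ) :
    HasDerivAt (fun x : ℝ => f (w + x * d * I)) (d * I * deriv f (w + x * d * I)) x := by
  have h : HasDerivAt (fun z : ℂ => w + z * d * I) (d * I) (x : ℂ) := by
    have := (((hasDerivAt_id (x : ℂ)).mul_const (d : ℂ)).mul_const I).const_add w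
    simpa using this
  have := (HasDerivAt.comp (x : ℂ) (h₂ := f) (hf _).hasDerivAt h).comp_ofReal
  simpa [mul_comm, Function.comp_def] using this

/-- A function with second derivative bounded by `K` on a vertical line is close to its linear
interpolation between two points of the line. -/
lemma norm_sub_segment_le {f : ℂ → ℂ} {w : ℂ} {K d θ : ℝ} (hf : Differentiable ℂ f)
    (hK : ∀ z : ℂ, z.re = w.re → ‖deriv (deriv f) z‖ ≤ K) (h0 : 0 ≤ θ) (hθ : θ ≤ 1) :
    ‖f (w + θ * d * I) - ((1 - θ) * f w + θ * f (w + d * I))‖ ≤ d ^ 2 * K / 8 := by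
  have h := norm_sub_lineMap_le (f := fun x : ℝ => f (w + x * d * I))
    (f' := fun x : ℝ => d * I * deriv f (w + x * d * I))
    (f'' := fun x : ℝ => d * I * (d * I * deriv (deriv f) (w + x * d * I))) (K := d ^ 2 * K)
    (hasDerivAt_comp_vertical hf w d)
    (fun x => (hasDerivAt_comp_vertical hf.deriv w d x).const_mul _) (fun x => ?_) h0 hθ
  · simpa using h
  · simp only [norm_mul, norm_I, mul_one, norm_real, Real.norm_eq_abs]
    have : ‖deriv (deriv f) (w + x * d * I)‖ ≤ K := hK _ (by simp)
    rw [← mul_assoc, ← sq, sq_abs]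
    exact mul_le_mul_of_nonneg_left this (sq_nonneg d)

/-- A disc in fixed-point arithmetic: centre `(re + im * I) / 2 ^ 64`, radius `rad / 2 ^ 64`. -/
structure CBall where
  re : ℤ
  im : ℤ
  rad : ℤ

namespace CBall

/-- The fixed-point unit `2 ^ 64`. -/
def scale : ℤ := 18446744073709551616

/-- An upper bound for `√(M ^ 2 + m ^ 2)` when `m ≤ M`. -/
def hypotUB (M m : ℕ) : ℕ :=
  (bif Nat.ble (2 * m) M then 10000 * M + 2361 * m else 8220 * M + 5923 * m) / 10000 + 1

/-- An upper bound for `√(x ^ 2 + y ^ 2)`. -/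
def normUB (x y : ℤ) : ℤ :=
  Int.ofNat (bif Nat.ble x.natAbs y.natAbs then hypotUB y.natAbs x.natAbs
    else hypotUB x.natAbs y.natAbs)

/-- The centre of the disc, multiplied by `2 ^ 64`. -/
noncomputable def center (a : CBall) : ℂ := a.re + a.im * I

/-- The point `z` lies in the disc `a`. -/
def Holds (a : CBall) (z : ℂ) : Prop := ‖z * scale - a.center‖ ≤ a.rad

def abs (a : CBall) : ℤ := normUB a.re a.im + a.rad

def add (a b : CBall) : CBall := ⟨a.re + b.re, a.im + b.im, a.rad + b.rad⟩

def sub (a b : CBall) : CBall := ⟨a.re - b.re, a.im - b.im, a.rad + b.rad⟩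

def mul (a b : CBall) : CBall :=
  ⟨(a.re * b.re - a.im * b.im) / scale, (a.re * b.im + a.im * b.re) / scale,
    (normUB a.re a.im * b.rad + normUB b.re b.im * a.rad + a.rad * b.rad) / scale + 3⟩

def star (a : CBall) : CBall := ⟨a.re, -a.im, a.rad⟩

def inflate (a : CBall) (r : ℤ) : CBall := ⟨a.re, a.im, a.rad + r⟩

/-- Multiplication by `n / d`. -/
def smul (n d : ℕ) (a : CBall) : CBall :=
  ⟨a.re * n / d, a.im * n / d, a.rad * n / d + 3⟩

/-- The denominator in the radius of `inv a`. -/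
def invDen (a : CBall) : ℤ := a.re * a.re + a.im * a.im - a.rad * normUB a.re a.im

def inv (a : CBall) : CBall :=
  ⟨a.re * scale * scale / (a.re * a.re + a.im * a.im),
    -a.im * scale * scale / (a.re * a.re + a.im * a.im),
    a.rad * scale * scale / invDen a + 3⟩

def rat (n : ℤ) (d : ℕ) : CBall := ⟨n * scale / d, 0, 1⟩

instance : Add CBall := ⟨add⟩
instance : Sub CBall := ⟨sub⟩
instance : Mul CBall := ⟨mul⟩

lemma le_hypotUB {M m : ℕ} (h : m ≤ M) : √((M : ℝ) ^ 2 + (m : ℝ) ^ 2) ≤ hypotUB M m := by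
  have key : ∀ N : ℕ, ((N : ℝ) / 10000) ≤ ((N / 10000 + 1 : ℕ) : ℝ) := by
    intro N
    rw [div_le_iff₀ (by norm_num)]
    have : N ≤ (N / 10000 + 1) * 10000 := by omega
    exact_mod_cast this
  have hm : (m : ℝ) ≤ M := by exact_mod_cast h
  have hm0 : (0 : ℝ) ≤ m := by positivity
  refine Real.sqrt_le_iff.2 ⟨by positivity, ?_⟩
  unfold hypotUB
  by_cases hc : 2 * m ≤ M
  · have hc' : 2 * (m : ℝ) ≤ M := by exact_mod_cast hc
    rw [show Nat.ble (2 * m) M = true from Nat.ble_eq_true_of_le hc, cond_true]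
    refine le_trans ?_ (pow_le_pow_left₀ (by positivity) (key _) 2)
    push_cast
    nlinarith [mul_nonneg hm0 (sub_nonneg.2 hc')]
  · have hc' : (M : ℝ) ≤ 2 * m := by exact_mod_cast (not_le.1 hc).le
    rw [show Nat.ble (2 * m) M = false from by
      rw [← Bool.not_eq_true, Nat.ble_eq]; exact hc, cond_false]
    refine le_trans ?_ (pow_le_pow_left₀ (by positivity) (key _) 2)
    push_cast
    nlinarith [mul_nonneg (sub_nonneg.2 hm) (sub_nonneg.2 hc'), mul_nonneg hm0 (sub_nonneg.2 hm),
      mul_nonneg hm0 (sub_nonneg.2 hc'), sq_nonneg ((M : ℝ) - m), sq_nonneg (2 * (m : ℝ) - M)]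

lemma norm_int_le (x y : ℤ) : ‖(x + y * I : ℂ)‖ ≤ normUB x y := by
  have h : ‖(x + y * I : ℂ)‖ = √(((x.natAbs : ℕ) : ℝ) ^ 2 + ((y.natAbs : ℕ) : ℝ) ^ 2) := by
    have := Complex.norm_add_mul_I (x : ℝ) (y : ℝ)
    rw [Nat.cast_natAbs, Nat.cast_natAbs]
    push_cast at this ⊢
    rw [this, sq_abs, sq_abs]
  rw [h, normUB]
  simp only [Int.ofNat_eq_natCast, Int.cast_natCast]
  by_cases hc : x.natAbs ≤ y.natAbs
  · rw [show Nat.ble _ _ = true from Nat.ble_eq_true_of_le hc, cond_true, add_comm]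
    exact le_hypotUB hc
  · rw [show Nat.ble _ _ = false from by
      rw [← Bool.not_eq_true, Nat.ble_eq]; exact hc, cond_false]
    exact le_hypotUB (not_le.1 hc).le

lemma norm_center_le (a : CBall) : ‖a.center‖ ≤ normUB a.re a.im := norm_int_le _ _

lemma normUB_nonneg (x y : ℤ) : (0 : ℝ) ≤ normUB x y := (norm_nonneg _).trans (norm_int_le x y)

lemma scale_pos : (0 : ℝ) < scale := by norm_num [scale]

lemma cast_scale_ne : (scale : ℂ) ≠ 0 := by norm_num [scale]

lemma Holds.rad_nonneg {a : CBall} {z : ℂ} (h : Holds a z) : (0 : ℝ) ≤ a.rad :=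
  (norm_nonneg _).trans h

lemma Holds.norm_le {a : CBall} {z : ℂ} (h : Holds a z) : ‖z‖ * scale ≤ a.abs := by
  have h1 : ‖z * scale‖ ≤ ‖a.center‖ + ‖z * scale - a.center‖ := norm_le_norm_add_norm_sub' _ _
  rw [norm_mul, norm_intCast, abs_of_pos scale_pos] at h1
  have := norm_center_le a
  have h2 : ‖z * scale - a.center‖ ≤ a.rad := h
  rw [CBall.abs]; push_cast
  linarith

lemma Holds.re_ge {a : CBall} {z : ℂ} (h : Holds a z) : (a.re : ℝ) - a.rad ≤ z.re * scale := by
  have h1 := (abs_re_le_norm (z * scale - a.center)).trans h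
  have h2 : (z * scale - a.center).re = z.re * scale - a.re := by simp [center]
  rw [h2, abs_le] at h1
  linarith

lemma Holds.add {a b : CBall} {z w : ℂ} (ha : Holds a z) (hb : Holds b w) :
    Holds (a + b) (z + w) := by
  change ‖(z + w) * scale - (((a.re + b.re : ℤ) : ℂ) + ((a.im + b.im : ℤ) : ℂ) * I)‖
    ≤ ((a.rad + b.rad : ℤ) : ℝ)
  push_cast
  refine le_trans (le_of_eq ?_) ((norm_add_le _ _).trans (add_le_add ha hb))
  congr 1; simp only [center]; ring

lemma Holds.sub {a b : CBall} {z w : ℂ} (ha : Holds a z) (hb : Holds b w) :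
    Holds (a - b) (z - w) := by
  change ‖(z - w) * scale - (((a.re - b.re : ℤ) : ℂ) + ((a.im - b.im : ℤ) : ℂ) * I)‖
    ≤ ((a.rad + b.rad : ℤ) : ℝ)
  push_cast
  refine le_trans (le_of_eq ?_) ((norm_sub_le _ _).trans (add_le_add ha hb))
  congr 1; simp only [center]; ring

lemma Holds.star {a : CBall} {z : ℂ} (ha : Holds a z) : Holds a.star (conj z) := by
  change ‖conj z * scale - (a.re + ((-a.im : ℤ) : ℂ) * I)‖ ≤ a.rad
  refine le_trans (le_of_eq ?_) ha
  rw [← norm_conj]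
  congr 1; simp only [center]; simp

lemma Holds.inflate {a : CBall} {z w : ℂ} {r : ℤ} (ha : Holds a z) (h : ‖w - z‖ * scale ≤ r) :
    Holds (a.inflate r) w := by
  change ‖w * scale - a.center‖ ≤ ((a.rad + r : ℤ) : ℝ)
  have h1 : w * scale - a.center = (z * scale - a.center) + (w - z) * scale := by ring
  rw [h1]
  refine (norm_add_le _ _).trans ?_
  rw [norm_mul (w - z), norm_intCast, abs_of_pos scale_pos]
  push_cast
  exact add_le_add ha h

lemma Holds.of_contained {a b : CBall} {z : ℂ} (ha : Holds a z)
    (h : normUB (a.re - b.re) (a.im - b.im) + a.rad ≤ b.rad) : Holds b z := by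
  have h1 : z * scale - b.center
      = (z * scale - a.center) + (((a.re - b.re : ℤ) : ℂ) + ((a.im - b.im : ℤ) : ℂ) * I) := by
    simp only [center]; push_cast; ring
  change ‖z * scale - b.center‖ ≤ b.rad
  rw [h1]
  refine (norm_add_le _ _).trans ((add_le_add ha (norm_int_le _ _)).trans ?_)
  have : ((normUB (a.re - b.re) (a.im - b.im) + a.rad : ℤ) : ℝ) ≤ b.rad := by exact_mod_cast h
  push_cast at this
  linarith

lemma sub_floor_bounds (x : ℤ) {d : ℤ} (hd : 0 < d) :
    0 ≤ (x : ℝ) / d - (x / d : ℤ) ∧ (x : ℝ) / d - (x / d : ℤ) ≤ 1 := by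
  have hd' : (0 : ℝ) < d := by exact_mod_cast hd
  have h1 : x / d * d ≤ x := Int.ediv_mul_le _ hd.ne'
  have h2 : x < (x / d + 1) * d := Int.lt_ediv_add_one_mul_self _ hd
  have h1' : ((x / d : ℤ) : ℝ) * d ≤ x := by exact_mod_cast h1
  have h2' : (x : ℝ) < ((x / d : ℤ) + 1) * d := by exact_mod_cast h2
  rw [sub_nonneg, le_div_iff₀ hd', sub_le_iff_le_add, div_le_iff₀ hd']
  exact ⟨h1', by linarith⟩

lemma norm_sub_floor_le (x y : ℤ) {d : ℤ} (hd : 0 < d) :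
    ‖((x : ℂ) + y * I) / d - ((x / d : ℤ) + (y / d : ℤ) * I)‖ ≤ 2 := by
  have h : ((x : ℂ) + y * I) / d - ((x / d : ℤ) + (y / d : ℤ) * I)
      = (((x : ℝ) / d - (x / d : ℤ) : ℝ) : ℂ) + (((y : ℝ) / d - (y / d : ℤ) : ℝ) : ℂ) * I := by
    push_cast; ring
  obtain ⟨hx, hx'⟩ := sub_floor_bounds x hd
  obtain ⟨hy, hy'⟩ := sub_floor_bounds y hd
  rw [h]
  refine (norm_add_le _ _).trans ?_
  rw [norm_mul, norm_I, norm_real, norm_real, Real.norm_of_nonneg hx, Real.norm_of_nonneg hy]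
  linarith

lemma div_le_floor_add_one (x : ℤ) {d : ℤ} (hd : 0 < d) : (x : ℝ) / d + 2 ≤
    ((x / d + 3 : ℤ) : ℝ) := by
  have := (sub_floor_bounds x hd).2
  push_cast
  linarith

lemma Holds.mul {a b : CBall} {z w : ℂ} (ha : Holds a z) (hb : Holds b w) :
    Holds (a * b) (z * w) := by
  have hs : (0 : ℤ) < scale := by decide
  have hr := ha.rad_nonneg
  have h1 := norm_sub_floor_le (a.re * b.re - a.im * b.im) (a.re * b.im + a.im * b.re) hs
  have h2 := div_le_floor_add_one
    (normUB a.re a.im * b.rad + normUB b.re b.im * a.rad + a.rad * b.rad) hs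
  refine le_trans ?_ h2
  set α := z * scale - a.center with hα
  set β := w * scale - b.center with hβ
  have h3 : z * w * scale - (a * b).center
      = (a.center * β + b.center * α + α * β) / scale +
        ((((a.re * b.re - a.im * b.im : ℤ) : ℂ) + ((a.re * b.im + a.im * b.re : ℤ) : ℂ) * I) / scale
          - (((a.re * b.re - a.im * b.im) / scale : ℤ)
            + ((a.re * b.im + a.im * b.re) / scale : ℤ) * I)) := by
    have h4 : (a * b).center = (((a.re * b.re - a.im * b.im) / scale : ℤ)
            + ((a.re * b.im + a.im * b.re) / scale : ℤ) * I) := rfl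
    have h5 : (((a.re * b.re - a.im * b.im : ℤ) : ℂ) + ((a.re * b.im + a.im * b.re : ℤ) : ℂ) * I)
        = a.center * b.center := by
      simp only [center]; push_cast
      linear_combination (-a.im * b.im : ℂ) * I_sq
    rw [h4, h5, hα, hβ]
    have := cast_scale_ne
    field_simp
    ring
  rw [h3]
  refine (norm_add_le _ _).trans (add_le_add ?_ h1)
  rw [norm_div, norm_intCast, abs_of_pos scale_pos]
  refine div_le_div_of_nonneg_right ?_ scale_pos.le
  push_cast
  refine (norm_add₃_le).trans ?_
  simp only [norm_mul]
  have hα' : ‖α‖ ≤ a.rad := ha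
  have hβ' : ‖β‖ ≤ b.rad := hb
  refine add_le_add (add_le_add ?_ ?_) ?_
  · exact mul_le_mul (norm_center_le a) hβ' (norm_nonneg _) (normUB_nonneg _ _)
  · exact mul_le_mul (norm_center_le b) hα' (norm_nonneg _) (normUB_nonneg _ _)
  · exact mul_le_mul hα' hβ' (norm_nonneg _) hr

lemma Holds.smul {a : CBall} {z : ℂ} (n : ℕ) {d : ℕ} (hd : 0 < d) (ha : Holds a z) :
    Holds (a.smul n d) (z * (n / d)) := by
  have hs : (0 : ℤ) < d := by exact_mod_cast hd
  have hd' : (d : ℂ) ≠ 0 := by exact_mod_cast hd.ne'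
  have h1 := norm_sub_floor_le (a.re * n) (a.im * n) hs
  have h2 := div_le_floor_add_one (a.rad * n) hs
  refine le_trans ?_ h2
  have h3 : z * (n / d) * scale - (a.smul n d).center
      = (z * scale - a.center) * (n / d) +
          ((((a.re * n : ℤ) : ℂ) + ((a.im * n : ℤ) : ℂ) * I) / (d : ℤ)
          - ((a.re * n / d : ℤ) + (a.im * n / d : ℤ) * I)) := by
    have h4 : (a.smul n d).center = ((a.re * n / d : ℤ) + (a.im * n / d : ℤ) * I) := rfl
    rw [h4]
    simp only [center]; push_cast
    ring
  rw [h3]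
  refine (norm_add_le _ _).trans (add_le_add ?_ h1)
  rw [norm_mul, norm_div, norm_natCast, norm_natCast]
  push_cast
  rw [mul_div_assoc]
  exact mul_le_mul_of_nonneg_right ha (by positivity)

lemma Holds.inv {a : CBall} {z : ℂ} (ha : Holds a z) (hden : 0 < invDen a) :
    Holds a.inv z⁻¹ := by
  have hr := ha.rad_nonneg
  have hden' : (0 : ℝ) < invDen a := by exact_mod_cast hden
  have hsq : ‖a.center‖ ^ 2 = ((a.re * a.re + a.im * a.im : ℤ) : ℝ) := by
    rw [← normSq_eq_norm_sq]; simp [center, normSq_apply]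
  have hub := norm_center_le a
  have hle : (invDen a : ℝ) ≤ ‖a.center‖ * (‖a.center‖ - a.rad) := by
    rw [mul_sub, ← sq, hsq, invDen]; push_cast
    nlinarith
  have hA : 0 < ‖a.center‖ := by
    rcases (norm_nonneg a.center).eq_or_lt with h | h
    · rw [← h] at hle; linarith
    · exact h
  have hAr : 0 < ‖a.center‖ - a.rad := pos_of_mul_pos_right (hden'.trans_le hle) hA.le
  have hA0 : a.center ≠ 0 := norm_pos_iff.1 hA
  have hn : (0 : ℤ) < a.re * a.re + a.im * a.im := by
    have : (0 : ℝ) < ((a.re * a.re + a.im * a.im : ℤ) : ℝ) := by rw [← hsq]; positivity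
    exact_mod_cast this
  set Z := z * scale with hZ
  have hZn : ‖a.center‖ - a.rad ≤ ‖Z‖ := by
    have h1 : ‖Z - a.center‖ ≤ a.rad := ha
    have := norm_le_norm_add_norm_sub Z a.center
    linarith
  have hZ0 : Z ≠ 0 := norm_pos_iff.1 (hAr.trans_le hZn)
  have hz0 : z ≠ 0 := by rintro rfl; simp [hZ] at hZ0
  have h1 := norm_sub_floor_le (a.re * scale * scale) (-a.im * scale * scale) hn
  have h2 := div_le_floor_add_one (a.rad * scale * scale) hden
  refine le_trans ?_ h2
  have hconj : conj a.center = a.re - a.im * I := by simp [center, sub_eq_add_neg]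
  have h3 : z⁻¹ * scale - a.inv.center
      = (scale : ℂ) ^ 2 * (a.center - Z) / (Z * a.center) +
        ((((a.re * scale * scale : ℤ) : ℂ) + ((-a.im * scale * scale : ℤ) : ℂ) * I)
            / ((a.re * a.re + a.im * a.im : ℤ) : ℂ)
          - ((a.re * scale * scale / (a.re * a.re + a.im * a.im) : ℤ)
            + (-a.im * scale * scale / (a.re * a.re + a.im * a.im) : ℤ) * I)) := by
    have h4 : a.inv.center = ((a.re * scale * scale / (a.re * a.re + a.im * a.im) : ℤ)
            + (-a.im * scale * scale / (a.re * a.re + a.im * a.im) : ℤ) * I) := rfl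
    have h5 : ((((a.re * scale * scale : ℤ) : ℂ) + ((-a.im * scale * scale : ℤ) : ℂ) * I)
            / ((a.re * a.re + a.im * a.im : ℤ) : ℂ)) = (scale : ℂ) ^ 2 / a.center := by
      have h6 : ((a.re * a.re + a.im * a.im : ℤ) : ℂ) = a.center * conj a.center := by
        rw [hconj]; simp only [center]; push_cast
        linear_combination (a.im * a.im : ℂ) * I_sq
      have h7 : (((a.re * scale * scale : ℤ) : ℂ) + ((-a.im * scale * scale : ℤ) : ℂ) * I)
          = (scale : ℂ) ^ 2 * conj a.center := by
        rw [hconj]; push_cast; ring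
      have h8 : conj a.center ≠ 0 := by simpa using hA0
      rw [h6, h7]
      field_simp
    rw [h4, h5, hZ]
    have := cast_scale_ne
    field_simp
    ring
  rw [h3]
  refine (norm_add_le _ _).trans (add_le_add ?_ h1)
  rw [norm_div, norm_mul, norm_mul, norm_pow, norm_intCast, abs_of_pos scale_pos, ← norm_neg,
      neg_sub]
  have h9 : ‖Z - a.center‖ ≤ a.rad := ha
  rw [div_le_div_iff₀ (by positivity) hden']
  push_cast
  have h10 : (invDen a : ℝ) ≤ ‖Z‖ * ‖a.center‖ := by
    refine hle.trans ?_
    rw [mul_comm]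
    exact mul_le_mul_of_nonneg_right hZn hA.le
  have h11 : ‖Z - a.center‖ * invDen a ≤ a.rad * (‖Z‖ * ‖a.center‖) :=
    mul_le_mul h9 h10 hden'.le hr
  nlinarith [mul_le_mul_of_nonneg_left h11 (sq_nonneg (scale : ℝ))]

lemma holds_rat (n : ℤ) {d : ℕ} (hd : 0 < d) : Holds (rat n d) (n / d : ℂ) := by
  have hs : (0 : ℤ) < d := by exact_mod_cast hd
  obtain ⟨h1, h2⟩ := sub_floor_bounds (n * scale) hs
  change ‖(n / d : ℂ) * scale - (((n * scale / d : ℤ) : ℂ) + ((0 : ℤ) : ℂ) * I)‖ ≤ ((1 : ℤ) : ℝ)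
  have h3 : (n / d : ℂ) * scale - (((n * scale / d : ℤ) : ℂ) + ((0 : ℤ) : ℂ) * I)
      = (((((n * scale : ℤ) : ℝ)) / (d : ℤ) - ((n * scale / d : ℤ) : ℝ) : ℝ) : ℂ) := by
    push_cast; ring
  rw [h3, norm_real, Real.norm_of_nonneg h1]
  simpa using h2

/-- Horner evaluation of the exponential series, from the term of index `n` down. -/
def expAcc (x : CBall) : ℕ → CBall → CBall
  | 0, a => a
  | n + 1, a => expAcc x n (rat 1 1 + smul 1 (n + 1) (x * a))

/-- The exponential of a disc contained in the unit disc. -/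
def expB (x : CBall) : CBall := (expAcc x 23 (rat 1 1)).inflate 1

/-- Horner evaluation of the series of the hyperbolic cosine in the variable `x ^ 2`. -/
def coshAcc (x2 : CBall) : ℕ → CBall → CBall
  | 0, a => a
  | n + 1, a => coshAcc x2 n (rat 1 1 + smul 1 ((2 * n + 1) * (2 * n + 2)) (x2 * a))

/-- The hyperbolic cosine of a disc contained in `‖x‖ ≤ 2`. -/
def coshB (x : CBall) : CBall := (coshAcc (x * x) 10 (rat 1 1)).inflate 200000

lemma holds_rat_one : Holds (rat 1 1) 1 := by simpa using holds_rat 1 one_pos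

lemma Holds.abs_le {a : CBall} {z : ℂ} {r : ℤ} (h : Holds a z) (hr : a.abs ≤ r * scale) :
    ‖z‖ ≤ r := by
  have h1 := h.norm_le
  have h2 : (a.abs : ℝ) ≤ r * scale := by exact_mod_cast hr
  exact le_of_mul_le_mul_right (h1.trans h2) scale_pos

lemma holds_expAcc {x : CBall} {z : ℂ} (hx : Holds x z) (n k : ℕ) {a : CBall}
    (ha : Holds a (∑ i ∈ Finset.range (k + 1), (n.factorial : ℂ) / ((n + i).factorial) * z ^ i)) :
    Holds (expAcc x n a) (∑ i ∈ Finset.range (n + k + 1), z ^ i / (i.factorial : ℂ)) := by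
  induction n generalizing k a with
  | zero =>
    simp only [expAcc]
    convert ha using 2
    · ring_nf
    · simp [div_eq_mul_inv, mul_comm]
  | succ n ih =>
    simp only [expAcc]
    have := ih (k + 1) (a := rat 1 1 + smul 1 (n + 1) (x * a)) (by
      have h := holds_rat_one.add ((hx.mul ha).smul 1 n.succ_pos)
      convert h using 1
      rw [Finset.sum_range_succ', add_comm]
      congr 1
      · have : (n.factorial : ℂ) ≠ 0 := by exact_mod_cast n.factorial_ne_zero
        simp [this]
      · rw [mul_comm z, mul_assoc, Finset.sum_mul]
        refine Finset.sum_congr rfl fun i _ => ?_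
        rw [show n + 1 + i = n + (i + 1) by ring, Nat.factorial_succ n]
        have : ((n + (i + 1)).factorial : ℂ) ≠ 0 := by exact_mod_cast Nat.factorial_ne_zero _
        have : ((n : ℂ) + 1) ≠ 0 := by exact_mod_cast n.succ_ne_zero
        push_cast
        field_simp
        ring_nf)
    rwa [show n + 1 + k + 1 = n + (k + 1) + 1 by ring]

lemma holds_expB {x : CBall} {z : ℂ} (hx : Holds x z) (h1 : x.abs ≤ scale) :
    Holds (expB x) (exp z) := by
  have hz : ‖z‖ ≤ 1 := by simpa using hx.abs_le (r := 1) (by simpa using h1)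
  have h := holds_expAcc hx 23 0 (a := rat 1 1) (by
    simpa [Nat.factorial_ne_zero] using holds_rat_one)
  refine h.inflate ?_
  have h2 := exp_bound' (x := z) (n := 24) (by norm_num; linarith)
  calc _ ≤ ‖z‖ ^ 24 / (Nat.factorial 24) * 2 * scale :=
        mul_le_mul_of_nonneg_right h2 scale_pos.le
    _ ≤ 1 ^ 24 / (Nat.factorial 24) * 2 * scale := by
        have := scale_pos
        gcongr
    _ ≤ _ := by norm_num [Nat.factorial, scale]

lemma holds_coshAcc {x2 : CBall} {z : ℂ} (hx : Holds x2 (z * z)) (n k : ℕ) {a : CBall}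
    (ha : Holds a (∑ i ∈ Finset.range (k + 1),
      ((2 * n).factorial : ℂ) / ((2 * (n + i)).factorial) * (z * z) ^ i)) :
    Holds (coshAcc x2 n a)
        (∑ i ∈ Finset.range (n + k + 1), z ^ (2 * i) / ((2 * i).factorial : ℂ)) := by
  induction n generalizing k a with
  | zero =>
    simp only [coshAcc]
    convert ha using 2
    · ring_nf
    · rw [pow_mul, sq]; simp [div_eq_mul_inv, mul_comm]
  | succ n ih =>
    simp only [coshAcc]
    have := ih (k + 1) (a := rat 1 1 + smul 1 ((2 * n + 1) * (2 * n + 2)) (x2 * a)) (by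
      have h := holds_rat_one.add
          ((hx.mul ha).smul 1 (by positivity : 0 < (2 * n + 1) * (2 * n + 2)))
      convert h using 1
      rw [Finset.sum_range_succ', add_comm]
      congr 1
      · have : ((2 * n).factorial : ℂ) ≠ 0 := by exact_mod_cast Nat.factorial_ne_zero _
        simp [this]
      · rw [mul_comm (z * z), mul_assoc, Finset.sum_mul]
        refine Finset.sum_congr rfl fun i _ => ?_
        rw [show n + 1 + i = n + (i + 1) by ring, show 2 * (n + 1) = 2 * n + 1 + 1 by ring,
          Nat.factorial_succ (2 * n + 1), Nat.factorial_succ (2 * n)]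
        have : ((2 * (n + (i + 1))).factorial : ℂ) ≠ 0 := by exact_mod_cast Nat.factorial_ne_zero _
        have : ((2 * n : ℂ) + 1) ≠ 0 := by exact_mod_cast (2 * n).succ_ne_zero
        have : ((2 * n : ℂ) + 2) ≠ 0 := by exact_mod_cast (2 * n + 1).succ_ne_zero
        have h3 : ((2 * n : ℂ) + 1 + 1) = 2 * n + 2 := by ring
        push_cast
        rw [h3]
        field_simp
        ring_nf)
    rwa [show n + 1 + k + 1 = n + (k + 1) + 1 by ring]

lemma cosh_sub_sum (z : ℂ) : cosh z - ∑ i ∈ Finset.range 11, z ^ (2 * i) / ((2 * i).factorial : ℂ)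
    = ((exp z - ∑ m ∈ Finset.range 22, z ^ m / m.factorial)
      + (exp (-z) - ∑ m ∈ Finset.range 22, (-z) ^ m / m.factorial)) / 2 := by
  rw [cosh]
  simp only [Finset.sum_range_succ, Finset.sum_range_zero]
  ring

lemma holds_coshB {x : CBall} {z : ℂ} (hx : Holds x z) (hz : ‖z‖ ≤ 2) :
    Holds (coshB x) (cosh z) := by
  have h := holds_coshAcc (hx.mul hx) 10 0 (a := rat 1 1) (by
    simpa [Nat.factorial_ne_zero] using holds_rat_one)
  refine h.inflate ?_
  have h2 := exp_bound' (x := z) (n := 22) (by norm_num; linarith)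
  have h3 := exp_bound' (x := -z) (n := 22) (by norm_num; linarith)
  rw [norm_neg] at h3
  have h4 : ‖z‖ ^ 22 / (Nat.factorial 22) * 2 ≤ 2 ^ 22 / (Nat.factorial 22) * 2 := by gcongr
  have h5 : ‖cosh z - ∑ i ∈ Finset.range (10 + 0 + 1), z ^ (2 * i) / ((2 * i).factorial : ℂ)‖
      ≤ 2 ^ 22 / (Nat.factorial 22) * 2 := by
    rw [show 10 + 0 + 1 = 11 from rfl, cosh_sub_sum, norm_div, norm_ofNat]
    have := norm_add_le (exp z - ∑ m ∈ Finset.range 22, z ^ m / m.factorial)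
      (exp (-z) - ∑ m ∈ Finset.range 22, (-z) ^ m / m.factorial)
    linarith
  refine (mul_le_mul_of_nonneg_right h5 scale_pos.le).trans ?_
  norm_num [Nat.factorial, scale]

/-- Repeated squaring. -/
def sqIter : ℕ → CBall → CBall
  | 0, a => a
  | n + 1, a => sqIter n (a * a)

lemma holds_sqIter {a : CBall} {z : ℂ} (n : ℕ) (h : Holds a (exp z)) :
    Holds (sqIter n a) (exp (z * 2 ^ n)) := by
  induction n generalizing a z with
  | zero => simpa [sqIter] using h
  | succ n ih =>
    rw [sqIter, pow_succ', ← mul_assoc]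
    refine ih ?_
    rw [mul_two, Complex.exp_add]
    exact h.mul h

/-- The exponential of a disc contained in the disc of radius `2 ^ n`. -/
def expScaled (n : ℕ) (x : CBall) : CBall := sqIter n (expB (x.smul 1 (2 ^ n)))

lemma holds_expScaled {x : CBall} {z : ℂ} (n : ℕ) (hx : Holds x z)
    (h1 : (x.smul 1 (2 ^ n)).abs ≤ scale) : Holds (expScaled n x) (exp z) := by
  have := holds_sqIter n (holds_expB (hx.smul 1 (by positivity : 0 < 2 ^ n)) h1)
  rw [expScaled]
  convert this using 2
  push_cast
  field_simp

def piB : CBall := ⟨57952155664616982739, 0, 2⟩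

lemma holds_piB : Holds piB π := by
  change ‖(π : ℂ) * scale - (((57952155664616982739 : ℤ) : ℂ) + ((0 : ℤ) : ℂ) * I)‖ ≤ ((2 : ℤ) : ℝ)
  have h : (π : ℂ) * scale - (((57952155664616982739 : ℤ) : ℂ) + ((0 : ℤ) : ℂ) * I)
      = ((π * 18446744073709551616 - 57952155664616982739 : ℝ) : ℂ) := by
    push_cast [scale]; ring
  rw [h, norm_real, Real.norm_eq_abs, abs_le]
  have := Real.pi_gt_d20
  have := Real.pi_lt_d20
  constructor <;> push_cast <;> linarith

/-- An enclosure of `thetaF (m / 8)`. -/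
def thetaB (m : ℕ) : CBall :=
  (((expScaled 6 (rat 0 1 - piB * expScaled 1 (rat m 4))).smul 2 1
    + (sqIter 2 (expScaled 6 (rat 0 1 - piB * expScaled 1 (rat m 4)))).smul 2 1)
    * expScaled 1 (rat m 16)).inflate 200000000

lemma holds_thetaB {m : ℕ} (h1 : ((rat m 4).smul 1 (2 ^ 1)).abs ≤ scale)
    (h2 : ((rat m 16).smul 1 (2 ^ 1)).abs ≤ scale)
    (h3 : ((rat 0 1 - piB * expScaled 1 (rat m 4)).smul 1 (2 ^ 6)).abs ≤ scale) (hm : m ≤ 8) :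
    Holds (thetaB m) (thetaF (m / 8)) := by
  have e1 : Holds (expScaled 1 (rat m 4)) (exp (m / 4)) :=
    holds_expScaled 1 (by simpa using holds_rat m (by norm_num : 0 < 4)) h1
  have e2 : Holds (expScaled 1 (rat m 16)) (exp (m / 16)) :=
    holds_expScaled 1 (by simpa using holds_rat m (by norm_num : 0 < 16)) h2
  have e0 : Holds (rat 0 1) 0 := by simpa using holds_rat 0 one_pos
  have e3 := holds_expScaled 6 (e0.sub (holds_piB.mul e1)) h3
  have h := ((e3.smul 2 one_pos).add ((holds_sqIter 2 e3).smul 2 one_pos)).mul e2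
  refine h.inflate ?_
  clear h e3 e2 e1 h1 h2 h3
  set x : ℝ := Real.exp (m / 4) with hx
  have hx1 : 1 ≤ x := Real.one_le_exp (by positivity)
  obtain ⟨hl, hu⟩ := thetaTail_bound 2 hx1
  have hF : thetaF (m / 8) = thetaTail x * Real.exp (m / 16) := by
    rw [thetaF, abs_of_nonneg (by positivity), hx]
    congr 2 <;> ring_nf
  have hE : (exp (m / 16) : ℂ) = (Real.exp (m / 16) : ℝ) := by push_cast; rfl
  have hT : ((thetaF (m / 8) : ℝ) : ℂ) - ((exp (0 - π * exp (m / 4)) * ((2 : ℕ) / (1 : ℕ))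
      + exp ((0 - π * exp (m / 4)) * 2 ^ 2) * ((2 : ℕ) / (1 : ℕ))) * exp (m / 16))
      = (((thetaTail x - ∑ n ∈ Finset.range 2, 2 * Real.exp (-π * (n + 1) ^ 2 * x))
        * Real.exp (m / 16) : ℝ) : ℂ) := by
    rw [hF, Finset.sum_range_succ, Finset.sum_range_one, hx]
    push_cast
    ring_nf
  have hm' : (m : ℝ) ≤ 8 := by exact_mod_cast hm
  rw [hT, norm_real, Real.norm_of_nonneg (by positivity)]
  have h4 : Real.exp (-π * ((2 : ℕ) + 1) ^ 2 * x) ≤ Real.exp (-28) := by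
    refine Real.exp_le_exp.2 ?_
    have := Real.pi_gt_d4
    have h : (28 : ℝ) ≤ π * 9 * x := by nlinarith
    push_cast
    linarith
  have h5 : Real.exp (m / 16) ≤ Real.exp 1 := Real.exp_le_exp.2 (by linarith)
  have h6 : Real.exp (-28) * Real.exp 1 ≤ (1 / 2.718) ^ 27 := by
    rw [← Real.exp_add, show (-28 + 1 : ℝ) = (27 : ℕ) * (-1) by norm_num, Real.exp_nat_mul]
    refine pow_le_pow_left₀ (Real.exp_pos _).le ?_ _
    rw [Real.exp_neg, ← one_div]
    have := Real.exp_one_gt_d9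
    exact one_div_le_one_div_of_le (by norm_num) (by linarith)
  have h7 : (thetaTail x - ∑ n ∈ Finset.range 2, 2 * Real.exp (-π * (n + 1) ^ 2 * x))
        * Real.exp (m / 16) ≤ 3 * Real.exp (-28) * Real.exp 1 :=
    mul_le_mul (hu.trans (mul_le_mul_of_nonneg_left h4 (by norm_num))) h5
      (Real.exp_pos _).le (by positivity)
  have h8 : ((1 / 2.718 : ℝ)) ^ 27 ≤ 2 / 10 ^ 12 := by norm_num
  refine (mul_le_mul_of_nonneg_right h7 scale_pos.le).trans ?_
  norm_num [scale] at h8 h6 ⊢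
  linarith

/-- Enclosures of `thetaF 0` and `2 * thetaF (m / 8)`. -/
def theta0 : CBall := ⟨1594440841491904186, 0, 200001000⟩
def theta1 : CBall := ⟨1390694103138373348, 0, 400001000⟩
def theta2 : CBall := ⟨470749953457924900, 0, 400001000⟩
def theta3 : CBall := ⟨115086707712047472, 0, 400001000⟩
def theta4 : CBall := ⟨18526521487335674, 0, 400001000⟩
def theta5 : CBall := ⟨1744035582999540, 0, 400001000⟩
def theta6 : CBall := ⟨82438399521898, 0, 400001000⟩
def theta7 : CBall := ⟨1608939569910, 0, 400001000⟩

/-- An enclosure of `cosh (1 / 16)`. -/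
def chB : CBall := ⟨18482784600379751204, 0, 300000⟩

/-- An enclosure of `sinh (1 / 16)`. -/
def shB : CBall := ⟨1153672251159927985, 0, 50⟩

set_option maxRecDepth 10000 in
lemma holds_theta0 : Holds theta0 (thetaF 0) := by
  have h := (holds_thetaB (m := 0) (by decide +kernel) (by decide +kernel) (by decide +kernel)
    (by norm_num)).of_contained (b := theta0) (by decide +kernel)
  simpa using h

lemma holds_two_mul_thetaF {m : ℕ} {b : CBall} (h1 : ((rat m 4).smul 1 (2 ^ 1)).abs ≤ scale)
    (h2 : ((rat m 16).smul 1 (2 ^ 1)).abs ≤ scale)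
    (h3 : ((rat 0 1 - piB * expScaled 1 (rat m 4)).smul 1 (2 ^ 6)).abs ≤ scale) (hm : m ≤ 8)
    (h4 : normUB (((thetaB m).smul 2 1).re - b.re) (((thetaB m).smul 2 1).im - b.im)
      + ((thetaB m).smul 2 1).rad ≤ b.rad) :
    Holds b (2 * thetaF (m / 8)) := by
  have h := ((holds_thetaB h1 h2 h3 hm).smul 2 one_pos).of_contained h4
  convert h using 1
  push_cast; ring

lemma holds_theta1 : Holds theta1 (2 * thetaF ((1 : ℕ) / 8)) :=
  holds_two_mul_thetaF (by decide +kernel) (by decide +kernel) (by decide +kernel) (by norm_num)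
    (by decide +kernel)
lemma holds_theta2 : Holds theta2 (2 * thetaF ((2 : ℕ) / 8)) :=
  holds_two_mul_thetaF (by decide +kernel) (by decide +kernel) (by decide +kernel) (by norm_num)
    (by decide +kernel)
lemma holds_theta3 : Holds theta3 (2 * thetaF ((3 : ℕ) / 8)) :=
  holds_two_mul_thetaF (by decide +kernel) (by decide +kernel) (by decide +kernel) (by norm_num)
    (by decide +kernel)
lemma holds_theta4 : Holds theta4 (2 * thetaF ((4 : ℕ) / 8)) :=
  holds_two_mul_thetaF (by decide +kernel) (by decide +kernel) (by decide +kernel) (by norm_num)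
    (by decide +kernel)
lemma holds_theta5 : Holds theta5 (2 * thetaF ((5 : ℕ) / 8)) :=
  holds_two_mul_thetaF (by decide +kernel) (by decide +kernel) (by decide +kernel) (by norm_num)
    (by decide +kernel)
lemma holds_theta6 : Holds theta6 (2 * thetaF ((6 : ℕ) / 8)) :=
  holds_two_mul_thetaF (by decide +kernel) (by decide +kernel) (by decide +kernel) (by norm_num)
    (by decide +kernel)
lemma holds_theta7 : Holds theta7 (2 * thetaF ((7 : ℕ) / 8)) :=
  holds_two_mul_thetaF (by decide +kernel) (by decide +kernel) (by decide +kernel) (by norm_num)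
    (by decide +kernel)

lemma holds_chB : Holds chB (cosh (1 / 16)) := by
  have h0 : Holds (rat 1 16) (1 / 16) := by simpa using holds_rat 1 (by norm_num : 0 < 16)
  exact (holds_coshB h0 (by norm_num)).of_contained (by decide +kernel)

lemma holds_shB : Holds shB (sinh (1 / 16)) := by
  have h0 : Holds (rat 1 16) (1 / 16) := by simpa using holds_rat 1 (by norm_num : 0 < 16)
  have h0' : Holds (rat (-1) 16) (-(1 / 16)) := by
    convert holds_rat (-1) (by norm_num : 0 < 16) using 1; norm_num
  have h := ((holds_expScaled 1 h0 (by decide +kernel)).sub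
    (holds_expScaled 1 h0' (by decide +kernel))).smul 1 two_pos
  have h' := h.of_contained (b := shB) (by decide +kernel)
  convert h' using 1
  rw [sinh]; push_cast; ring

/-- The radius marking an invalid enclosure. -/
def huge : ℤ := 1267650600228229401496703205376

/-- An enclosure of `entireXi (1 / 2 + z)`, valid if its radius is smaller than `huge`. -/
def xiB (z : CBall) : CBall :=
  let c := coshB (z.smul 1 8)
  let d := c - chB
  let c2 := c + c
  let b6 := theta6 + c2 * theta7
  let b5 := theta5 + c2 * b6 - theta7
  let b4 := theta4 + c2 * b5 - b6
  let b3 := theta3 + c2 * b4 - b5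
  let b2 := theta2 + c2 * b3 - b4
  let b1 := theta1 + c2 * b2 - b3
  bif decide (0 < d.invDen) then
    (((z * z - rat 1 4) * (theta0 + c * b1 - b2 + shB * d.inv)).smul 1 8).inflate 73786976294839
  else ⟨0, 0, huge⟩

lemma cosh_add_add_cosh_sub (x y : ℂ) : cosh (x + y) = 2 * cosh y * cosh x - cosh (x - y) := by
  rw [cosh_add, cosh_sub]; ring

lemma holds_xiB {b : CBall} {z : ℂ} (hz : Holds b z) (hl : -(1 / 2) ≤ z.re) (hr : z.re ≤ 5 / 4)
    (hi : |z.im| ≤ 59 / 4) (h0 : z ≠ 1 / 2) (h1 : z ≠ -(1 / 2)) (hb : (xiB b).rad < huge) :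
    Holds (xiB b) (entireXi (1 / 2 + z)) := by
  by_cases hd : 0 < ((coshB (b.smul 1 8)) - chB).invDen
  swap
  · exfalso
    simp [xiB, hd] at hb
  have hz8 : Holds (b.smul 1 8) (z / 8) := by
    convert hz.smul 1 (by norm_num : 0 < 8) using 1
    push_cast; ring
  have hn : ‖z / 8‖ ≤ 2 := by
    have := norm_le_abs_re_add_abs_im z
    have : |z.re| ≤ 5 / 4 := abs_le.2 ⟨by linarith, hr⟩
    rw [norm_div, norm_ofNat]
    linarith
  have hc := holds_coshB hz8 hn
  have hdd := (hc.sub holds_chB)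
  set c := coshB (b.smul 1 8)
  have h2 := hc.add hc
  have e7 := holds_theta7
  have e6 := holds_theta6.add (h2.mul e7)
  have e5 := (holds_theta5.add (h2.mul e6)).sub e7
  have e4 := (holds_theta4.add (h2.mul e5)).sub e6
  have e3 := (holds_theta3.add (h2.mul e4)).sub e5
  have e2 := (holds_theta2.add (h2.mul e3)).sub e4
  have e1 := (holds_theta1.add (h2.mul e2)).sub e3
  have e0 := ((holds_theta0.add (hc.mul e1)).sub e2).add (holds_shB.mul (hdd.inv hd))
  have hq : Holds (rat 1 4) (1 / 4) := by simpa using holds_rat 1 (by norm_num : 0 < 4)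
  have h := (((hz.mul hz).sub hq).mul e0).smul 1 (by norm_num : 0 < 8)
  have hx : xiB b = _ := if_pos hd ▸ Bool.cond_decide _ _ _
  rw [hx]
  refine h.inflate ?_
  have happ := entireXi_approx (w := 1 / 2 + z) (by simp; linarith) (by simp; linarith)
    (by simpa using hi) (fun h => h1 (by linear_combination h))
        (fun h => h0 (by linear_combination h))
  refine le_trans (mul_le_mul_of_nonneg_right (le_trans (le_of_eq ?_) happ) scale_pos.le)
    (by norm_num [scale])
  congr 2
  have hk : ∀ k : ℕ, cosh (z * ((k + 2 : ℕ) / 8))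
      = 2 * cosh (z / 8) * cosh (z * ((k + 1 : ℕ) / 8)) - cosh (z * (k / 8)) := by
    intro k
    have := cosh_add_add_cosh_sub (z * ((k + 1 : ℕ) / 8)) (z / 8)
    convert this using 3 <;> push_cast <;> ring
  have k0 := hk 0
  have k1 := hk 1
  have k2 := hk 2
  have k3 := hk 3
  have k4 := hk 4
  have k5 := hk 5
  simp only [Finset.sum_range_succ, Finset.sum_range_zero, trapezoidTerm, add_sub_cancel_left]
  have kk : cosh (z * ((1 : ℕ) / 8)) = cosh (z / 8) := by congr 1; push_cast; ring
  have kz : cosh (z * ((0 : ℕ) / 8)) = 1 := by simp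
  norm_num only [zero_add, Nat.reduceAdd] at k0 k1 k2 k3 k4 k5 kk kz ⊢
  rw [kk, kz] at k0
  rw [kk] at k1
  simp only [k5, k4, k3, k2, k1, k0, kk]
  ring

end CBall

/-- The constant `2 ξ(2) - 1`. -/
noncomputable def eps : ℝ := π / 3 - 1

/-- The constant making the symmetrised numerator vanish at `2 / 3`. -/
noncomputable def lam : ℝ :=
  (10 / 3 - 4 * π / 9) / (1 + (entireXi (1 / 3)).re / (entireXi (4 / 3)).re)

lemma ofReal_entireXi_re (x : ℝ) : (((entireXi x).re : ℝ) : ℂ) = entireXi x := by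
  apply Complex.ext
  · simp
  · simp [entireXi_ofReal_im]

lemma ofReal_lam : (lam : ℂ) = (10 / 3 - 4 * π / 9) *
    (1 + entireXi (1 / 3) * (entireXi (4 / 3))⁻¹)⁻¹ := by
  have h1 := ofReal_entireXi_re (1 / 3)
  have h2 := ofReal_entireXi_re (4 / 3)
  push_cast at h1 h2
  rw [lam]
  push_cast
  rw [h1, h2, ← div_eq_mul_inv, ← div_eq_mul_inv]

namespace CBall

def epsB : CBall := ⟨870641147829442630, 0, 20⟩
def lamB : CBall := ⟨18003834000000000000, 0, 180000000000000⟩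

lemma holds_epsB : Holds epsB eps := by
  have h := ((holds_piB.smul 1 (by norm_num : 0 < 3)).sub holds_rat_one).of_contained (b := epsB)
    (by decide +kernel)
  convert h using 1
  rw [eps]; push_cast; ring

lemma holds_lamB : Holds lamB lam := by
  have h1 : Holds (rat (-1) 6) (-1 / 6) := by simpa using holds_rat (-1) (by norm_num : 0 < 6)
  have h2 : Holds (rat 5 6) (5 / 6) := by simpa using holds_rat 5 (by norm_num : 0 < 6)
  have h3 := holds_xiB h1 (by norm_num) (by norm_num) (by norm_num) (by norm_num) (by norm_num)
    (by decide +kernel)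
  have h4 := holds_xiB h2 (by norm_num) (by norm_num) (by norm_num) (by norm_num) (by norm_num)
    (by decide +kernel)
  have h5 := (((holds_rat 10 (by norm_num : 0 < 3)).sub
      (holds_piB.smul 4 (by norm_num : 0 < 9))).mul
    ((holds_rat_one.add (h3.mul (h4.inv (by decide +kernel)))).inv
        (by decide +kernel))).of_contained
    (b := lamB) (by decide +kernel)
  rw [ofReal_lam]
  convert h5 using 1
  rw [show (1 / 2 + -1 / 6 : ℂ) = 1 / 3 by norm_num, show (1 / 2 + 5 / 6 : ℂ) = 4 / 3 by norm_num]
  push_cast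
  ring

/-- A disc containing all points near the segment between two discs. -/
def hull (A B : CBall) (mult dk : ℕ) : CBall :=
  ⟨(A.re + B.re) / 2, (A.im + B.im) / 2,
    normUB (A.re - B.re) (A.im - B.im) / 2 + (bif decide (A.rad ≤ B.rad) then B.rad else A.rad)
      + mult * (scale * dk * dk) / (24 * 1600 * 1600) + 4⟩

lemma holds_hull {A B : CBall} {zA zB z : ℂ} {θ : ℝ} {mult dk : ℕ} (hA : Holds A zA)
    (hB : Holds B zB) (h0 : 0 ≤ θ) (h1 : θ ≤ 1)
    (h : ‖z - ((1 - θ) * zA + θ * zB)‖ ≤ mult * (dk / 1600) ^ 2 / 24) :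
    Holds (hull A B mult dk) z := by
  have hm : (A.rad : ℝ) ≤ ((bif decide (A.rad ≤ B.rad) then B.rad else A.rad : ℤ) : ℝ) ∧
      (B.rad : ℝ) ≤ ((bif decide (A.rad ≤ B.rad) then B.rad else A.rad : ℤ) : ℝ) := by
    rw [Bool.cond_decide]
    split_ifs with hc
    · exact ⟨by exact_mod_cast hc, le_rfl⟩
    · exact ⟨le_rfl, by exact_mod_cast (not_le.1 hc).le⟩
  set r := (bif decide (A.rad ≤ B.rad) then B.rad else A.rad : ℤ) with hr
  have f1 := norm_sub_floor_le (A.re + B.re) (A.im + B.im) (d := 2) (by norm_num)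
  have f2 := (sub_floor_bounds (normUB (A.re - B.re) (A.im - B.im)) (d := 2) (by norm_num)).2
  have f3 := (sub_floor_bounds (mult * (scale * dk * dk)) (d := 24 * 1600 * 1600) (by norm_num)).2
  have hd := norm_int_le (A.re - B.re) (A.im - B.im)
  change ‖z * scale - ((((A.re + B.re) / 2 : ℤ) : ℂ) + (((A.im + B.im) / 2 : ℤ) : ℂ) * I)‖ ≤
    ((normUB (A.re - B.re) (A.im - B.im) / 2 + r + mult * (scale * dk * dk) / (24 * 1600 * 1600)
        + 4 : ℤ) : ℝ)
  have e : z * scale - ((((A.re + B.re) / 2 : ℤ) : ℂ) + (((A.im + B.im) / 2 : ℤ) : ℂ) * I)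
      = (z - ((1 - θ) * zA + θ * zB)) * scale + ((1 - θ : ℝ) * (zA * scale - A.center)
        + (θ : ℝ) * (zB * scale - B.center))
        + ((1 / 2 - θ : ℝ) * (((A.re - B.re : ℤ) : ℂ) + ((A.im - B.im : ℤ) : ℂ) * I))
        + ((((A.re + B.re : ℤ) : ℂ) + ((A.im + B.im : ℤ) : ℂ) * I) / (2 : ℤ)
          - ((((A.re + B.re) / 2 : ℤ) : ℂ) + (((A.im + B.im) / 2 : ℤ) : ℂ) * I)) := by
    simp only [center]; push_cast; ring
  rw [e]
  have g1 : ‖(z - ((1 - θ) * zA + θ * zB)) * scale‖ ≤ mult * (dk / 1600) ^ 2 / 24 * scale := by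
    rw [norm_mul, norm_intCast, abs_of_pos scale_pos]
    exact mul_le_mul_of_nonneg_right h scale_pos.le
  have g2 : ‖(1 - θ : ℝ) * (zA * scale - A.center) + (θ : ℝ) * (zB * scale - B.center)‖ ≤ r := by
    refine (norm_add_le _ _).trans ?_
    rw [norm_mul, norm_mul, norm_real, norm_real, Real.norm_of_nonneg h0,
      Real.norm_of_nonneg (by linarith)]
    have a1 : ‖zA * scale - A.center‖ ≤ r := hA.trans hm.1
    have a2 : ‖zB * scale - B.center‖ ≤ r := hB.trans hm.2
    nlinarith
  have g3 : ‖((1 / 2 - θ : ℝ) * (((A.re - B.re : ℤ) : ℂ) + ((A.im - B.im : ℤ) : ℂ) * I))‖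
      ≤ normUB (A.re - B.re) (A.im - B.im) / 2 := by
    rw [norm_mul, norm_real, Real.norm_eq_abs]
    have : |1 / 2 - θ| ≤ 1 / 2 := abs_le.2 ⟨by linarith, by linarith⟩
    calc _ ≤ 1 / 2 * (normUB (A.re - B.re) (A.im - B.im) : ℝ) :=
          mul_le_mul this hd (norm_nonneg _) (by norm_num)
      _ = _ := by ring
  have g := (norm_add_le _ _).trans (add_le_add ((norm_add_le _ _).trans (add_le_add
    ((norm_add_le _ _).trans (add_le_add g1 g2)) g3)) f1)
  refine g.trans ?_
  push_cast at f2 f3 ⊢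
  linarith

/-- The disc `a` contains `z`, provided that its radius is not `huge`. -/
def Valid (a : CBall) (z : ℂ) : Prop := a.rad < huge → Holds a z

lemma rad_lt_of_hull {A B : CBall} {mult dk : ℕ} (h : (hull A B mult dk).rad < huge) :
    A.rad < huge ∧ B.rad < huge := by
  have h1 : 0 ≤ normUB (A.re - B.re) (A.im - B.im) := Int.natCast_nonneg _
  have h2 : (0 : ℤ) ≤ mult * (scale * dk * dk) / (24 * 1600 * 1600) :=
    Int.ediv_nonneg (mul_nonneg (by positivity) (mul_nonneg (mul_nonneg (by decide) (by positivity))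
      (by positivity))) (by norm_num)
  have h3 : (hull A B mult dk).rad = normUB (A.re - B.re) (A.im - B.im) / 2
      + (bif decide (A.rad ≤ B.rad) then B.rad else A.rad)
      + mult * (scale * dk * dk) / (24 * 1600 * 1600) + 4 := rfl
  rw [h3, Bool.cond_decide] at h
  split_ifs at h with hc <;> constructor <;> omega

/-- An enclosure of `entireXi ((1 + j) / 2 + i k / 1600)`. -/
def edge (j k : ℕ) : CBall := xiB ⟨j * scale / 2, k * scale / 1600, 2⟩

lemma holds_grid (j k : ℕ) : Holds ⟨j * scale / 2, k * scale / 1600, 2⟩ (j / 2 + k / 1600 * I) := by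
  have h1 : ((j * scale / 2 : ℤ) : ℝ) = j * scale / 2 := by
    have : (j * scale / 2 : ℤ) * 2 = j * scale := Int.ediv_mul_cancel
        ⟨j * 9223372036854775808, by rw [scale]; ring⟩
    have : ((j * scale / 2 : ℤ) : ℝ) * 2 = j * scale := by exact_mod_cast this
    linarith
  obtain ⟨h2, h3⟩ := sub_floor_bounds (k * scale) (d := 1600) (by norm_num)
  change ‖(j / 2 + k / 1600 * I : ℂ) * scale - (((j * scale / 2 : ℤ) : ℂ)
    + ((k * scale / 1600 : ℤ) : ℂ) * I)‖ ≤ ((2 : ℤ) : ℝ)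
  have h4 : (j / 2 + k / 1600 * I : ℂ) * scale - (((j * scale / 2 : ℤ) : ℂ)
      + ((k * scale / 1600 : ℤ) : ℂ) * I)
      = (((k * scale : ℤ) / ((1600 : ℤ) : ℝ) - ((k * scale / 1600 : ℤ) : ℝ) : ℝ) : ℂ) * I := by
    have h5 : ((j * scale / 2 : ℤ) : ℂ) = j * scale / 2 := by exact_mod_cast h1
    rw [h5]; push_cast; ring
  rw [h4, norm_mul, norm_I, mul_one, norm_real, Real.norm_of_nonneg h2]
  push_cast at h3 ⊢
  linarith

lemma valid_edge {j k : ℕ} (hj : j ≤ 2) (hk : k ≤ 23600) (h : j = 1 → k ≠ 0) :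
    Valid (edge j k) (entireXi (1 / 2 + (j / 2 + k / 1600 * I))) := by
  have hj' : (j : ℝ) ≤ 2 := by exact_mod_cast hj
  have hk' : (k : ℝ) ≤ 23600 := by exact_mod_cast hk
  have hre : ((j : ℂ) / 2 + k / 1600 * I).re = j / 2 := by simp
  have him : ((j : ℂ) / 2 + k / 1600 * I).im = k / 1600 := by simp
  refine holds_xiB (holds_grid j k) ?_ ?_ ?_ ?_ ?_
  · rw [hre]; have : (0 : ℝ) ≤ j := by positivity
    linarith
  · rw [hre]; linarith
  · rw [him, abs_of_nonneg (by positivity)]; linarith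
  · intro e
    have e1 := congrArg Complex.re e
    have e2 := congrArg Complex.im e
    rw [hre] at e1
    rw [him] at e2
    norm_num at e1 e2
    exact h e1 e2
  · intro e
    have e1 := congrArg Complex.re e
    rw [hre] at e1
    norm_num at e1
    have : (0 : ℝ) ≤ j := by positivity
    linarith

/-- Enclosures of the values of `entireXi` at `s`, `s + 1`, `2 s`, `3 s`, `3 s - 1` for a point
`s = 1 / 2 + i k / 1600`. -/
structure Edges where
  x : CBall
  u : CBall
  a : CBall
  b : CBall
  m : CBall

def edgesAt (k : ℕ) : Edges :=
  ⟨edge 0 k, edge 2 k, bif Nat.beq k 0 then rat 1 1 else edge 1 (2 * k), edge 2 (3 * k),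
    edge 0 (3 * k)⟩

/-- A certificate for `r * ‖d‖ < (n * conj d).re`, when `R` bounds `r`. -/
def dominates (N D : CBall) (R : ℤ) : Bool :=
  decide (0 < (N * D.star).re - (N * D.star).rad - (R * D.abs / scale + 1))

def ok (a : CBall) : Bool := decide (a.rad < huge)

def sB (k st : ℕ) : CBall := ⟨scale / 2, (2 * k + st) * scale / 3200, st * scale / 3200 + 2⟩

def cB (s : CBall) : CBall := (s - rat 1 1) * (s - rat 2 1)
def bB (s : CBall) : CBall := (s + rat 1 1) * (s - rat 2 1)
def a3B (s : CBall) : CBall :=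
  (epsB * s + (rat 1 1 - epsB)) * ((s - rat 1 1) * (s.smul 3 1 - rat 2 1))
def t0B (s : CBall) : CBall := s * (s + rat 8 1) * (s - rat 2 3)

/-- The check near the real axis, with all cancellations. -/
def segNear (s X U a b m dU db da : CBall) : Bool :=
  ok X && ok U && ok a && ok b && ok m &&
  dominates
    (a * (b * ((((rat 1 1 - lamB) * s).smul 2 1
        + epsB * ((s - rat 1 1) * ((s - rat 1 1) * (s.smul 3 1 - rat 2 1)))) * U
        + (cB s * dU).smul 2 1))
      + (bB s + (lamB * s).smul 2 1) * (a * (dU * b + X * db)) + lamB * s * (X * (m * da)))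
    (a * (U * (b * t0B s))) 0

def segMid (s X U a : CBall) : Bool :=
  ok X && ok U && ok a &&
  dominates (a * (a3B s * U - (X * cB s).smul 2 1)) (a * U * t0B s)
    (X * ((bB s + lamB * s) * a + lamB * s * a.star)).abs

def segFar (s X U : CBall) : Bool :=
  ok X && ok U &&
  dominates (a3B s * U - (X * cB s).smul 2 1) (U * t0B s)
    (X.abs * ((bB s + lamB * s).abs + (lamB * s).abs) / scale + 1)

def seg (mode k st : ℕ) (e f : Edges) : Bool :=
  match mode with
  | 0 => Nat.ble (3 * (k + st)) 23600 &&
      segNear (sB k st) (hull e.x f.x 1 st) (hull e.u f.u 1 st) (hull e.a f.a 1 (2 * st))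
        (hull e.b f.b 1 (3 * st)) (hull e.m f.m 1 (3 * st)) (hull (e.u - e.x) (f.u - f.x) 2 st)
        (hull (e.b - e.m) (f.b - f.m) 2 (3 * st))
        (hull (e.a - e.a.star) (f.a - f.a.star) 2 (2 * st))
  | 1 => Nat.ble (2 * (k + st)) 23600 &&
      segMid (sB k st) (hull e.x f.x 1 st) (hull e.u f.u 1 st) (hull e.a f.a 1 (2 * st))
  | _ => Nat.ble (k + st) 23600 && segFar (sB k st) (hull e.x f.x 1 st) (hull e.u f.u 1 st)

def run (mode st : ℕ) : ℕ → ℕ → Edges → Bool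
  | 0, _, _ => true
  | n + 1, k, e => seg mode k st e (edgesAt (k + st)) && run mode st n (k + st) (edgesAt (k + st))

lemma holds_hull_line {A B : CBall} {f : ℂ → ℂ} (hf : Differentiable ℂ f) {w : ℂ} {mult c k st : ℕ}
    {t : ℝ} (hK : ∀ z : ℂ, z.re = w.re → ‖deriv (deriv f) z‖ ≤ mult / 3)
    (h0 : k ≤ 1600 * t) (h1 : 1600 * t ≤ k + st) (hst : 0 < st)
    (hA : Holds A (f (w + c * (k / 1600) * I)))
    (hB : Holds B (f (w + c * ((k + st : ℕ) / 1600) * I))) :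
    Holds (hull A B mult (c * st)) (f (w + c * t * I)) := by
  have hst' : (0 : ℝ) < st := by exact_mod_cast hst
  have hstc : (st : ℂ) ≠ 0 := by exact_mod_cast hst.ne'
  have e0 : 0 ≤ (1600 * t - k) / st := div_nonneg (by linarith) hst'.le
  have e1 : (1600 * t - k) / st ≤ 1 := (div_le_one hst').2 (by linarith)
  refine holds_hull hA hB e0 e1 ?_
  have h := norm_sub_segment_le (f := f) (w := w + c * (k / 1600) * I) (K := mult / 3)
    (d := c * st / 1600) hf (fun z hz => hK z (by rw [hz]; simp)) e0 e1
  have p1 : w + c * (k / 1600) * I + (((1600 * t - k) / st : ℝ) : ℂ) * ((c * st / 1600 : ℝ) : ℂ) * I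
      = w + c * t * I := by
    push_cast
    field_simp
    ring
  have p2 : w + c * (k / 1600) * I + ((c * st / 1600 : ℝ) : ℂ) * I
      = w + c * ((k + st : ℕ) / 1600) * I := by
    push_cast; ring
  rw [p1, p2] at h
  refine h.trans (le_of_eq ?_)
  push_cast
  ring

lemma of_dominates {N D : CBall} {R : ℤ} {n d : ℂ} {r : ℝ} (hN : Holds N n) (hD : Holds D d)
    (hR : 0 ≤ R) (hr : r * scale ≤ R) (h : dominates N D R = true) :
    r * ‖d‖ < (n * conj d).re := by
  have h1 := (hN.mul hD.star).re_ge
  have h2 : 0 < (N * D.star).re - (N * D.star).rad - (R * D.abs / scale + 1) := by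
    simpa [dominates] using h
  have h3 : (0 : ℝ) < (N * D.star).re - (N * D.star).rad - ((R * D.abs / scale : ℤ) + 1) := by
    exact_mod_cast h2
  have h4 := (sub_floor_bounds (R * D.abs) (d := scale) (by decide)).2
  have h5 := hD.norm_le
  have hs := scale_pos
  have h6 : r * ‖d‖ * scale ≤ ((R * D.abs : ℤ) : ℝ) / scale := by
    rw [le_div_iff₀ hs]
    push_cast
    calc r * ‖d‖ * scale * scale = (r * scale) * (‖d‖ * scale) := by ring
      _ ≤ R * D.abs := mul_le_mul hr h5 (by positivity) (by exact_mod_cast hR)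
  refine lt_of_mul_lt_mul_right ?_ hs.le
  linarith

lemma abs_nonneg' {a : CBall} {z : ℂ} (h : Holds a z) : 0 ≤ a.abs := by
  have : (0 : ℝ) ≤ a.abs := le_trans (mul_nonneg (norm_nonneg _) scale_pos.le) h.norm_le
  exact_mod_cast this

lemma holds_rat_natCast (n : ℕ) : Holds (rat n 1) n := by simpa using holds_rat n one_pos

lemma holds_ofNat (n : ℕ) [n.AtLeastTwo] : Holds (rat (OfNat.ofNat n : ℕ) 1)
    (OfNat.ofNat n : ℂ) := by
  simpa using holds_rat_natCast (OfNat.ofNat n)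

lemma holds_sB {k st : ℕ} {t : ℝ} (h0 : k ≤ 1600 * t) (h1 : 1600 * t ≤ k + st) :
    Holds (sB k st) (1 / 2 + t * I) := by
  obtain ⟨a1, a2⟩ := sub_floor_bounds ((2 * k + st) * scale) (d := 3200) (by norm_num)
  obtain ⟨b1, b2⟩ := sub_floor_bounds (st * scale) (d := 3200) (by norm_num)
  have hs : (((scale / 2 : ℤ)) : ℂ) = scale / 2 := by norm_num [scale]
  change ‖(1 / 2 + t * I : ℂ) * scale - (((scale / 2 : ℤ) : ℂ)
    + (((2 * k + st) * scale / 3200 : ℤ) : ℂ) * I)‖ ≤ ((st * scale / 3200 + 2 : ℤ) : ℝ)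
  rw [hs, show (1 / 2 + t * I : ℂ) * scale - ((scale : ℂ) / 2
    + (((2 * k + st) * scale / 3200 : ℤ) : ℂ) * I)
    = ((t * scale - ((2 * k + st) * scale / 3200 : ℤ) : ℝ) : ℂ) * I by push_cast; ring]
  rw [norm_mul, norm_I, mul_one, norm_real, Real.norm_eq_abs]
  have hsp := scale_pos
  have c1 : (t - (2 * k + st) / 3200) ≤ st / 3200 := by linarith
  have c2 : -(st / 3200 : ℝ) ≤ (t - (2 * k + st) / 3200) := by linarith
  have d1 := mul_le_mul_of_nonneg_right c1 hsp.le
  have d2 := mul_le_mul_of_nonneg_right c2 hsp.le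
  push_cast at a1 a2 b1 b2 ⊢
  rw [abs_le]
  constructor <;> linarith

lemma holds_cB {b : CBall} {s : ℂ} (h : Holds b s) : Holds (cB b) ((s - 1) * (s - 2)) :=
  (h.sub holds_rat_one).mul (h.sub (holds_ofNat 2))

lemma holds_bB {b : CBall} {s : ℂ} (h : Holds b s) : Holds (bB b) ((s + 1) * (s - 2)) :=
  (h.add holds_rat_one).mul (h.sub (holds_ofNat 2))

lemma Holds.smul_ofNat {b : CBall} {s : ℂ} (h : Holds b s) (n : ℕ) [n.AtLeastTwo] :
    Holds (b.smul (OfNat.ofNat n) 1) ((OfNat.ofNat n : ℂ) * s) := by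
  have := h.smul (OfNat.ofNat n) one_pos
  convert this using 1
  simp [mul_comm]

lemma holds_a3B {b : CBall} {s : ℂ} (h : Holds b s) :
    Holds (a3B b) ((eps * s + (1 - eps)) * ((s - 1) * (3 * s - 2))) :=
  ((holds_epsB.mul h).add (holds_rat_one.sub holds_epsB)).mul
    ((h.sub holds_rat_one).mul ((h.smul_ofNat 3).sub (holds_ofNat 2)))

lemma holds_t0B {b : CBall} {s : ℂ} (h : Holds b s) :
    Holds (t0B b) (s * (s + 8) * (s - 2 / 3)) := by
  have h23 : Holds (rat 2 3) (2 / 3) := by simpa using holds_rat 2 (by norm_num : 0 < 3)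
  exact (h.mul (h.add (holds_ofNat 8))).mul (h.sub h23)

lemma of_segNear {sb Xb Ub ab bb mb dUb dbb dab : CBall} {s X U a b m : ℂ} (hs : Holds sb s)
    (hX : Valid Xb X) (hU : Valid Ub U) (ha : Valid ab a) (hb : Valid bb b) (hm : Valid mb m)
    (hdU : Xb.rad < huge → Ub.rad < huge → Holds dUb (U - X))
    (hdb : bb.rad < huge → mb.rad < huge → Holds dbb (b - m))
    (hda : ab.rad < huge → Holds dab (a - conj a))
    (h : segNear sb Xb Ub ab bb mb dUb dbb dab = true) :
    0 < ((a * U * b * ((eps * s + (1 - eps)) * ((s - 1) * (3 * s - 2)))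
        - a * X * m * ((s + 1) * (s - 2)) - 2 * a * X * b * ((s - 1) * (s - 2))
        - lam * s * (X * m * (a + conj a)))
      * conj (a * (U * (b * (s * (s + 8) * (s - 2 / 3)))))).re := by
  simp only [segNear, Bool.and_eq_true, ok, decide_eq_true_eq] at h
  obtain ⟨⟨⟨⟨⟨kX, kU⟩, ka⟩, kb⟩, km⟩, h⟩ := h
  replace hdU := hdU kX kU
  replace hdb := hdb kb km
  replace hda := hda ka
  replace hX := hX kX
  replace hU := hU kU
  replace ha := ha ka
  replace hb := hb kb
  replace hm := hm km
  have h1 := holds_rat_one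
  have h2 := holds_ofNat 2
  have hl := holds_lamB
  have key := of_dominates (r := 0)
    (((ha.mul (hb.mul (((((((h1.sub hl).mul hs).smul_ofNat 2).add
      (holds_epsB.mul ((hs.sub h1).mul ((hs.sub h1).mul ((hs.smul_ofNat 3).sub h2)))))).mul hU).add
        (((holds_cB hs).mul hdU).smul_ofNat 2)))).add
      (((holds_bB hs).add ((hl.mul hs).smul_ofNat 2)).mul
          (ha.mul ((hdU.mul hb).add (hX.mul hdb))))).add
      ((hl.mul hs).mul (hX.mul (hm.mul hda))))
    (ha.mul (hU.mul (hb.mul (holds_t0B hs)))) le_rfl (by simp) h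
  rw [zero_mul] at key
  convert key using 3
  ring

lemma of_segMid {sb Xb Ub ab : CBall} {s X U a : ℂ} (hs : Holds sb s)
    (hX : Valid Xb X) (hU : Valid Ub U) (ha : Valid ab a) (h : segMid sb Xb Ub ab = true) :
    ‖X * (((s + 1) * (s - 2) + lam * s) * a + lam * s * conj a)‖
        * ‖a * U * (s * (s + 8) * (s - 2 / 3))‖
      < (a * ((eps * s + (1 - eps)) * ((s - 1) * (3 * s - 2)) * U - 2 * (X * ((s - 1) * (s - 2))))
      * conj (a * U * (s * (s + 8) * (s - 2 / 3)))).re := by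
  simp only [segMid, Bool.and_eq_true, ok, decide_eq_true_eq] at h
  obtain ⟨⟨⟨kX, kU⟩, ka⟩, h⟩ := h
  replace hX := hX kX
  replace hU := hU kU
  replace ha := ha ka
  have hl := holds_lamB
  have hR := hX.mul ((((holds_bB hs).add (hl.mul hs)).mul ha).add ((hl.mul hs).mul ha.star))
  exact of_dominates (ha.mul (((holds_a3B hs).mul hU).sub ((hX.mul (holds_cB hs)).smul_ofNat 2)))
    ((ha.mul hU).mul (holds_t0B hs)) (abs_nonneg' hR) hR.norm_le h

lemma of_segFar {sb Xb Ub : CBall} {s X U : ℂ} (hs : Holds sb s)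
    (hX : Valid Xb X) (hU : Valid Ub U) (h : segFar sb Xb Ub = true) :
    ‖X‖ * (‖(s + 1) * (s - 2) + lam * s‖ + ‖lam * s‖) * ‖U * (s * (s + 8) * (s - 2 / 3))‖
      < (((eps * s + (1 - eps)) * ((s - 1) * (3 * s - 2)) * U - 2 * (X * ((s - 1) * (s - 2))))
      * conj (U * (s * (s + 8) * (s - 2 / 3)))).re := by
  simp only [segFar, Bool.and_eq_true, ok, decide_eq_true_eq] at h
  obtain ⟨⟨kX, kU⟩, h⟩ := h
  replace hX := hX kX
  replace hU := hU kU
  have hl := holds_lamB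
  have r1 := (holds_bB hs).add (hl.mul hs)
  have r2 := hl.mul hs
  have hA : 0 ≤ Xb.abs * ((bB sb + lamB * sb).abs + (lamB * sb).abs) :=
    mul_nonneg (abs_nonneg' hX) (add_nonneg (abs_nonneg' r1) (abs_nonneg' r2))
  refine of_dominates (((holds_a3B hs).mul hU).sub ((hX.mul (holds_cB hs)).smul_ofNat 2))
    (hU.mul (holds_t0B hs)) (add_nonneg (Int.ediv_nonneg hA (by decide)) zero_le_one) ?_ h
  have h4 := (sub_floor_bounds (Xb.abs * ((bB sb + lamB * sb).abs + (lamB * sb).abs))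
    (d := scale) (by decide)).2
  have hsp := scale_pos
  have h5 : ‖X‖ * (‖(s + 1) * (s - 2) + lam * s‖ + ‖lam * s‖) * scale
      ≤ ((Xb.abs * ((bB sb + lamB * sb).abs + (lamB * sb).abs) : ℤ) : ℝ) / scale := by
    rw [le_div_iff₀ hsp]
    have e1 := hX.norm_le
    have e2 := r1.norm_le
    have e3 := r2.norm_le
    push_cast
    calc _ = (‖X‖ * scale) * (‖(s + 1) * (s - 2) + lam * s‖ * scale + ‖lam * s‖ * scale) := by ring
      _ ≤ _ := mul_le_mul e1 (add_le_add e2 e3) (by positivity)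
        (by exact_mod_cast abs_nonneg' hX)
  push_cast at h4 h5 ⊢
  linarith

end CBall

lemma entireXi_conj_of_re {w : ℂ} (h : w.re = 1) : entireXi (w - 1) = conj (entireXi w) := by
  rw [← entireXi_conj, ← entireXi_one_sub]
  congr 1
  apply Complex.ext <;> simp [h]

lemma deriv_entireXi_comp_add (c : ℂ) :
    deriv (fun z => entireXi (z + c)) = fun z => deriv entireXi (z + c) := by
  funext z; exact deriv_comp_add_const ..

lemma differentiable_deriv_entireXi : Differentiable ℂ (deriv entireXi) :=
  fun z => ((differentiable_entireXi.differentiableOn.deriv isOpen_univ) z trivial).differentiableAt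
    univ_mem

lemma norm_deriv_deriv_entireXi_sub_le {c z : ℂ} (h0 : 0 ≤ z.re) (h1 : z.re ≤ 3 / 2)
    (h2 : 0 ≤ z.re + c.re) (h3 : z.re + c.re ≤ 3 / 2) :
    ‖deriv (deriv fun w => entireXi (w + c) - entireXi w) z‖ ≤ 2 / 3 := by
  have e1 : deriv (fun w => entireXi (w + c) - entireXi w)
      = fun w => deriv entireXi (w + c) - deriv entireXi w := by
    funext w
    rw [deriv_fun_sub (by have := differentiable_entireXi; fun_prop) (differentiable_entireXi w),
      deriv_entireXi_comp_add]
  have e2 : deriv (fun w => deriv entireXi (w + c) - deriv entireXi w) z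
      = deriv (deriv entireXi) (z + c) - deriv (deriv entireXi) z := by
    rw [deriv_fun_sub (by have := differentiable_deriv_entireXi; fun_prop)
      (differentiable_deriv_entireXi z), deriv_comp_add_const]
  rw [e1, e2]
  have := norm_deriv_deriv_entireXi_le h0 h1
  have := norm_deriv_deriv_entireXi_le (w := z + c) (by simpa using h2) (by simpa using h3)
  exact (norm_sub_le _ _).trans (by linarith)

namespace CBall

/-- The enclosures `e` are correct at `s = 1 / 2 + i k / 1600`, as far as they are used. -/
structure EdgesOK (k : ℕ) (e : Edges) : Prop where
  x : k ≤ 23600 → Valid e.x (entireXi (1 / 2 + (1 : ℕ) * (k / 1600) * I))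
  u : k ≤ 23600 → Valid e.u (entireXi (1 / 2 + (1 : ℕ) * (k / 1600) * I + 1))
  a : 2 * k ≤ 23600 → Valid e.a (entireXi (1 + (2 : ℕ) * (k / 1600) * I))
  b : 3 * k ≤ 23600 → Valid e.b (entireXi (1 / 2 + (3 : ℕ) * (k / 1600) * I + 1))
  m : 3 * k ≤ 23600 → Valid e.m (entireXi (1 / 2 + (3 : ℕ) * (k / 1600) * I))

lemma valid_edge_of_eq {j k : ℕ} (hj : j ≤ 2) (hk : k ≤ 23600) (h : j = 1 → k ≠ 0) {z : ℂ}
    (hz : z = 1 / 2 + (j / 2 + k / 1600 * I)) : Valid (edge j k) (entireXi z) :=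
  hz ▸ valid_edge hj hk h

lemma edgesAt_of_eq_zero {k : ℕ} (hk : k = 0) :
    edgesAt k = ⟨edge 0 k, edge 2 k, rat 1 1, edge 2 (3 * k), edge 0 (3 * k)⟩ := by
  have : Nat.beq k 0 = true := by rw [hk]; rfl
  rw [edgesAt, this, cond_true]

lemma edgesAt_of_pos {k : ℕ} (hk : 0 < k) :
    edgesAt k = ⟨edge 0 k, edge 2 k, edge 1 (2 * k), edge 2 (3 * k), edge 0 (3 * k)⟩ := by
  have : Nat.beq k 0 = false := by
    cases k with
    | zero => simp at hk
    | succ n => rfl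
  rw [edgesAt, this, cond_false]

lemma edgesOK_edgesAt (k : ℕ) : EdgesOK k (edgesAt k) := by
  have hx (h : k ≤ 23600) : Valid (edge 0 k) (entireXi (1 / 2 + (1 : ℕ) * (k / 1600) * I)) :=
    valid_edge_of_eq (by norm_num) h (by norm_num) (by push_cast; ring)
  have hu (h : k ≤ 23600) : Valid (edge 2 k) (entireXi (1 / 2 + (1 : ℕ) * (k / 1600) * I + 1)) :=
    valid_edge_of_eq (by norm_num) h (by norm_num) (by push_cast; ring)
  have hb (h : 3 * k ≤ 23600) :
      Valid (edge 2 (3 * k)) (entireXi (1 / 2 + (3 : ℕ) * (k / 1600) * I + 1)) :=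
    valid_edge_of_eq (by norm_num) h (by norm_num) (by push_cast; ring)
  have hm (h : 3 * k ≤ 23600) :
      Valid (edge 0 (3 * k)) (entireXi (1 / 2 + (3 : ℕ) * (k / 1600) * I)) :=
    valid_edge_of_eq (by norm_num) h (by norm_num) (by push_cast; ring)
  rcases Nat.eq_zero_or_pos k with hk | hk
  · have ha : Valid (rat 1 1) (entireXi (1 + (2 : ℕ) * (k / 1600) * I)) := fun _ => by
      simpa [hk] using holds_rat_one
    rw [edgesAt_of_eq_zero hk]
    exact ⟨hx, hu, fun _ => ha, hb, hm⟩
  · have ha (h : 2 * k ≤ 23600) :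
        Valid (edge 1 (2 * k)) (entireXi (1 + (2 : ℕ) * (k / 1600) * I)) :=
      valid_edge_of_eq (by norm_num) h (by omega) (by push_cast; ring)
    rw [edgesAt_of_pos hk]
    exact ⟨hx, hu, ha, hb, hm⟩

variable {k st : ℕ} {e f : Edges} {t : ℝ}

lemma valid_hull {A B : CBall} {w : ℂ} {c : ℕ} {g : ℂ → ℂ} (hg : Differentiable ℂ g)
    (hK : ∀ z : ℂ, z.re = w.re → ‖deriv (deriv g) z‖ ≤ 1 / 3)
    (h0 : k ≤ 1600 * t) (h1 : 1600 * t ≤ k + st) (hst : 0 < st)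
    (hA : Valid A (g (w + c * (k / 1600) * I)))
    (hB : Valid B (g (w + c * ((k + st : ℕ) / 1600) * I))) :
    Valid (hull A B 1 (c * st)) (g (w + c * t * I)) := fun h => by
  obtain ⟨r1, r2⟩ := rad_lt_of_hull h
  exact holds_hull_line hg (by simpa using hK) h0 h1 hst (hA r1) (hB r2)

lemma differentiable_entireXi_add_one : Differentiable ℂ fun w => entireXi (w + 1) := by
  have := differentiable_entireXi; fun_prop

lemma deriv_deriv_add_one_le {w : ℂ} (hw : w.re = 1 / 2) (z : ℂ) (hz : z.re = w.re) :
    ‖deriv (deriv fun w => entireXi (w + 1)) z‖ ≤ 1 / 3 := by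
  rw [deriv_entireXi_comp_add, deriv_comp_add_const (f := deriv entireXi)]
  apply norm_deriv_deriv_entireXi_le <;> simp [hz, hw] <;> norm_num

lemma valid_x (he : EdgesOK k e) (hf : EdgesOK (k + st) f) (h0 : k ≤ 1600 * t)
    (h1 : 1600 * t ≤ k + st) (hst : 0 < st) (hk : k + st ≤ 23600) :
    Valid (hull e.x f.x 1 st) (entireXi (1 / 2 + t * I)) := by
  have := valid_hull differentiable_entireXi
    (fun z hz => norm_deriv_deriv_entireXi_le (by norm_num [hz]) (by norm_num [hz])) h0 h1 hst
    (he.x (by omega)) (hf.x hk)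
  simpa using this

lemma valid_u (he : EdgesOK k e) (hf : EdgesOK (k + st) f) (h0 : k ≤ 1600 * t)
    (h1 : 1600 * t ≤ k + st) (hst : 0 < st) (hk : k + st ≤ 23600) :
    Valid (hull e.u f.u 1 st) (entireXi (1 / 2 + t * I + 1)) := by
  have := valid_hull differentiable_entireXi_add_one
    (deriv_deriv_add_one_le (by norm_num)) h0 h1 hst (he.u (by omega)) (hf.u hk)
  simpa using this

lemma valid_a (he : EdgesOK k e) (hf : EdgesOK (k + st) f) (h0 : k ≤ 1600 * t)
    (h1 : 1600 * t ≤ k + st) (hst : 0 < st) (hk : 2 * (k + st) ≤ 23600) :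
    Valid (hull e.a f.a 1 (2 * st)) (entireXi (2 * (1 / 2 + t * I))) := by
  have := valid_hull differentiable_entireXi
    (fun z hz => norm_deriv_deriv_entireXi_le (by norm_num [hz]) (by norm_num [hz])) h0 h1 hst
    (he.a (by omega)) (hf.a hk)
  convert this using 2
  push_cast; ring

lemma valid_b (he : EdgesOK k e) (hf : EdgesOK (k + st) f) (h0 : k ≤ 1600 * t)
    (h1 : 1600 * t ≤ k + st) (hst : 0 < st) (hk : 3 * (k + st) ≤ 23600) :
    Valid (hull e.b f.b 1 (3 * st)) (entireXi (3 * (1 / 2 + t * I))) := by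
  have := valid_hull differentiable_entireXi_add_one
    (deriv_deriv_add_one_le (by norm_num)) h0 h1 hst (he.b (by omega)) (hf.b hk)
  convert this using 2
  push_cast; ring

lemma valid_m (he : EdgesOK k e) (hf : EdgesOK (k + st) f) (h0 : k ≤ 1600 * t)
    (h1 : 1600 * t ≤ k + st) (hst : 0 < st) (hk : 3 * (k + st) ≤ 23600) :
    Valid (hull e.m f.m 1 (3 * st)) (entireXi (3 * (1 / 2 + t * I) - 1)) := by
  have := valid_hull differentiable_entireXi
    (fun z hz => norm_deriv_deriv_entireXi_le (by norm_num [hz]) (by norm_num [hz])) h0 h1 hst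
    (he.m (by omega)) (hf.m hk)
  convert this using 2
  push_cast; ring

lemma holds_dU (he : EdgesOK k e) (hf : EdgesOK (k + st) f) (h0 : k ≤ 1600 * t)
    (h1 : 1600 * t ≤ k + st) (hst : 0 < st) (hk : k + st ≤ 23600)
        (hx : (hull e.x f.x 1 st).rad < huge)
    (hu : (hull e.u f.u 1 st).rad < huge) :
    Holds (hull (e.u - e.x) (f.u - f.x) 2 st)
      (entireXi (1 / 2 + t * I + 1) - entireXi (1 / 2 + t * I)) := by
  obtain ⟨r1, r2⟩ := rad_lt_of_hull hx
  obtain ⟨r3, r4⟩ := rad_lt_of_hull hu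
  have := holds_hull_line (c := 1) (w := 1 / 2) (mult := 2)
    (f := fun w => entireXi (w + 1) - entireXi w)
    (differentiable_entireXi_add_one.sub differentiable_entireXi)
    (fun z hz => by
      have : z.re = 1 / 2 := by rw [hz]; norm_num
      have := norm_deriv_deriv_entireXi_sub_le (c := 1) (z := z) (by norm_num [this])
        (by norm_num [this]) (by norm_num [this]) (by norm_num [this])
      simpa using this) h0 h1 hst
    ((he.u (by omega) r3).sub (he.x (by omega) r1)) ((hf.u hk r4).sub (hf.x hk r2))
  simpa using this

lemma holds_db (he : EdgesOK k e) (hf : EdgesOK (k + st) f) (h0 : k ≤ 1600 * t)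
    (h1 : 1600 * t ≤ k + st) (hst : 0 < st) (hk : 3 * (k + st) ≤ 23600)
        (hb : (hull e.b f.b 1 (3 * st)).rad < huge)
    (hm : (hull e.m f.m 1 (3 * st)).rad < huge) :
    Holds (hull (e.b - e.m) (f.b - f.m) 2 (3 * st))
      (entireXi (3 * (1 / 2 + t * I)) - entireXi (3 * (1 / 2 + t * I) - 1)) := by
  obtain ⟨r1, r2⟩ := rad_lt_of_hull hb
  obtain ⟨r3, r4⟩ := rad_lt_of_hull hm
  have := holds_hull_line (c := 3) (w := 1 / 2) (mult := 2)
    (f := fun w => entireXi (w + 1) - entireXi w)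
    (differentiable_entireXi_add_one.sub differentiable_entireXi)
    (fun z hz => by
      have : z.re = 1 / 2 := by rw [hz]; norm_num
      have := norm_deriv_deriv_entireXi_sub_le (c := 1) (z := z) (by norm_num [this])
        (by norm_num [this]) (by norm_num [this]) (by norm_num [this])
      simpa using this) h0 h1 hst
    ((he.b (by omega) r1).sub (he.m (by omega) r3)) ((hf.b hk r2).sub (hf.m hk r4))
  convert this using 3 <;> push_cast <;> ring

lemma holds_da (he : EdgesOK k e) (hf : EdgesOK (k + st) f) (h0 : k ≤ 1600 * t)
    (h1 : 1600 * t ≤ k + st) (hst : 0 < st) (hk : 2 * (k + st) ≤ 23600)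
        (ha : (hull e.a f.a 1 (2 * st)).rad < huge) :
    Holds (hull (e.a - e.a.star) (f.a - f.a.star) 2 (2 * st))
      (entireXi (2 * (1 / 2 + t * I)) - conj (entireXi (2 * (1 / 2 + t * I)))) := by
  obtain ⟨r1, r2⟩ := rad_lt_of_hull ha
  have key (r : ℝ) : -(entireXi (1 + 2 * r * I + -1) - entireXi (1 + 2 * r * I))
      = entireXi (1 + 2 * r * I) - conj (entireXi (1 + 2 * r * I)) := by
    rw [← sub_eq_add_neg, entireXi_conj_of_re (by simp)]; ring
  have hd : Differentiable ℂ fun w => entireXi (w + -1) := by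
    have := differentiable_entireXi; fun_prop
  have := holds_hull_line (c := 2) (w := 1) (mult := 2)
    (f := fun w => -(entireXi (w + -1) - entireXi w))
    (hd.sub differentiable_entireXi).neg
    (fun z hz => by
      have hz' : z.re = 1 := by rw [hz]; norm_num
      have := norm_deriv_deriv_entireXi_sub_le (c := -1) (z := z) (by norm_num [hz'])
        (by norm_num [hz']) (by norm_num [hz']) (by norm_num [hz'])
      have e1 : deriv (fun w => -(entireXi (w + -1) - entireXi w))
        = -deriv (fun w => (entireXi (w + -1) - entireXi w)) := deriv.neg'
      have e2 : deriv (-deriv (fun w => (entireXi (w + -1) - entireXi w))) z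
        = -deriv (deriv (fun w => (entireXi (w + -1) - entireXi w))) z := deriv.neg
      rw [e1, e2, norm_neg]
      simpa using this) h0 h1 hst
    (A := e.a - e.a.star) (B := f.a - f.a.star)
    (by
      have h := he.a (by omega) r1
      have := key (k / 1600)
      push_cast at h this ⊢
      rw [this]
      exact h.sub h.star)
    (by
      have h := hf.a hk r2
      have := key ((k + st) / 1600)
      push_cast at h this ⊢
      rw [this]
      exact h.sub h.star)
  have h2 := key t
  push_cast at this
  rw [h2] at this
  convert this using 3 <;> ring_nf

end CBall

lemma norm_sin_le (z : ℂ) : ‖sin z‖ ≤ ‖z‖ * Real.exp (3 * ‖z‖) := by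
  have h : sin z = exp (-z * I) * ((1 - exp (2 * z * I)) * I / 2) := by
    rw [sin, show z * I = -z * I + 2 * z * I by ring, exp_add]; ring
  have h1 : ‖exp (-z * I)‖ ≤ Real.exp ‖z‖ := by
    refine (norm_exp_le_exp_norm _).trans (by simp)
  have h2 := norm_exp_sub_sum_le_norm_mul_exp (2 * z * I) 1
  simp only [Finset.range_one, Finset.sum_singleton, pow_zero, Nat.factorial_zero, Nat.cast_one,
    div_one, pow_one, norm_mul, norm_I, mul_one, Complex.norm_ofNat] at h2
  rw [h, norm_mul, norm_div, norm_mul, norm_I, norm_sub_rev, Complex.norm_ofNat]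
  calc _ ≤ Real.exp ‖z‖ * (2 * ‖z‖ * Real.exp (2 * ‖z‖) * 1 / 2) := by gcongr
    _ = ‖z‖ * (Real.exp ‖z‖ * Real.exp (2 * ‖z‖)) := by ring
    _ = _ := by rw [← Real.exp_add]; ring_nf

lemma Gamma_le_two {x : ℝ} (h1 : 1 / 2 ≤ x) (h2 : x ≤ 3 / 2) : Real.Gamma x ≤ 2 := by
  have hpi : √π ≤ 2 := by
    rw [Real.sqrt_le_left (by norm_num)]; linarith [Real.pi_lt_four]
  have h3 : Real.Gamma (3 / 2) = 1 / 2 * √π := by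
    rw [show (3 / 2 : ℝ) = 1 / 2 + 1 by norm_num, Real.Gamma_add_one (by norm_num),
      Real.Gamma_one_half_eq]
  refine (Real.convexOn_Gamma.le_max_of_mem_Icc (x := 1 / 2) (y := 3 / 2) (by norm_num)
    (by norm_num) ⟨h1, h2⟩).trans (max_le ?_ ?_)
  · rw [Real.Gamma_one_half_eq]; exact hpi
  · rw [h3]; linarith [Real.sqrt_nonneg π]

lemma norm_inv_Gamma_le {α : ℂ} (h1 : 1 / 2 ≤ α.re) (h2 : α.re ≤ 3 / 2) :
    ‖(Gamma α)⁻¹‖ ≤ 2 * Real.exp (3 * π * ‖1 - α‖) := by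
  rcases eq_or_ne α 1 with rfl | hα
  · simp
  have hα' : 1 - α ≠ 0 := sub_ne_zero.2 hα.symm
  have hG : Gamma α ≠ 0 := Gamma_ne_zero_of_re_pos (by linarith)
  have e1 := Gamma_mul_Gamma_one_sub α
  have e2 := Gamma_add_one (1 - α) hα'
  have hs : sin (π * α) = sin (π * (1 - α)) := by
    rw [mul_sub, mul_one, sin_pi_sub]
  have hs0 : sin (π * α) ≠ 0 := by
    rw [Ne, sin_eq_zero_iff]
    rintro ⟨k, hk⟩
    rw [mul_comm, mul_left_inj' (ofReal_ne_zero.2 Real.pi_ne_zero)] at hk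
    rw [hk] at h1 h2
    simp only [intCast_re] at h1 h2
    have : (0 : ℝ) < k := by linarith
    have : 0 < k := by exact_mod_cast this
    have : (k : ℝ) < 2 := by linarith
    have : k < 2 := by exact_mod_cast this
    exact hα (by rw [hk, show k = 1 by omega]; simp)
  have hpi : (π : ℂ) ≠ 0 := ofReal_ne_zero.2 Real.pi_ne_zero
  have e : (Gamma α)⁻¹ = Gamma (1 - α + 1) * sin (π * (1 - α)) / (π * (1 - α)) := by
    rw [eq_div_iff hs0] at e1
    rw [e2, ← hs, eq_div_iff (mul_ne_zero hpi hα'), inv_mul_eq_iff_eq_mul₀ hG]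
    linear_combination -(1 - α) * e1
  have h3 : ‖Gamma (1 - α + 1)‖ ≤ 2 := by
    refine (norm_Gamma_le (by simp; linarith)).trans (Gamma_le_two ?_ ?_) <;> simp <;> linarith
  have h4 := norm_sin_le (π * (1 - α))
  have h5 : 0 < ‖(π : ℂ) * (1 - α)‖ := norm_pos_iff.2 (mul_ne_zero hpi hα')
  rw [e, norm_div, div_le_iff₀ h5, norm_mul]
  have h6 : ‖(π : ℂ) * (1 - α)‖ = π * ‖1 - α‖ := by
    rw [norm_mul, norm_real, Real.norm_of_nonneg Real.pi_pos.le]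
  calc _ ≤ 2 * (‖(π : ℂ) * (1 - α)‖ * Real.exp (3 * ‖(π : ℂ) * (1 - α)‖)) := by gcongr
    _ = _ := by rw [h6]; ring_nf

lemma norm_inv_riemannZeta_le {w : ℂ} (hw : 1 < w.re) :
    ‖(riemannZeta w)⁻¹‖ ≤ ‖riemannZeta w.re‖ := by
  have h := ArithmeticFunction.LSeries_zeta_mul_Lseries_moebius hw
  rw [ArithmeticFunction.LSeries_zeta_eq_riemannZeta hw] at h
  rw [inv_eq_of_mul_eq_one_right h]
  have hs := (Complex.summable_one_div_nat_cpow (p := w.re)).2 (by simpa)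
  have hs' : Summable fun n : ℕ => 1 / (n : ℝ) ^ w.re := Real.summable_one_div_nat_rpow.2 hw
  have hz : riemannZeta w.re = ((∑' n : ℕ, 1 / (n : ℝ) ^ w.re : ℝ) : ℂ) := by
    rw [zeta_eq_tsum_one_div_nat_cpow (by simpa), ofReal_tsum]
    refine tsum_congr fun n => ?_
    rw [ofReal_div, ofReal_cpow (Nat.cast_nonneg n)]
    simp
  rw [hz, norm_real, Real.norm_of_nonneg (tsum_nonneg fun n => by positivity), LSeries]
  refine tsum_of_norm_bounded hs'.hasSum fun n => ?_
  rcases eq_or_ne n 0 with rfl | hn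
  · simp [Real.zero_rpow (by linarith : w.re ≠ 0)]
  rw [LSeries.term_of_ne_zero hn, norm_div, norm_natCast_cpow_of_pos (Nat.pos_of_ne_zero hn)]
  gcongr
  rw [← Int.cast_one, norm_intCast]
  exact_mod_cast ArithmeticFunction.abs_moebius_le_one

lemma norm_inv_Gamma_add_one_le {w : ℂ} (h1 : 1 ≤ w.re) (h2 : w.re ≤ 3) :
    ‖(Gamma (w / 2 + 1))⁻¹‖ ≤ 4 * Real.exp (3 * π * (1 + ‖w‖)) := by
  have hw : 1 ≤ ‖w‖ := h1.trans (re_le_norm w)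
  have h0 : w / 2 ≠ 0 := by
    rw [Ne, div_eq_zero_iff]; rintro (h | h)
    · rw [h] at h1; norm_num at h1
    · norm_num at h
  have h3 := norm_inv_Gamma_le (α := w / 2) (by simp; linarith) (by simp; linarith)
  have h4 : ‖1 - w / 2‖ ≤ 1 + ‖w‖ := by
    refine (norm_sub_le _ _).trans ?_
    rw [norm_div]
    simp
  have h5 : ‖(w / 2)⁻¹‖ ≤ 2 := by
    rw [norm_inv, norm_div, Complex.norm_ofNat, inv_div, div_le_iff₀ (by linarith)]; linarith
  rw [Gamma_add_one _ h0, mul_inv, norm_mul]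
  calc _ ≤ 2 * (2 * Real.exp (3 * π * ‖1 - w / 2‖)) := by gcongr
    _ ≤ 2 * (2 * Real.exp (3 * π * (1 + ‖w‖))) := by gcongr
    _ = _ := by ring

lemma inv_entireXi_eq {w : ℂ} (h0 : 1 < w.re) :
    (entireXi w)⁻¹ = (2 * (w - 1))⁻¹ * (Gamma (w / 2 + 1))⁻¹ * (π : ℂ) ^ (w / 2) *
        (riemannZeta w)⁻¹ := by
  have h1 : w ≠ 1 := by rintro rfl; simp at h0
  rw [entireXi_eq_Gamma (by linarith) h1, mul_inv, mul_inv, mul_inv, neg_div, cpow_neg, inv_inv]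

lemma norm_riemannZeta_ofReal_le {x : ℝ} (h1 : 1 < x) (h2 : x ≤ 3) :
    ‖riemannZeta x‖ ≤ 16 * π / 15 * (2 * Real.exp (3 * π * 4) * π ^ (3 / 2 : ℝ)) / (x - 1) := by
  have hx : (x : ℂ) - 1 ≠ 0 := by
    rw [sub_ne_zero]; exact_mod_cast h1.ne'
  have hG : Gamma ((x : ℂ) / 2 + 1) ≠ 0 := Gamma_ne_zero_of_re_pos (by simp; linarith)
  have hp : (π : ℂ) ^ ((x : ℂ) / 2) ≠ 0 := by
    rw [Ne, cpow_eq_zero_iff]; simp [Real.pi_ne_zero]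
  have h := entireXi_eq_Gamma (w := x) (by simp; linarith) (by exact_mod_cast h1.ne')
  have e : riemannZeta x = entireXi x * ((Gamma ((x : ℂ) / 2 + 1))⁻¹ * (π : ℂ) ^ ((x : ℂ) / 2) / 2)
      / (x - 1) := by
    rw [h, neg_div, cpow_neg]
    generalize Gamma ((x : ℂ) / 2 + 1) = G at hG
    field_simp
  have h3 := norm_inv_Gamma_add_one_le (w := x) (by simpa using h1.le) (by simpa using h2)
  have h4 : ‖(x : ℂ)‖ ≤ 3 := by rw [norm_real, Real.norm_of_nonneg (by linarith)]; exact h2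
  have h5 : ‖(π : ℂ) ^ ((x : ℂ) / 2)‖ ≤ π ^ (3 / 2 : ℝ) := by
    rw [norm_pi_cpow]
    exact Real.rpow_le_rpow_of_exponent_le (by linarith [Real.pi_gt_three]) (by simp; linarith)
  have h6 := norm_entireXi_le (w := x) (by simp; linarith) (by simp; linarith)
  have h7 : ‖(x : ℂ) - 1‖ = x - 1 := by
    rw [← ofReal_one, ← ofReal_sub, norm_real, Real.norm_of_nonneg (by linarith)]
  have h8 : Real.exp (3 * π * (1 + ‖(x : ℂ)‖)) ≤ Real.exp (3 * π * 4) :=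
    Real.exp_le_exp.2 (mul_le_mul_of_nonneg_left (by linarith) (by positivity))
  rw [e, norm_div, norm_mul, norm_div, norm_mul, h7, Complex.norm_ofNat]
  refine div_le_div_of_nonneg_right ?_ (by linarith)
  calc _ ≤ 16 * π / 15 * (4 * Real.exp (3 * π * 4) * π ^ (3 / 2 : ℝ) / 2) := by
        refine mul_le_mul h6 (div_le_div_of_nonneg_right (mul_le_mul ?_ h5 (by positivity)
          (by positivity)) (by norm_num)) (by positivity) (by positivity)
        exact h3.trans (by linarith)
    _ = _ := by ring

lemma norm_inv_entireXi_le : ∃ C > 0, ∀ w : ℂ, 1 < w.re → w.re ≤ 3 →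
    ‖(entireXi w)⁻¹‖ ≤ C * Real.exp (3 * π * ‖w‖) / (w.re - 1) ^ 2 := by
  refine ⟨2 * Real.exp (3 * π) * π ^ (3 / 2 : ℝ)
    * (16 * π / 15 * (2 * Real.exp (3 * π * 4) * π ^ (3 / 2 : ℝ))), by positivity,
        fun w h1 h2 => ?_⟩
  have h3 := norm_inv_Gamma_add_one_le h1.le h2
  have h4 := (norm_inv_riemannZeta_le h1).trans (norm_riemannZeta_ofReal_le h1 h2)
  have h5 : ‖(π : ℂ) ^ (w / 2)‖ ≤ π ^ (3 / 2 : ℝ) := by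
    rw [norm_pi_cpow]
    exact Real.rpow_le_rpow_of_exponent_le (by linarith [Real.pi_gt_three]) (by simp; linarith)
  have hp : 0 < w.re - 1 := by linarith
  have h6 : ‖(2 * (w - 1))⁻¹‖ ≤ 1 / (2 * (w.re - 1)) := by
    have := re_le_norm (w - 1)
    simp only [sub_re, one_re] at this
    rw [norm_inv, norm_mul, Complex.norm_ofNat, ← one_div]
    exact one_div_le_one_div_of_le (by linarith) (by linarith)
  rw [inv_entireXi_eq h1, norm_mul, norm_mul, norm_mul]
  set K := 16 * π / 15 * (2 * Real.exp (3 * π * 4) * π ^ (3 / 2 : ℝ))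
  calc _ ≤ 1 / (2 * (w.re - 1)) * (4 * Real.exp (3 * π * (1 + ‖w‖))) * π ^ (3 / 2 : ℝ)
        * (K / (w.re - 1)) := by
        refine mul_le_mul (mul_le_mul (mul_le_mul h6 h3 (norm_nonneg _) (by positivity)) h5
          (norm_nonneg _) (by positivity)) h4 (norm_nonneg _) (by positivity)
    _ = _ := by rw [mul_add, Real.exp_add, mul_one]; field_simp; ring

lemma norm_betaIntegral_half_le : ∃ C > 0, ∀ α : ℂ, 1 ≤ α.re → ‖betaIntegral α (1 / 2)‖ ≤ C := by
  have hint : IntervalIntegrable (fun x : ℝ => (1 - x) ^ (-1 / 2 : ℝ)) volume 0 1 := by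
    have := (intervalIntegral.intervalIntegrable_rpow' (a := 0) (b := 1)
      (r := (-1 / 2 : ℝ)) (by norm_num)).comp_sub_left 1
    simpa using this.symm
  refine ⟨|∫ x in (0 : ℝ)..1, (1 - x) ^ (-1 / 2 : ℝ)| + 1, by positivity, fun α hα => ?_⟩
  rw [betaIntegral]
  have := intervalIntegral.norm_integral_le_of_norm_le (a := 0) (b := 1) (by norm_num)
    (f := fun x : ℝ => (x : ℂ) ^ (α - 1) * (1 - (x : ℂ)) ^ ((1 : ℂ) / 2 - 1))
    (g := fun x => (1 - x) ^ (-1 / 2 : ℝ)) (μ := volume) ?_ hint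
  · exact this.trans ((le_abs_self _).trans (by linarith))
  · have h1 : ∀ᵐ x : ℝ, x ≠ 1 := by
      simp [ae_iff, measure_singleton]
    filter_upwards [h1] with x hx1 hx
    have hx2 : 0 < 1 - x := by
      have := lt_of_le_of_ne hx.2 hx1
      linarith
    rw [norm_mul, norm_cpow_eq_rpow_re_of_pos hx.1]
    have : (1 - (x : ℂ)) = ((1 - x : ℝ) : ℂ) := by push_cast; ring
    rw [this, norm_cpow_eq_rpow_re_of_pos hx2]
    have h2 : x ^ (α - 1).re ≤ 1 := Real.rpow_le_one hx.1.le hx.2 (by simp; linarith)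
    have h3 : ((1 : ℂ) / 2 - 1).re = -1 / 2 := by norm_num
    rw [h3]
    exact mul_le_of_le_one_left (by positivity) h2

lemma norm_entireXi_sub_one_div_le : ∃ C > 0, ∀ w : ℂ, 3 ≤ w.re →
    ‖entireXi (w - 1) / entireXi w‖ ≤ C := by
  obtain ⟨C, hC, hβ⟩ := norm_betaIntegral_half_le
  have hS : HasSum (fun n : ℕ => 1 / (n : ℝ) ^ 2) (π ^ 2 / 6) := hasSum_zeta_two
  refine ⟨C * (π ^ 2 / 6) * (π ^ 2 / 6), by positivity, fun w hw => ?_⟩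
  have hG : Gamma ((w - 1) / 2 + 1) * √π = Gamma (w / 2 + 1) * betaIntegral (w / 2 + 1 / 2)
      (1 / 2) := by
    have := Gamma_mul_Gamma_eq_betaIntegral (s := w / 2 + 1 / 2) (t := 1 / 2)
      (by simp; linarith) (by norm_num)
    rw [Gamma_one_half_eq] at this
    rw [show (w - 1) / 2 + 1 = w / 2 + 1 / 2 by ring,
      show w / 2 + 1 = w / 2 + 1 / 2 + 1 / 2 by ring, ← this]
    congr 1
    rw [Real.sqrt_eq_rpow, ofReal_cpow Real.pi_pos.le]
    norm_num
  have hG0 : Gamma (w / 2 + 1) ≠ 0 := Gamma_ne_zero_of_re_pos (by simp; linarith)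
  have hw1 : w - 1 ≠ 0 := fun h => by
    have := congrArg Complex.re h
    simp at this; linarith
  have hp : (π : ℂ) ^ (w / 2) ≠ 0 := by
    rw [Ne, cpow_eq_zero_iff]; simp [Real.pi_ne_zero]
  have hpi : (π : ℂ) ^ (-(w - 1) / 2) = √π * ((π : ℂ) ^ (w / 2))⁻¹ := by
    rw [← cpow_neg, show -(w - 1) / 2 = 1 / 2 + -(w / 2) by ring,
      cpow_add _ _ (ofReal_ne_zero.2 Real.pi_ne_zero), Real.sqrt_eq_rpow,
          ofReal_cpow Real.pi_pos.le]
    norm_num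
  have e : entireXi (w - 1) / entireXi w = (w - 2) / (w - 1)
      * betaIntegral (w / 2 + 1 / 2) (1 / 2) * riemannZeta (w - 1) * (riemannZeta w)⁻¹ := by
    rw [div_eq_mul_inv, inv_entireXi_eq (by linarith), entireXi_eq_Gamma (by simp; linarith)
      (fun h => by rw [h] at hw1; have := congrArg Complex.re h; simp at this; linarith), hpi]
    have : Gamma ((w - 1) / 2 + 1) * √π * (Gamma (w / 2 + 1))⁻¹
        = betaIntegral (w / 2 + 1 / 2) (1 / 2) := by
      rw [hG, mul_comm, inv_mul_cancel_left₀ hG0]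
    rw [← this]
    field_simp
    ring
  have n1 : ‖(w - 2) / (w - 1)‖ ≤ 1 := by
    rw [norm_div, div_le_one (norm_pos_iff.2 hw1)]
    apply (sq_le_sq₀ (norm_nonneg _) (norm_nonneg _)).1
    rw [← normSq_eq_norm_sq, ← normSq_eq_norm_sq, normSq_apply, normSq_apply]
    simp; nlinarith
  have n2 := hβ (w / 2 + 1 / 2) (by simp; linarith)
  have n3 := norm_riemannZeta_le (w := w - 1) (k := 2) (by norm_num) (by simp; linarith) hS
  have n4 := (norm_inv_riemannZeta_le (w := w) (by linarith)).trans
    (norm_riemannZeta_le (w := w.re) (k := 2) (by norm_num) (by simp; linarith) hS)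
  rw [e, norm_mul, norm_mul, norm_mul]
  calc _ ≤ 1 * C * (π ^ 2 / 6) * (π ^ 2 / 6) := by gcongr
    _ = _ := by ring

/-- The function `g + λ s (s - 1) (…)` divided by `s - 1`, where `wengG2Plong` is, up to an
elementary factor, `g s - g (1 - s)`. -/
noncomputable def num (s : ℂ) : ℂ :=
  entireXi (2 * s) * entireXi (s + 1) * entireXi (3 * s)
      * ((eps * s + (1 - eps)) * ((s - 1) * (3 * s - 2)))
    - entireXi (2 * s) * entireXi s * entireXi (3 * s - 1) * ((s + 1) * (s - 2))
    - 2 * entireXi (2 * s) * entireXi s * entireXi (3 * s) * ((s - 1) * (s - 2))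
    - lam * s * (entireXi s * entireXi (3 * s - 1) * (entireXi (2 * s) + entireXi (2 * s - 1)))

/-- A comparison function for `num` in the half-plane `1 / 2 ≤ re s`. -/
noncomputable def den (s : ℂ) : ℂ :=
  entireXi (2 * s) * (entireXi (s + 1) * (entireXi (3 * s) * (s * (s + 8) * (s - 2 / 3))))

lemma differentiable_num : Differentiable ℂ num := by
  have := differentiable_entireXi
  unfold num
  fun_prop

lemma den_ne_zero {s : ℂ} (hs : 1 / 2 ≤ s.re) (h : s ≠ 2 / 3) : den s ≠ 0 := by
  have h1 : entireXi (2 * s) ≠ 0 := entireXi_ne_zero (by simp; linarith)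
  have h2 : entireXi (s + 1) ≠ 0 := entireXi_ne_zero (by simp; linarith)
  have h3 : entireXi (3 * s) ≠ 0 := entireXi_ne_zero (by simp; linarith)
  have h4 : s ≠ 0 := by rintro rfl; norm_num at hs
  have h5 : s + 8 ≠ 0 := fun h => by
    have := congrArg Complex.re h
    simp at this; linarith
  simp [den, *, sub_eq_zero]

lemma num_conj (s : ℂ) : num (conj s) = conj (num s) := by
  have e1 : 2 * conj s = conj (2 * s) := by simp [map_ofNat]
  have e2 : conj s + 1 = conj (s + 1) := by simp
  have e3 : 3 * conj s = conj (3 * s) := by simp [map_ofNat]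
  have e4 : 3 * conj s - 1 = conj (3 * s - 1) := by simp [map_ofNat]
  have e5 : 2 * conj s - 1 = conj (2 * s - 1) := by simp [map_ofNat]
  rw [num, num, e4, e5, e1, e2, e3]
  simp only [entireXi_conj]
  simp [map_ofNat]

lemma den_conj (s : ℂ) : den (conj s) = conj (den s) := by
  have e1 : 2 * conj s = conj (2 * s) := by simp [map_ofNat]
  have e2 : conj s + 1 = conj (s + 1) := by simp
  have e3 : 3 * conj s = conj (3 * s) := by simp [map_ofNat]
  rw [den, den, e1, e2, e3]
  simp only [entireXi_conj]
  simp [map_ofNat]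

lemma entireXi_two_mul_sub_one {s : ℂ} (hs : s.re = 1 / 2) :
    entireXi (2 * s - 1) = conj (entireXi (2 * s)) := entireXi_conj_of_re (by simp [hs])

lemma num_eq_of_mid {s : ℂ} (hs : s.re = 1 / 2) : num s =
    entireXi (2 * s) * ((eps * s + (1 - eps)) * ((s - 1) * (3 * s - 2)) * entireXi (s + 1)
      - 2 * (entireXi s * ((s - 1) * (s - 2)))) * entireXi (3 * s)
    - entireXi s * (((s + 1) * (s - 2) + lam * s) * entireXi (2 * s)
        + lam * s * conj (entireXi (2 * s))) * entireXi (3 * s - 1) := by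
  rw [num, entireXi_two_mul_sub_one hs]; ring

/-- Discarding the precise value of `E (3 s - 1) / E (3 s)`. -/
lemma re_num_mul_conj_den_of_mid {s : ℂ} (hs : s.re = 1 / 2)
    (hq : ‖entireXi (3 * s - 1)‖ ≤ ‖entireXi (3 * s)‖)
    (h : ‖entireXi s * (((s + 1) * (s - 2) + lam * s) * entireXi (2 * s)
          + lam * s * conj (entireXi (2 * s)))‖
        * ‖entireXi (2 * s) * entireXi (s + 1) * (s * (s + 8) * (s - 2 / 3))‖
      < (entireXi (2 * s) * ((eps * s + (1 - eps)) * ((s - 1) * (3 * s - 2)) * entireXi (s + 1)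
          - 2 * (entireXi s * ((s - 1) * (s - 2))))
        * conj (entireXi (2 * s) * entireXi (s + 1) * (s * (s + 8) * (s - 2 / 3)))).re) :
    0 < (num s * conj (den s)).re := by
  have hb : 0 < ‖entireXi (3 * s)‖ := norm_pos_iff.2 (entireXi_ne_zero (by simp [hs]; norm_num))
  rw [num_eq_of_mid hs]
  have hd : den s = entireXi (2 * s) * entireXi (s + 1) * (s * (s + 8) * (s - 2 / 3))
      * entireXi (3 * s) := by rw [den]; ring
  rw [hd]
  set b := entireXi (3 * s)
  set m := entireXi (3 * s - 1)
  set M := entireXi s * (((s + 1) * (s - 2) + lam * s) * entireXi (2 * s)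
          + lam * s * conj (entireXi (2 * s)))
  set D := entireXi (2 * s) * entireXi (s + 1) * (s * (s + 8) * (s - 2 / 3))
  set N := entireXi (2 * s) * ((eps * s + (1 - eps)) * ((s - 1) * (3 * s - 2)) * entireXi (s + 1)
          - 2 * (entireXi s * ((s - 1) * (s - 2))))
  have e : (N * b - M * m) * conj (D * b) = ((‖b‖ ^ 2 : ℝ) : ℂ) * (N * conj D) - M * m *
      conj (D * b) := by
    rw [← normSq_eq_norm_sq, normSq_eq_conj_mul_self, map_mul]; ring
  rw [e, sub_re, re_ofReal_mul]
  have h1 : (M * m * conj (D * b)).re ≤ ‖M‖ * ‖D‖ * ‖b‖ ^ 2 := by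
    refine (re_le_norm _).trans ?_
    rw [norm_mul, norm_mul M, norm_conj, norm_mul D]
    calc ‖M‖ * ‖m‖ * (‖D‖ * ‖b‖) ≤ ‖M‖ * ‖b‖ * (‖D‖ * ‖b‖) := by gcongr
      _ = _ := by ring
  have h2 := mul_pos (pow_pos hb 2) (sub_pos.2 h)
  nlinarith

/-- Discarding also the precise value of `E (2 s - 1) / E (2 s)`. -/
lemma re_num_mul_conj_den_of_far {s : ℂ} (hs : s.re = 1 / 2)
    (hq : ‖entireXi (3 * s - 1)‖ ≤ ‖entireXi (3 * s)‖)
    (h : ‖entireXi s‖ * (‖(s + 1) * (s - 2) + lam * s‖ + ‖lam * s‖)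
        * ‖entireXi (s + 1) * (s * (s + 8) * (s - 2 / 3))‖
      < (((eps * s + (1 - eps)) * ((s - 1) * (3 * s - 2)) * entireXi (s + 1)
          - 2 * (entireXi s * ((s - 1) * (s - 2))))
        * conj (entireXi (s + 1) * (s * (s + 8) * (s - 2 / 3)))).re) :
    0 < (num s * conj (den s)).re := by
  apply re_num_mul_conj_den_of_mid hs hq
  have ha : 0 < ‖entireXi (2 * s)‖ := norm_pos_iff.2 (entireXi_ne_zero (by simp [hs]))
  set a := entireXi (2 * s)
  set M1 := (s + 1) * (s - 2) + lam * s
  set D := s * (s + 8) * (s - 2 / 3)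
  set U := entireXi (s + 1)
  set N := ((eps * s + (1 - eps)) * ((s - 1) * (3 * s - 2)) * U
          - 2 * (entireXi s * ((s - 1) * (s - 2))))
  have e : a * N * conj (a * U * D) = ((‖a‖ ^ 2 : ℝ) : ℂ) * (N * conj (U * D)) := by
    rw [← normSq_eq_norm_sq, normSq_eq_conj_mul_self]; simp only [map_mul]; ring
  rw [e, re_ofReal_mul]
  have h1 : ‖entireXi s * (M1 * a + lam * s * conj a)‖
      ≤ ‖entireXi s‖ * (‖M1‖ + ‖lam * s‖) * ‖a‖ := by
    rw [norm_mul]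
    have : ‖M1 * a + lam * s * conj a‖ ≤ (‖M1‖ + ‖lam * s‖) * ‖a‖ := by
      refine (norm_add_le _ _).trans (le_of_eq ?_)
      rw [norm_mul, norm_mul _ (conj a), norm_conj]; ring
    calc _ ≤ ‖entireXi s‖ * ((‖M1‖ + ‖lam * s‖) * ‖a‖) := by gcongr
      _ = _ := by ring
  have h3 : ‖a * U * D‖ = ‖a‖ * ‖U * D‖ := by rw [mul_assoc, norm_mul]
  rw [h3]
  calc _ ≤ ‖entireXi s‖ * (‖M1‖ + ‖lam * s‖) * ‖a‖ * (‖a‖ * ‖U * D‖) := by gcongr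
    _ = ‖a‖ ^ 2 * (‖entireXi s‖ * (‖M1‖ + ‖lam * s‖) * ‖U * D‖) := by ring
    _ < _ := mul_lt_mul_of_pos_left h (pow_pos ha 2)

namespace CBall

lemma re_pos_of_seg {mode k st : ℕ} {e f : Edges} {t : ℝ}
    (hq : ∀ w : ℂ, 1 ≤ w.re → ‖entireXi (w - 1)‖ ≤ ‖entireXi w‖)
    (he : EdgesOK k e) (hf : EdgesOK (k + st) f) (h0 : k ≤ 1600 * t)
    (h1 : 1600 * t ≤ k + st) (hst : 0 < st) (h : seg mode k st e f = true) :
    0 < (num (1 / 2 + t * I) * conj (den (1 / 2 + t * I))).re := by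
  have hs := holds_sB h0 h1
  have hre : (1 / 2 + t * I : ℂ).re = 1 / 2 := by simp
  have hq3 : ‖entireXi (3 * (1 / 2 + t * I) - 1)‖ ≤ ‖entireXi (3 * (1 / 2 + t * I))‖ :=
    hq _ (by simp; norm_num)
  match mode, h with
  | 0, h =>
    rw [seg, Bool.and_eq_true, Nat.ble_eq] at h
    obtain ⟨hk, h⟩ := h
    have hk1 : k + st ≤ 23600 := by omega
    have hk2 : 2 * (k + st) ≤ 23600 := by omega
    have := of_segNear hs (valid_x he hf h0 h1 hst hk1) (valid_u he hf h0 h1 hst hk1)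
      (valid_a he hf h0 h1 hst hk2) (valid_b he hf h0 h1 hst hk) (valid_m he hf h0 h1 hst hk)
      (holds_dU he hf h0 h1 hst hk1) (holds_db he hf h0 h1 hst hk) (holds_da he hf h0 h1 hst hk2) h
    rwa [num, den, entireXi_two_mul_sub_one hre]
  | 1, h =>
    rw [seg, Bool.and_eq_true, Nat.ble_eq] at h
    obtain ⟨hk, h⟩ := h
    have hk1 : k + st ≤ 23600 := by omega
    exact re_num_mul_conj_den_of_mid hre hq3
      (of_segMid hs (valid_x he hf h0 h1 hst hk1) (valid_u he hf h0 h1 hst hk1)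
        (valid_a he hf h0 h1 hst hk) h)
  | _ + 2, h =>
    rw [seg, Bool.and_eq_true, Nat.ble_eq] at h
    obtain ⟨hk, h⟩ := h
    exact re_num_mul_conj_den_of_far hre hq3
      (of_segFar hs (valid_x he hf h0 h1 hst hk) (valid_u he hf h0 h1 hst hk) h)
    all_goals simp

lemma re_pos_of_run {mode st : ℕ} {t : ℝ}
    (hq : ∀ w : ℂ, 1 ≤ w.re → ‖entireXi (w - 1)‖ ≤ ‖entireXi w‖) (hst : 0 < st) (n : ℕ) :
    ∀ (k : ℕ) (e : Edges), EdgesOK k e → run mode st n k e = true → (k : ℝ) < 1600 * t →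
      1600 * t ≤ (k + n * st : ℕ) → 0 < (num (1 / 2 + t * I) * conj (den (1 / 2 + t * I))).re := by
  induction n with
  | zero => intro k e _ _ h0 h1; push_cast at h1; linarith
  | succ n ih =>
    intro k e he h h0 h1
    rw [run, Bool.and_eq_true] at h
    rcases le_or_gt (1600 * t) ((k + st : ℕ) : ℝ) with h2 | h2
    · exact re_pos_of_seg hq he (edgesOK_edgesAt _) h0.le (by simpa using h2) hst h.1
    · refine ih _ _ (edgesOK_edgesAt _) h.2 h2 ?_
      convert h1 using 2
      ring

lemma run_near_0 : run 0 16 32 0 (edgesAt 0) = true := by decide +kernel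
lemma run_near_512 : run 0 32 22 512 (edgesAt 512) = true := by decide +kernel
lemma run_near_1216 : run 0 64 21 1216 (edgesAt 1216) = true := by decide +kernel
lemma run_near_2560 : run 0 128 25 2560 (edgesAt 2560) = true := by decide +kernel
lemma run_near_5760 : run 0 64 23 5760 (edgesAt 5760) = true := by decide +kernel
lemma run_near_7232 : run 0 32 19 7232 (edgesAt 7232) = true := by decide +kernel
lemma run_mid_7840 : run 1 8 14 7840 (edgesAt 7840) = true := by decide +kernel
lemma run_mid_7952 : run 1 16 23 7952 (edgesAt 7952) = true := by decide +kernel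
lemma run_mid_8320 : run 1 32 42 8320 (edgesAt 8320) = true := by decide +kernel
lemma run_far_9664 : run 2 32 12 9664 (edgesAt 9664) = true := by decide +kernel
lemma run_far_10048 : run 2 64 13 10048 (edgesAt 10048) = true := by decide +kernel
lemma run_far_10880 : run 2 128 15 10880 (edgesAt 10880) = true := by decide +kernel
lemma run_far_12800 : run 2 256 22 12800 (edgesAt 12800) = true := by decide +kernel

end CBall

open CBall in
lemma re_num_mul_conj_den_pos_of_le {t : ℝ}
    (hq : ∀ w : ℂ, 1 ≤ w.re → ‖entireXi (w - 1)‖ ≤ ‖entireXi w‖) (h0 : 0 ≤ t) (h1 : t ≤ 11.52) :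
    0 < (num (1 / 2 + t * I) * conj (den (1 / 2 + t * I))).re := by
  have key {mode st n k : ℕ} (h : run mode st n k (edgesAt k) = true) (hst : 0 < st)
      (h2 : 1600 * t ≤ (k + n * st : ℕ)) (h3 : (k : ℝ) < 1600 * t) :=
    re_pos_of_run hq hst n k _ (edgesOK_edgesAt k) h h3 h2
  rcases h0.eq_or_lt with rfl | h0
  · have := run_near_0
    rw [run, Bool.and_eq_true] at this
    exact re_pos_of_seg hq (edgesOK_edgesAt 0) (edgesOK_edgesAt 16) (by simp) (by norm_num)
      (by norm_num) this.1
  by_contra H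
  have h2 {mode st n k : ℕ} (h : run mode st n k (edgesAt k) = true) (hst : 0 < st)
      (h2 : 1600 * t ≤ (k + n * st : ℕ)) : 1600 * t ≤ k :=
    le_of_not_gt fun h3 => H (key h hst h2 h3)
  have a1 := h2 run_far_12800 (by norm_num) (by norm_num; linarith)
  have a2 := h2 run_far_10880 (by norm_num) (by norm_num at a1 ⊢; linarith)
  have a3 := h2 run_far_10048 (by norm_num) (by norm_num at a2 ⊢; linarith)
  have a4 := h2 run_far_9664 (by norm_num) (by norm_num at a3 ⊢; linarith)
  have a5 := h2 run_mid_8320 (by norm_num) (by norm_num at a4 ⊢; linarith)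
  have a6 := h2 run_mid_7952 (by norm_num) (by norm_num at a5 ⊢; linarith)
  have a7 := h2 run_mid_7840 (by norm_num) (by norm_num at a6 ⊢; linarith)
  have a8 := h2 run_near_7232 (by norm_num) (by norm_num at a7 ⊢; linarith)
  have a9 := h2 run_near_5760 (by norm_num) (by norm_num at a8 ⊢; linarith)
  have a10 := h2 run_near_2560 (by norm_num) (by norm_num at a9 ⊢; linarith)
  have a11 := h2 run_near_1216 (by norm_num) (by norm_num at a10 ⊢; linarith)
  have a12 := h2 run_near_512 (by norm_num) (by norm_num at a11 ⊢; linarith)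
  have a13 := h2 run_near_0 (by norm_num) (by norm_num at a12 ⊢; linarith)
  norm_num at a13
  linarith

/-- A Phragmén–Lindelöf principle in the right half-plane for functions of exponential type. -/
lemma norm_le_of_exp_growth {f : ℂ → ℂ} {C K A M : ℝ}
    (hd : ∀ z : ℂ, 0 ≤ z.re → DifferentiableAt ℂ f z)
    (hexp : ∀ z : ℂ, 0 < z.re → M ≤ ‖z‖ → ‖f z‖ ≤ K * Real.exp (A * ‖z‖))
    (hre : ∃ R N : ℝ, ∀ x : ℝ, N ≤ x → ‖f x‖ ≤ R) (him : ∀ x : ℝ, ‖f (x * I)‖ ≤ C) {z : ℂ}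
    (hz : 0 ≤ z.re) : ‖f z‖ ≤ C := by
  refine PhragmenLindelof.right_half_plane_of_bounded_on_real ?_ ⟨1, by norm_num, A, ?_⟩ ?_ him hz
  · apply DifferentiableOn.diffContOnCl
    intro z hz
    refine (hd z ?_).differentiableWithinAt
    rwa [closure_setOfPred_lt_re] at hz
  · refine Asymptotics.IsBigO.of_bound K ?_
    have h1 : ∀ᶠ z in Bornology.cobounded ℂ, M ≤ ‖z‖ :=
      tendsto_norm_cobounded_atTop.eventually_ge_atTop M
    filter_upwards [mem_inf_of_left h1, mem_inf_of_right (mem_principal_self _)] with z h1 h2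
    simpa [abs_of_pos (Real.exp_pos _)] using hexp z h2 h1
  · obtain ⟨R, N, h⟩ := hre
    refine ⟨R, ?_⟩
    rw [eventually_map]
    filter_upwards [eventually_ge_atTop N] with x hx using h x hx

lemma differentiableAt_div_entireXi {f : ℂ → ℂ} {c z : ℂ} (hf : Differentiable ℂ f)
    (hz : 1 ≤ z.re + c.re) : DifferentiableAt ℂ (fun z => f z / entireXi (z + c)) z := by
  have := differentiable_entireXi
  refine (hf z).div (by fun_prop) (entireXi_ne_zero (by simpa))

lemma norm_half_disc_factor {x y : ℝ} (h : x ^ 2 + y ^ 2 = 4) (hx : 0 ≤ x) :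
    ‖((x + y * I : ℂ) ^ 2 + 4)‖ = 4 * x := by
  rw [← sq_eq_sq₀ (norm_nonneg _) (by positivity), ← normSq_eq_norm_sq, normSq_apply]
  have e1 : ((x + y * I : ℂ) ^ 2 + 4).re = x ^ 2 - y ^ 2 + 4 := by simp [pow_two]
  have e2 : ((x + y * I : ℂ) ^ 2 + 4).im = 2 * x * y := by simp [pow_two]; ring
  rw [e1, e2, show y ^ 2 = 4 - x ^ 2 by linarith]
  linear_combination 4 * x ^ 2 * h

lemma norm_entireXi_div_of_re_eq_zero {z : ℂ} (hz : z.re = 0) :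
    ‖entireXi z / entireXi (z + 1)‖ = 1 := by
  have h := entireXi_conj_of_re (w := z + 1) (by simp [hz])
  rw [add_sub_cancel_right] at h
  rw [h, norm_div, norm_conj, div_self]
  exact norm_ne_zero_iff.2 (entireXi_ne_zero (by simp [hz]))

lemma norm_entireXi_div_le_exp : ∃ K > 0, ∀ z : ℂ, 0 < z.re →
    ‖entireXi z / entireXi (z + 1)‖ ≤ K * Real.exp (3 * π * ‖z‖) := by
  obtain ⟨C, hC, h1⟩ := norm_inv_entireXi_le
  obtain ⟨C', hC', h2⟩ := norm_entireXi_sub_one_div_le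
  have hraw {z : ℂ} (h0 : 0 < z.re) (hz : z.re ≤ 2) : ‖entireXi z / entireXi (z + 1)‖
      ≤ 16 * π / 15 * (C * Real.exp (3 * π)) * Real.exp (3 * π * ‖z‖) / z.re ^ 2 := by
    have h3 := h1 (z + 1) (by simpa) (by simp; linarith)
    have h4 := norm_entireXi_le (w := z) (by linarith) (by linarith)
    simp only [add_re, one_re, add_sub_cancel_right] at h3
    have h5 : ‖z + 1‖ ≤ 1 + ‖z‖ := by simpa [add_comm] using norm_add_le z 1
    rw [div_eq_mul_inv, norm_mul]
    have h6 : C * Real.exp (3 * π * ‖z + 1‖) / z.re ^ 2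
        ≤ C * (Real.exp (3 * π) * Real.exp (3 * π * ‖z‖)) / z.re ^ 2 := by
      rw [← Real.exp_add]
      refine div_le_div_of_nonneg_right (mul_le_mul_of_nonneg_left (Real.exp_le_exp.2 ?_) hC.le)
        (by positivity)
      nlinarith [Real.pi_pos]
    calc _ ≤ 16 * π / 15 * (C * (Real.exp (3 * π) * Real.exp (3 * π * ‖z‖)) / z.re ^ 2) :=
          mul_le_mul h4 (h3.trans h6) (norm_nonneg _) (by positivity)
      _ = _ := by ring
  set K := 16 * π / 15 * (C * Real.exp (3 * π)) with hK
  have hK0 : 0 < K := by positivity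
  refine ⟨max C' (max K (4 + K * Real.exp (6 * π))), by positivity, fun z hz => ?_⟩
  have he : 1 ≤ Real.exp (3 * π * ‖z‖) := Real.one_le_exp (by positivity)
  rcases le_or_gt 2 z.re with hz2 | hz2
  · have := h2 (z + 1) (by simp; linarith)
    rw [add_sub_cancel_right] at this
    calc _ ≤ C' * 1 := by linarith
      _ ≤ _ := mul_le_mul (le_max_left _ _) he zero_le_one (by positivity)
  rcases le_or_gt 1 z.re with hz1 | hz1
  · refine (hraw hz hz2.le).trans ?_
    calc _ ≤ K * Real.exp (3 * π * ‖z‖) := div_le_self (by positivity) (one_le_pow₀ hz1)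
      _ ≤ _ := mul_le_mul_of_nonneg_right ((le_max_left _ _).trans (le_max_right _ _))
          (by positivity)
  set c : ℂ := z.im * I with hc
  have hzc : z = c + z.re := by rw [hc, add_comm]; exact (re_add_im z).symm
  have hcn : ‖c‖ ≤ ‖z‖ := by
    rw [hc, norm_mul, norm_I, mul_one, norm_real]; exact abs_im_le_norm z
  set S := Metric.ball c 2 ∩ {w : ℂ | 0 < w.re} with hS
  have hSo : IsOpen S := Metric.isOpen_ball.inter (isOpen_lt continuous_const continuous_re)
  have hScl : closure S ⊆ Metric.closedBall c 2 ∩ {w : ℂ | 0 ≤ w.re} := by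
    refine (closure_inter_subset_inter_closure _ _).trans
      (inter_subset_inter Metric.closure_ball_subset_closedBall ?_)
    rw [closure_setOfPred_lt_re]
  have key := norm_le_of_forall_mem_frontier_norm_le (U := S)
    (f := fun w => entireXi w / entireXi (w + 1) * ((w - c) ^ 2 + 4) ^ 2)
    (C := 64 * Real.exp (3 * π * ‖z‖) + 16 * (K * Real.exp (6 * π) * Real.exp (3 * π * ‖z‖)))
    (Metric.isBounded_ball.subset inter_subset_left)
    (DifferentiableOn.diffContOnCl fun w hw => by
      have := differentiableAt_div_entireXi (z := w) (c := 1) differentiable_entireXi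
        (by simpa using (hScl hw).2)
      exact (this.mul (by fun_prop)).differentiableWithinAt)
    (fun w hw => by
      have h3 := hScl (frontier_subset_closure hw)
      have h4 : w ∉ S := by
        rw [hSo.frontier_eq] at hw; exact hw.2
      have h5 : ‖w - c‖ ≤ 2 := by simpa [dist_eq_norm] using h3.1
      have h6 : 0 ≤ w.re := h3.2
      have h7 : (w - c).re = w.re := by simp [hc]
      rw [norm_mul, norm_pow]
      rcases h6.eq_or_lt with h6 | h6
      · rw [norm_entireXi_div_of_re_eq_zero h6.symm, one_mul]
        have : ‖(w - c) ^ 2 + 4‖ ≤ 8 := by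
          refine (norm_add_le _ _).trans ?_
          rw [norm_pow, Complex.norm_ofNat]
          nlinarith [norm_nonneg (w - c)]
        have : ‖(w - c) ^ 2 + 4‖ ^ 2 ≤ 64 := by nlinarith [norm_nonneg ((w - c) ^ 2 + 4)]
        have : 0 ≤ 16 * (K * Real.exp (6 * π) * Real.exp (3 * π * ‖z‖)) := by positivity
        linarith
      · have h8 : ‖w - c‖ = 2 := by
          refine le_antisymm h5 (not_lt.1 fun h => h4 ⟨?_, h6⟩)
          simpa [dist_eq_norm] using h
        have h9 : w.re ^ 2 + (w - c).im ^ 2 = 4 := by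
          rw [← h7, pow_two, pow_two, ← normSq_apply, normSq_eq_norm_sq, h8]; norm_num
        have h10 := norm_half_disc_factor h9 h6.le
        rw [← h7, re_add_im, h7] at h10
        have h11 : w.re ≤ 2 := by
          rw [← h7]; exact (re_le_norm _).trans h5
        have h12 : ‖w‖ ≤ ‖z‖ + 2 := by
          calc ‖w‖ = ‖c + (w - c)‖ := by ring_nf
            _ ≤ _ := (norm_add_le _ _).trans (by linarith)
        have h13 : Real.exp (3 * π * ‖w‖) ≤ Real.exp (6 * π) * Real.exp (3 * π * ‖z‖) := by
          rw [← Real.exp_add]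
          exact Real.exp_le_exp.2 (by nlinarith [Real.pi_pos])
        rw [h10]
        calc _ ≤ K * Real.exp (3 * π * ‖w‖) / w.re ^ 2 * (4 * w.re) ^ 2 :=
              mul_le_mul_of_nonneg_right (hraw h6 h11) (by positivity)
          _ = 16 * (K * Real.exp (3 * π * ‖w‖)) := by field_simp; ring
          _ ≤ 16 * (K * (Real.exp (6 * π) * Real.exp (3 * π * ‖z‖))) := by
              exact mul_le_mul_of_nonneg_left (mul_le_mul_of_nonneg_left h13 hK0.le) (by norm_num)
          _ = 16 * (K * Real.exp (6 * π) * Real.exp (3 * π * ‖z‖)) := by ring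
          _ ≤ _ := by
              have : 0 ≤ 64 * Real.exp (3 * π * ‖z‖) := by positivity
              linarith)
    (z := z) (subset_closure ⟨by
      rw [Metric.mem_ball, dist_eq_norm]
      nth_rewrite 1 [hzc]
      rw [add_sub_cancel_left, norm_real, Real.norm_of_nonneg hz.le]; linarith, hz⟩)
  have h14 : ‖((z - c) ^ 2 + 4) ^ 2‖ = (z.re ^ 2 + 4) ^ 2 := by
    have : z - c = z.re := by nth_rewrite 1 [hzc]; ring
    rw [this, show ((z.re : ℂ) ^ 2 + 4) ^ 2 = (((z.re ^ 2 + 4) ^ 2 : ℝ) : ℂ) by push_cast; ring,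
      norm_real, Real.norm_of_nonneg (by positivity)]
  rw [norm_mul, h14] at key
  have h15 : (16 : ℝ) ≤ (z.re ^ 2 + 4) ^ 2 := by nlinarith [sq_nonneg z.re]
  have h16 := mul_le_mul_of_nonneg_left h15 (norm_nonneg (entireXi z / entireXi (z + 1)))
  calc _ ≤ (4 + K * Real.exp (6 * π)) * Real.exp (3 * π * ‖z‖) := by linarith
    _ ≤ _ := mul_le_mul_of_nonneg_right ((le_max_right _ _).trans (le_max_right _ _))
      (by positivity)

/-- The key monotonicity property of `entireXi`. -/
lemma norm_entireXi_sub_one_le {w : ℂ} (hw : 1 ≤ w.re) : ‖entireXi (w - 1)‖ ≤ ‖entireXi w‖ := by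
  obtain ⟨K, -, h1⟩ := norm_entireXi_div_le_exp
  obtain ⟨C', hC', h2⟩ := norm_entireXi_sub_one_div_le
  have h := norm_le_of_exp_growth (f := fun z => entireXi z / entireXi (z + 1)) (M := 0)
    (fun z hz => differentiableAt_div_entireXi differentiable_entireXi (by simpa))
    (fun z hz _ => h1 z hz) ⟨C', 2, fun x hx => by
      have := h2 (x + 1) (by simp; linarith)
      rwa [add_sub_cancel_right] at this⟩
    (fun x => (norm_entireXi_div_of_re_eq_zero (z := x * I) (by simp)).le) (z := w - 1)
    (by simpa using hw)
  rwa [sub_add_cancel, norm_div, div_le_one (norm_pos_iff.2 (entireXi_ne_zero hw))] at h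

lemma norm_entireXi_sub_two_div_le_exp : ∃ K > 0, ∀ w : ℂ, 3 / 2 ≤ w.re →
    ‖entireXi (w - 2) / entireXi w‖ ≤ K * Real.exp (3 * π * ‖w‖) := by
  obtain ⟨C, hC, h1⟩ := norm_inv_entireXi_le
  refine ⟨max 1 (16 * π / 15 * (C * 4)), by positivity, fun w hw => ?_⟩
  have he : 1 ≤ Real.exp (3 * π * ‖w‖) := Real.one_le_exp (by positivity)
  rcases le_or_gt 2 w.re with h | h
  · have h3 := norm_entireXi_sub_one_le (w := w) (by linarith)
    have h4 := norm_entireXi_sub_one_le (w := w - 1) (by simp; linarith)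
    rw [sub_sub, one_add_one_eq_two] at h4
    have h5 : ‖entireXi (w - 2) / entireXi w‖ ≤ 1 := by
      rw [norm_div]; exact div_le_one_of_le₀ (h4.trans h3) (norm_nonneg _)
    calc _ ≤ 1 * 1 := by linarith
      _ ≤ _ := mul_le_mul (le_max_left _ _) he zero_le_one (by positivity)
  · have h3 := h1 w (by linarith) (by linarith)
    have h4 := norm_entireXi_le (w := w - 2) (by simp; linarith) (by simp; linarith)
    have h5 : 1 / 4 ≤ (w.re - 1) ^ 2 := by nlinarith
    have h6 : C * Real.exp (3 * π * ‖w‖) / (w.re - 1) ^ 2 ≤ C * 4 * Real.exp (3 * π * ‖w‖) := by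
      rw [div_le_iff₀ (by linarith)]
      have : 0 ≤ C * 4 * Real.exp (3 * π * ‖w‖) := by positivity
      nlinarith
    rw [div_eq_mul_inv, norm_mul]
    calc _ ≤ 16 * π / 15 * (C * 4 * Real.exp (3 * π * ‖w‖)) :=
          mul_le_mul h4 (h3.trans h6) (norm_nonneg _) (by positivity)
      _ = 16 * π / 15 * (C * 4) * Real.exp (3 * π * ‖w‖) := by ring
      _ ≤ _ := mul_le_mul_of_nonneg_right (le_max_right _ _) (by positivity)

lemma lam_nonneg : 0 ≤ lam := by
  have h := CBall.holds_lamB.re_ge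
  have h2 : (0 : ℝ) ≤ lam * CBall.scale := by
    refine le_trans ?_ h
    norm_num [CBall.lamB]
  exact nonneg_of_mul_nonneg_left h2 CBall.scale_pos

lemma lam_le_one : lam ≤ 1 := by
  have h := CBall.holds_lamB.norm_le
  rw [norm_real] at h
  have h2 : (CBall.lamB.abs : ℤ) ≤ CBall.scale := by decide +kernel
  have h3 : (CBall.lamB.abs : ℝ) ≤ CBall.scale := by exact_mod_cast h2
  have h4 := CBall.scale_pos
  have h5 := le_abs_self lam
  rw [← Real.norm_eq_abs] at h5
  nlinarith

lemma eps_gt : 0.0471 < eps := by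
  rw [eps]; linarith [Real.pi_gt_d4]

lemma eps_lt : eps < 0.0472 := by
  rw [eps]; linarith [Real.pi_lt_d4]

lemma norm_le_of_normSq {z : ℂ} {r : ℝ} (hr : 0 ≤ r) (h : z.re ^ 2 + z.im ^ 2 ≤ r ^ 2) :
    ‖z‖ ≤ r := by
  rw [← sq_le_sq₀ (norm_nonneg _) hr, ← normSq_eq_norm_sq, normSq_apply]
  linarith

lemma polynomial_pos {t : ℝ} (ht : 11.52 ≤ t) :
    (t + 0.011) * (t + 2.8) * (3 * t ^ 2 + t + 4.761)
      < 3 * t * ((t ^ 2 - 1 / 4) * (8.5 * (1 - eps / 2) + eps * t ^ 2)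
        - t ^ 2 * (8.5 * eps - (1 - eps / 2))) := by
  have h1 : (t ^ 2 - 1 / 4) * (8.5 * (1 - eps / 2) + eps * t ^ 2)
        - t ^ 2 * (8.5 * eps - (1 - eps / 2))
      = 8.5 * (t ^ 2 - 1 / 4) + t ^ 2 + eps * ((t ^ 2 - 1 / 4) * (t ^ 2 - 4.25) - 9 * t ^ 2) := by
    ring
  have h2 : 0 ≤ (t ^ 2 - 1 / 4) * (t ^ 2 - 4.25) - 9 * t ^ 2 := by
    have hx : 132 ≤ t ^ 2 := by nlinarith
    nlinarith [mul_nonneg (sub_nonneg.2 hx) (sq_nonneg t)]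
  have h3 := mul_le_mul_of_nonneg_right eps_gt.le h2
  rw [h1]
  refine lt_of_lt_of_le ?_ (mul_le_mul_of_nonneg_left (add_le_add_right h3 _) (by linarith))
  obtain ⟨u, hu, rfl⟩ : ∃ u : ℝ, 0 ≤ u ∧ t = u + 11.52 := ⟨t - 11.52, by linarith, by ring⟩
  rw [← sub_pos]
  ring_nf
  positivity

lemma re_num_mul_conj_den_pos_of_ge {t : ℝ} (ht : 11.52 ≤ t) :
    0 < (num (1 / 2 + t * I) * conj (den (1 / 2 + t * I))).re := by
  have hre : (1 / 2 + t * I : ℂ).re = 1 / 2 := by simp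
  refine re_num_mul_conj_den_of_far hre (norm_entireXi_sub_one_le (by simp; norm_num)) ?_
  have hU : 0 < ‖entireXi (1 / 2 + t * I + 1)‖ :=
    norm_pos_iff.2 (entireXi_ne_zero (by simp))
  have hXU : ‖entireXi (1 / 2 + t * I)‖ ≤ ‖entireXi (1 / 2 + t * I + 1)‖ := by
    simpa using norm_entireXi_sub_one_le (w := 1 / 2 + t * I + 1) (by simp)
  set s : ℂ := 1 / 2 + t * I with hs
  set U := entireXi (s + 1)
  set X := entireXi s
  set T := s * (s + 8) * (s - 2 / 3) with hT
  set A := (eps * s + (1 - eps)) * ((s - 1) * (3 * s - 2)) with hA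
  have r0 : s.re = 1 / 2 := hre
  have i0 : s.im = t := by simp [hs]
  have n1 : ‖s‖ ≤ t + 0.011 := norm_le_of_normSq (by linarith) (by rw [r0, i0]; nlinarith)
  have n2 : ‖s + 8‖ ≤ t + 2.8 := norm_le_of_normSq (by linarith) (by
    simp only [add_re, add_im, r0, i0, re_ofNat, im_ofNat]; nlinarith)
  have n3 : ‖(s + 1) * (s - 2) + lam * s‖ ≤ t ^ 2 + 9 / 4 := by
    refine norm_le_of_normSq (by positivity) ?_
    have e1 : ((s + 1) * (s - 2) + lam * s).re = -(t ^ 2 + 9 / 4) + lam / 2 := by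
      simp [r0, i0]; ring
    have e2 : ((s + 1) * (s - 2) + lam * s).im = lam * t := by simp [r0, i0]; ring
    rw [e1, e2]
    have h1 := mul_nonneg lam_nonneg (sub_nonneg.2 lam_le_one)
    nlinarith [mul_nonneg h1 (sq_nonneg t), lam_nonneg]
  have n4 : ‖lam * s‖ ≤ t + 0.011 := by
    rw [norm_mul, norm_real, Real.norm_of_nonneg lam_nonneg]
    calc _ ≤ 1 * ‖s‖ := mul_le_mul_of_nonneg_right lam_le_one (norm_nonneg _)
      _ ≤ _ := by linarith
  have n5 : ‖(s - 1) * (s - 2)‖ ≤ t ^ 2 + 5 / 4 := by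
    refine norm_le_of_normSq (by positivity) ?_
    have e1 : ((s - 1) * (s - 2)).re = 3 / 4 - t ^ 2 := by
      simp [r0, i0]; ring
    have e2 : ((s - 1) * (s - 2)).im = - 2 * t := by simp [r0, i0]; ring
    rw [e1, e2]
    nlinarith
  have n6 : t ≤ ‖s - 2 / 3‖ := by
    have := im_le_norm (s - 2 / 3)
    have e : (s - 2 / 3).im = t := by simp [i0]
    rwa [e] at this
  have hA' : (A * conj T).re = 3 * ‖s - 2 / 3‖ ^ 2
      * ((t ^ 2 - 1 / 4) * (8.5 * (1 - eps / 2) + eps * t ^ 2)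
        - t ^ 2 * (8.5 * eps - (1 - eps / 2))) := by
    have e : A * conj T = ((3 * normSq (s - 2 / 3) : ℝ) : ℂ)
        * ((eps * s + (1 - eps)) * conj (s + 8) * ((s - 1) * conj s)) := by
      push_cast
      rw [normSq_eq_conj_mul_self, hA, hT]
      simp only [map_mul]
      ring
    rw [e, re_ofReal_mul, normSq_eq_norm_sq]
    congr 1
    simp [r0, i0]
    ring
  have hP := polynomial_pos ht
  set Q := (t ^ 2 - 1 / 4) * (8.5 * (1 - eps / 2) + eps * t ^ 2)
        - t ^ 2 * (8.5 * eps - (1 - eps / 2))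
  have hQ : 0 < Q := by
    by_contra h
    have h1 : 3 * t * Q ≤ 0 := mul_nonpos_of_nonneg_of_nonpos (by linarith) (not_lt.1 h)
    have h2 : 0 < (t + 0.011) * (t + 2.8) * (3 * t ^ 2 + t + 4.761) := by
      have : 0 < t := by linarith
      positivity
    linarith
  have hN : 0 < ‖s - 2 / 3‖ := lt_of_lt_of_le (by linarith) n6
  have hmain : ‖T‖ * (‖(s + 1) * (s - 2) + lam * s‖ + ‖lam * s‖ + 2 * ‖(s - 1) * (s - 2)‖)
      < (A * conj T).re := by
    rw [hA', hT, norm_mul, norm_mul]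
    have ht0 : 0 < t := by linarith
    calc _ ≤ (t + 0.011) * (t + 2.8) * ‖s - 2 / 3‖ *
        (t ^ 2 + 9 / 4 + (t + 0.011) + 2 * (t ^ 2 + 5 / 4)) := by
          gcongr
      _ = ‖s - 2 / 3‖ * ((t + 0.011) * (t + 2.8) * (3 * t ^ 2 + t + 4.761)) := by ring
      _ < ‖s - 2 / 3‖ * (3 * t * Q) := mul_lt_mul_of_pos_left hP hN
      _ ≤ ‖s - 2 / 3‖ * (3 * ‖s - 2 / 3‖ * Q) := by gcongr
      _ = _ := by ring
  have e : ((A * U - 2 * (X * ((s - 1) * (s - 2)))) * conj (U * T)).re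
      = ‖U‖ ^ 2 * (A * conj T).re - (2 * (X * ((s - 1) * (s - 2))) * conj (U * T)).re := by
    rw [← re_ofReal_mul, ← sub_re, ← normSq_eq_norm_sq, normSq_eq_conj_mul_self, map_mul]
    congr 1; ring
  rw [e]
  have h1 : (2 * (X * ((s - 1) * (s - 2))) * conj (U * T)).re
      ≤ ‖U‖ ^ 2 * (‖T‖ * (2 * ‖(s - 1) * (s - 2)‖)) := by
    refine (re_le_norm _).trans ?_
    rw [norm_mul, norm_conj, norm_mul, norm_mul X, norm_mul U, Complex.norm_ofNat]
    calc _ ≤ 2 * (‖U‖ * ‖(s - 1) * (s - 2)‖) * (‖U‖ * ‖T‖) := by gcongr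
      _ = _ := by ring
  have h2 : ‖X‖ * (‖(s + 1) * (s - 2) + lam * s‖ + ‖lam * s‖) * ‖U * T‖
      ≤ ‖U‖ ^ 2 * (‖T‖ * (‖(s + 1) * (s - 2) + lam * s‖ + ‖lam * s‖)) := by
    rw [norm_mul U]
    calc _ ≤ ‖U‖ * (‖(s + 1) * (s - 2) + lam * s‖ + ‖lam * s‖) * (‖U‖ * ‖T‖) := by gcongr
      _ = _ := by ring
  have h3 := mul_lt_mul_of_pos_left hmain (pow_pos hU 2)
  linarith

/-- The quotient `num / den` has positive real part on the critical line. -/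
lemma re_num_mul_conj_den_pos {s : ℂ} (hs : s.re = 1 / 2) : 0 < (num s * conj (den s)).re := by
  have key {t : ℝ} (ht : 0 ≤ t) : 0 < (num (1 / 2 + t * I) * conj (den (1 / 2 + t * I))).re := by
    rcases le_total t 11.52 with h | h
    · exact re_num_mul_conj_den_pos_of_le (fun w hw => norm_entireXi_sub_one_le hw) ht h
    · exact re_num_mul_conj_den_pos_of_ge h
  rcases le_total 0 s.im with h | h
  · have e : s = 1 / 2 + s.im * I := by apply Complex.ext <;> simp [hs]
    rw [e]; exact key h
  · have e : conj s = 1 / 2 + (-s.im : ℝ) * I := by apply Complex.ext <;> simp [hs]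
    have h1 := key (neg_nonneg.2 h)
    rw [← e, num_conj, den_conj, ← map_mul, conj_re] at h1
    exact h1

lemma re_num_div_den_pos {s : ℂ} (hs : s.re = 1 / 2) : 0 < (num s / den s).re := by
  have h0 : den s ≠ 0 := den_ne_zero hs.ge (fun h => by rw [h] at hs; norm_num at hs)
  have h : num s / den s = (((normSq (den s))⁻¹ : ℝ) : ℂ) * (num s * conj (den s)) := by
    rw [div_eq_mul_inv, inv_def]; push_cast; ring
  rw [h, re_ofReal_mul]
  exact mul_pos (inv_pos.2 (normSq_pos.2 h0)) (re_num_mul_conj_den_pos hs)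

lemma num_one_sub (s : ℂ) : num (1 - s) =
    entireXi (2 * s - 1) * entireXi (s - 1) * entireXi (3 * s - 2)
      * ((eps * (1 - s) + (1 - eps)) * (-s * (1 - 3 * s)))
    - entireXi (2 * s - 1) * entireXi s * entireXi (3 * s - 1) * ((2 - s) * (-1 - s))
    - 2 * entireXi (2 * s - 1) * entireXi s * entireXi (3 * s - 2) * (-s * (-1 - s))
    - lam * (1 - s) * (entireXi s * entireXi (3 * s - 1)
      * (entireXi (2 * s - 1) + entireXi (2 * s))) := by
  rw [num, show 2 * (1 - s) = 1 - (2 * s - 1) by ring, show 1 - s + 1 = 1 - (s - 1) by ring,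
    show 3 * (1 - s) = 1 - (3 * s - 2) by ring, show 1 - (3 * s - 2) - 1 = 1 - (3 * s - 1) by ring,
    show 1 - (2 * s - 1) - 1 = 1 - 2 * s by ring]
  simp only [entireXi_one_sub]
  ring

/-- The numerator that Weng's zeta function antisymmetrizes. -/
noncomputable def symNum (s : ℂ) : ℂ := (s - 1) * num s

lemma eq_of_partial_fractions {s a U b V a' b' m X e l z : ℂ} (h0 : s ≠ 0) (h1 : s - 1 ≠ 0)
    (h2 : s - 2 ≠ 0) (h3 : s + 1 ≠ 0) (h4 : 2 * s - 1 ≠ 0) (h5 : 3 * s - 1 ≠ 0)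
    (h6 : 3 * s - 2 ≠ 0)
    (hz : (1 + e) / 2 * (U / ((s + 1) * s)) * (a / (2 * s * (2 * s - 1)))
          * (b / (3 * s * (3 * s - 1))) / (s - 2)
        - (1 + e) / 2 * (V / ((s - 1) * (s - 2))) * (a' / ((2 * s - 1) * (2 * (s - 1))))
          * (b' / ((3 * s - 2) * (3 * (s - 1)))) / (s + 1)
        - U / ((s + 1) * s) * (a / (2 * s * (2 * s - 1))) * (b / (3 * s * (3 * s - 1)))
          / (2 * (s - 1))
        + V / ((s - 1) * (s - 2)) * (a' / ((2 * s - 1) * (2 * (s - 1))))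
          * (b' / ((3 * s - 2) * (3 * (s - 1)))) / (2 * s)
        - m / (s * (s - 1)) * (a / (2 * s * (2 * s - 1))) * (X / ((3 * s - 1) * (3 * s - 2)))
          / (3 * s * (2 * (s - 1)))
        - m / (s * (s - 1)) * (a' / ((2 * s - 1) * (2 * (s - 1))))
          * (b' / ((3 * s - 2) * (3 * (s - 1)))) / ((3 * s - 1) * (s - 2))
        - m / (s * (s - 1)) * (a' / ((2 * s - 1) * (2 * (s - 1))))
          * (X / ((3 * s - 1) * (3 * s - 2))) / (3 * (s - 1) * (2 * s))
        - m / (s * (s - 1)) * (a / (2 * s * (2 * s - 1))) * (b / (3 * s * (3 * s - 1)))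
          / ((3 * s - 2) * (s + 1)) = z) :
    z * (12 * (s ^ 3 * (s - 1) ^ 3 * (3 * s - 2) * (3 * s - 1) * (s + 1) * (s - 2) * (2 * s - 1)))
      = (s - 1) * (a * U * b * ((e * s + (1 - e)) * ((s - 1) * (3 * s - 2)))
          - a * m * X * ((s + 1) * (s - 2)) - 2 * a * m * b * ((s - 1) * (s - 2))
          - l * s * (m * X * (a + a')))
        + s * (a' * V * b' * ((e * (1 - s) + (1 - e)) * (-s * (1 - 3 * s)))
          - a' * m * X * ((2 - s) * (-1 - s)) - 2 * a' * m * b' * (-s * (-1 - s))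
          - l * (1 - s) * (m * X * (a' + a))) := by
  subst hz
  obtain ⟨p1, e1⟩ : ∃ p, p = s - 1 := ⟨_, rfl⟩
  obtain ⟨p2, e2⟩ : ∃ p, p = s - 2 := ⟨_, rfl⟩
  obtain ⟨p3, e3⟩ : ∃ p, p = s + 1 := ⟨_, rfl⟩
  obtain ⟨p4, e4⟩ : ∃ p, p = 2 * s - 1 := ⟨_, rfl⟩
  obtain ⟨p5, e5⟩ : ∃ p, p = 3 * s - 1 := ⟨_, rfl⟩
  obtain ⟨p6, e6⟩ : ∃ p, p = 3 * s - 2 := ⟨_, rfl⟩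
  rw [← e1] at h1
  rw [← e2] at h2
  rw [← e3] at h3
  rw [← e4] at h4
  rw [← e5] at h5
  rw [← e6] at h6
  rw [← e1, ← e2, ← e3, ← e4, ← e5, ← e6]
  field_simp
  rw [e1, e2, e3, e5, e6]
  ring

lemma symNum_eq_of_wengG2Plong_eq_zero {s : ℂ}
    (hs : s ∉ ({-1, 0, 1/3, 1/2, 2/3, 1, 2} : Set ℂ)) (hzero : wengG2Plong s = 0) :
    symNum s = symNum (1 - s) := by
  simp only [mem_insert_iff, mem_singleton_iff, not_or] at hs
  obtain ⟨g1, g2, g3, g4, g5, g6, g7⟩ := hs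
  have h1 : s - 1 ≠ 0 := sub_ne_zero.2 g6
  have h2 : s - 2 ≠ 0 := sub_ne_zero.2 g7
  have h3 : s + 1 ≠ 0 := fun h => g1 (by linear_combination h)
  have h4 : 2 * s - 1 ≠ 0 := fun h => g4 (by linear_combination h / 2)
  have h5 : 3 * s - 1 ≠ 0 := fun h => g3 (by linear_combination h / 3)
  have h6 : 3 * s - 2 ≠ 0 := fun h => g5 (by linear_combination h / 3)
  have x2 : completedRiemannZeta 2 = (1 + eps) / 2 := by
    rw [completedRiemannZeta_eq_entireXi (by norm_num) (by norm_num), entireXi_two, eps]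
    push_cast; ring
  have key (w u v : ℂ) (hu : u ≠ 0) (hv : v ≠ 0) (eu : w = u) (ev : w - 1 = v) :
      completedRiemannZeta w = entireXi w / (u * v) := by
    subst eu ev
    rw [completedRiemannZeta_eq_entireXi hu (sub_ne_zero.1 hv)]
  have y1 := key (s + 1) (s + 1) s h3 g2 rfl (by ring)
  have y2 := key (2 * s) (2 * s) (2 * s - 1) (by simpa using g2) h4 rfl rfl
  have y3 := key (3 * s) (3 * s) (3 * s - 1) (by simpa using g2) h5 rfl rfl
  have y4 := key (s - 1) (s - 1) (s - 2) h1 h2 rfl (by ring)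
  have y5 := key (2 * s - 1) (2 * s - 1) (2 * (s - 1)) h4 (by simpa using h1) rfl (by ring)
  have y6 := key (3 * s - 2) (3 * s - 2) (3 * (s - 1)) h6 (by simpa using h1) rfl (by ring)
  have y7 := key s s (s - 1) g2 h1 rfl rfl
  have y8 := key (3 * s - 1) (3 * s - 1) (3 * s - 2) h5 h6 rfl (by ring)
  rw [wengG2Plong, x2, y1, y2, y3, y4, y5, y6, y7, y8, show 2 * s - 2 = 2 * (s - 1) by ring,
    show 3 * s - 3 = 3 * (s - 1) by ring] at hzero
  have := eq_of_partial_fractions (l := lam) g2 h1 h2 h3 h4 h5 h6 hzero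
  rw [symNum, symNum, num_one_sub, num]
  linear_combination -this

lemma lam_pos : 0 < lam := by
  have h := CBall.holds_lamB.re_ge
  have h2 : (0 : ℝ) < lam * CBall.scale := by
    refine lt_of_lt_of_le ?_ h
    norm_num [CBall.lamB]
  exact pos_of_mul_pos_left h2 CBall.scale_pos.le

lemma entireXi_four_thirds_ne_zero : entireXi (4 / 3) ≠ 0 := entireXi_ne_zero (by norm_num)

lemma lam_mul_add : lam * (entireXi (4 / 3) + entireXi (1 / 3)) = (2 - 4 / 3 * eps) * entireXi
    (4 / 3) := by
  have hl : (lam : ℂ) ≠ 0 := by exact_mod_cast lam_pos.ne'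
  have h := ofReal_lam
  have h1 : 1 + entireXi (1 / 3) * (entireXi (4 / 3))⁻¹ ≠ 0 := by
    intro h2
    rw [h2, inv_zero, mul_zero] at h
    exact hl h
  have hq := entireXi_four_thirds_ne_zero
  have h3 : entireXi (4 / 3) + entireXi (1 / 3)
      = (1 + entireXi (1 / 3) * (entireXi (4 / 3))⁻¹) * entireXi (4 / 3) := by field_simp
  rw [h, h3, eps]
  rw [← mul_assoc, mul_assoc _ _ (1 + _), inv_mul_cancel₀ h1]
  push_cast; ring

lemma entireXi_two_eq_eps : entireXi 2 = 1 + eps := by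
  rw [entireXi_two, eps]; push_cast; ring

lemma entireXi_two_thirds : entireXi (2 / 3) = entireXi (1 / 3) := by
  rw [← entireXi_one_sub]; norm_num

lemma num_zero : num 0 = 0 := by
  have h : entireXi (-1) = 1 + eps := by
    rw [← entireXi_one_sub, ← entireXi_two_eq_eps]; norm_num
  simp [num, h]; ring

lemma num_two_thirds : num (2 / 3) = 0 := by
  have h := lam_mul_add
  have h1 : (2 * (2 / 3) : ℂ) = 4 / 3 := by norm_num
  have h2 : (3 * (2 / 3) : ℂ) = 2 := by norm_num
  have h3 : (2 - 1 : ℂ) = 1 := by norm_num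
  have h4 : (4 / 3 - 1 : ℂ) = 1 / 3 := by norm_num
  rw [num, h1, h2, h3, h4, entireXi_two_thirds, entireXi_two_eq_eps, entireXi_one]
  linear_combination (-2 / 3 * entireXi (1 / 3)) * h

lemma num_one_third : num (1 / 3) = 0 := by
  have h := lam_mul_add
  have h1 : (2 * (1 / 3) : ℂ) = 2 / 3 := by norm_num
  have h2 : (3 * (1 / 3) : ℂ) = 1 := by norm_num
  have h3 : (1 - 1 : ℂ) = 0 := by norm_num
  have h4 : entireXi (2 / 3 - 1) = entireXi (4 / 3) := by rw [← entireXi_one_sub]; norm_num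
  have h5 : (1 / 3 + 1 : ℂ) = 4 / 3 := by norm_num
  rw [num, h1, h2, h3, h4, h5, entireXi_two_thirds, entireXi_zero, entireXi_one]
  linear_combination (-1 / 3 * entireXi (1 / 3)) * h

lemma norm_num_sub_le {s : ℂ} (hs : 1 / 2 ≤ s.re) :
    ‖num s - entireXi (2 * s) * entireXi (s + 1) * entireXi (3 * s)
      * ((eps * s + (1 - eps)) * ((s - 1) * (3 * s - 2)))‖
      ≤ ‖entireXi (2 * s) * entireXi (s + 1) * entireXi (3 * s)‖
        * (‖(s + 1) * (s - 2)‖ + 2 * ‖(s - 1) * (s - 2)‖ + 2 * ‖s‖) := by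
  have h1 : ‖entireXi s‖ ≤ ‖entireXi (s + 1)‖ := by
    simpa using norm_entireXi_sub_one_le (w := s + 1) (by simp; linarith)
  have h2 := norm_entireXi_sub_one_le (w := 3 * s) (by simp; linarith)
  have h3 := norm_entireXi_sub_one_le (w := 2 * s) (by simp; linarith)
  have e : num s - entireXi (2 * s) * entireXi (s + 1) * entireXi (3 * s)
      * ((eps * s + (1 - eps)) * ((s - 1) * (3 * s - 2)))
      = -(entireXi (2 * s) * entireXi s * entireXi (3 * s - 1) * ((s + 1) * (s - 2))
        + entireXi (2 * s) * entireXi s * entireXi (3 * s) * (2 * ((s - 1) * (s - 2)))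
        + (entireXi (2 * s) + entireXi (2 * s - 1)) * entireXi s * entireXi (3 * s - 1)
          * (lam * s)) := by
    rw [num]; ring
  rw [e, norm_neg, mul_add, mul_add]
  have hl : ‖(lam : ℂ)‖ ≤ 1 := by
    rw [norm_real, Real.norm_of_nonneg lam_nonneg]; exact lam_le_one
  refine (norm_add₃_le).trans (add_le_add (add_le_add ?_ ?_) ?_)
  · rw [norm_mul]
    refine mul_le_mul_of_nonneg_right ?_ (norm_nonneg _)
    rw [norm_mul, norm_mul, norm_mul, norm_mul]; gcongr
  · rw [norm_mul, norm_mul 2, Complex.norm_ofNat]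
    refine mul_le_mul_of_nonneg_right ?_ (by positivity)
    rw [norm_mul, norm_mul, norm_mul, norm_mul]; gcongr
  · have h4 : ‖entireXi (2 * s) + entireXi (2 * s - 1)‖ ≤ 2 * ‖entireXi (2 * s)‖ :=
      (norm_add_le _ _).trans (by linarith)
    calc _ = ‖entireXi (2 * s) + entireXi (2 * s - 1)‖ * ‖entireXi s‖ * ‖entireXi (3 * s - 1)‖
          * (‖(lam : ℂ)‖ * ‖s‖) := by simp only [norm_mul]
      _ ≤ (2 * ‖entireXi (2 * s)‖) * ‖entireXi (s + 1)‖ * ‖entireXi (3 * s)‖ * (1 * ‖s‖) := by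
        gcongr
      _ = _ := by simp only [norm_mul]; ring

section Growth

variable {s : ℂ}

lemma norm_num_le (hs : 1 / 2 ≤ s.re) (h : 4 ≤ ‖s‖) :
    ‖num s‖ ≤ ‖entireXi (2 * s) * entireXi (s + 1) * entireXi (3 * s)‖ * (20 * ‖s‖ ^ 3) := by
  have h0 := norm_num_sub_le hs
  have e0 : ‖(eps : ℂ) * s + (1 - eps)‖ ≤ ‖s‖ := by
    have : ‖(eps : ℂ) * s + (1 - eps)‖ ≤ eps * ‖s‖ + (1 - eps) := by
      refine (norm_add_le _ _).trans ?_
      rw [norm_mul, norm_real, Real.norm_of_nonneg (by linarith [eps_gt]), ← ofReal_one,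
        ← ofReal_sub, norm_real, Real.norm_of_nonneg (by linarith [eps_lt])]
    nlinarith [eps_lt]
  have e1 : ‖s - 1‖ ≤ 2 * ‖s‖ := (norm_sub_le _ _).trans (by simp; linarith)
  have e2 : ‖s - 2‖ ≤ 2 * ‖s‖ := (norm_sub_le _ _).trans (by simp; linarith)
  have e3 : ‖s + 1‖ ≤ 2 * ‖s‖ := (norm_add_le _ _).trans (by simp; linarith)
  have e4 : ‖3 * s - 2‖ ≤ 4 * ‖s‖ := (norm_sub_le _ _).trans (by simp; linarith)
  set Q := entireXi (2 * s) * entireXi (s + 1) * entireXi (3 * s)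
  set P : ℂ := (eps * s + (1 - eps)) * ((s - 1) * (3 * s - 2)) with hP
  have hP' : ‖P‖ ≤ 8 * ‖s‖ ^ 3 := by
    rw [hP, norm_mul, norm_mul]
    calc _ ≤ ‖s‖ * ((2 * ‖s‖) * (4 * ‖s‖)) := by gcongr
      _ = _ := by ring
  have hR : ‖(s + 1) * (s - 2)‖ + 2 * ‖(s - 1) * (s - 2)‖ + 2 * ‖s‖ ≤ 12 * ‖s‖ ^ 3 := by
    rw [norm_mul, norm_mul]
    calc _ ≤ (2 * ‖s‖) * (2 * ‖s‖) + 2 * ((2 * ‖s‖) * (2 * ‖s‖)) + 2 * ‖s‖ := by gcongr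
      _ ≤ _ := by nlinarith [mul_nonneg (norm_nonneg s) (norm_nonneg s)]
  calc ‖num s‖ = ‖Q * P + (num s - Q * P)‖ := by congr 1; ring
    _ ≤ ‖Q‖ * ‖P‖ + ‖Q‖ * (12 * ‖s‖ ^ 3) := by
      refine (norm_add_le _ _).trans (add_le_add (norm_mul _ _).le (h0.trans ?_))
      gcongr
    _ ≤ ‖Q‖ * (8 * ‖s‖ ^ 3) + ‖Q‖ * (12 * ‖s‖ ^ 3) := by gcongr
    _ = _ := by ring

lemma le_norm_num (hs : 1 / 2 ≤ s.re) (h : 1000 ≤ ‖s‖) :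
    ‖entireXi (2 * s) * entireXi (s + 1) * entireXi (3 * s)‖ * (1 / 100 * ‖s‖ ^ 3) ≤ ‖num s‖ := by
  have h0 := norm_num_sub_le hs
  have e0 : 1 / 22 * ‖s‖ ≤ ‖(eps : ℂ) * s + (1 - eps)‖ := by
    have : eps * ‖s‖ - (1 - eps) ≤ ‖(eps : ℂ) * s + (1 - eps)‖ := by
      have := norm_sub_norm_le ((eps : ℂ) * s) (-(1 - eps))
      rw [norm_neg, sub_neg_eq_add] at this
      refine le_trans ?_ this
      rw [norm_mul, norm_real, Real.norm_of_nonneg (by linarith [eps_gt]), ← ofReal_one,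
        ← ofReal_sub, norm_real, Real.norm_of_nonneg (by linarith [eps_lt])]
    nlinarith [eps_lt, eps_gt]
  have e1 : 0.999 * ‖s‖ ≤ ‖s - 1‖ := le_trans (by simp; linarith) (norm_sub_norm_le _ _)
  have e4 : 2.998 * ‖s‖ ≤ ‖3 * s - 2‖ := le_trans (by simp; linarith) (norm_sub_norm_le _ _)
  have e1' : ‖s - 1‖ ≤ 1.002 * ‖s‖ := (norm_sub_le _ _).trans (by simp; linarith)
  have e2 : ‖s - 2‖ ≤ 1.002 * ‖s‖ := (norm_sub_le _ _).trans (by simp; linarith)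
  have e3 : ‖s + 1‖ ≤ 1.002 * ‖s‖ := (norm_add_le _ _).trans (by simp; linarith)
  set Q := entireXi (2 * s) * entireXi (s + 1) * entireXi (3 * s)
  set P : ℂ := (eps * s + (1 - eps)) * ((s - 1) * (3 * s - 2)) with hP
  have hP' : 0.13 * ‖s‖ ^ 3 ≤ ‖P‖ := by
    rw [hP, norm_mul, norm_mul]
    calc _ ≤ (1 / 22 * ‖s‖) * ((0.999 * ‖s‖) * (2.998 * ‖s‖)) := by
          have : 0 ≤ ‖s‖ ^ 3 := by positivity
          linarith
      _ ≤ _ := by gcongr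
  have hR : ‖(s + 1) * (s - 2)‖ + 2 * ‖(s - 1) * (s - 2)‖ + 2 * ‖s‖ ≤ 0.01 * ‖s‖ ^ 3 := by
    rw [norm_mul, norm_mul]
    calc _ ≤ (1.002 * ‖s‖) * (1.002 * ‖s‖) + 2 * ((1.002 * ‖s‖) * (1.002 * ‖s‖)) + 2 * ‖s‖ := by
          gcongr
      _ ≤ _ := by nlinarith [mul_nonneg (norm_nonneg s) (norm_nonneg s)]
  have h5 : ‖Q‖ * ‖P‖ - ‖num s - Q * P‖ ≤ ‖num s‖ := by
    have := norm_sub_norm_le (Q * P) (Q * P - num s)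
    rw [sub_sub_cancel, norm_sub_rev (Q * P), norm_mul] at this
    exact this
  have h6 : ‖Q‖ * (0.13 * ‖s‖ ^ 3) ≤ ‖Q‖ * ‖P‖ := by gcongr
  have h7 := h0.trans (mul_le_mul_of_nonneg_left hR (norm_nonneg Q))
  have : 0 ≤ ‖Q‖ * ‖s‖ ^ 3 := by positivity
  linarith

end Growth

lemma differentiable_dslope {f : ℂ → ℂ} (hf : Differentiable ℂ f) (c : ℂ) :
    Differentiable ℂ (dslope f c) := by
  rw [← differentiableOn_univ] at hf ⊢
  exact (Complex.differentiableOn_dslope univ_mem).2 hf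

/-- The quotient of `num s` by `s - 2 / 3`. -/
noncomputable def quot : ℂ → ℂ := dslope num (2 / 3)

lemma differentiable_quot : Differentiable ℂ quot := differentiable_dslope differentiable_num _

lemma sub_mul_quot (s : ℂ) : (s - 2 / 3) * quot s = num s := by
  have := sub_smul_dslope num (2 / 3) s
  rwa [num_two_thirds, sub_zero] at this

/-- A comparison function for `quot` in the half-plane `1 / 2 ≤ re s`. -/
noncomputable def quotDen (s : ℂ) : ℂ :=
  entireXi (2 * s) * (entireXi (s + 1) * (entireXi (3 * s) * (s * (s + 8))))

lemma differentiable_quotDen : Differentiable ℂ quotDen := by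
  have := differentiable_entireXi
  unfold quotDen
  fun_prop

lemma quotDen_ne_zero {s : ℂ} (hs : 1 / 2 ≤ s.re) : quotDen s ≠ 0 := by
  have h1 : entireXi (2 * s) ≠ 0 := entireXi_ne_zero (by simp; linarith)
  have h2 : entireXi (s + 1) ≠ 0 := entireXi_ne_zero (by simp; linarith)
  have h3 : entireXi (3 * s) ≠ 0 := entireXi_ne_zero (by simp; linarith)
  have h4 : s ≠ 0 := by rintro rfl; norm_num at hs
  have h5 : s + 8 ≠ 0 := fun h => by
    have := congrArg Complex.re h
    simp at this; linarith
  simp [quotDen, *]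

lemma quot_div_quotDen {s : ℂ} (h : s ≠ 2 / 3) : quot s / quotDen s = num s / den s := by
  have h0 : s - 2 / 3 ≠ 0 := sub_ne_zero.2 h
  rw [← sub_mul_quot, ← mul_div_mul_left (quot s) (quotDen s) h0, den, quotDen]
  congr 1
  ring

lemma re_quot_div_pos {s : ℂ} (hs : s.re = 1 / 2) : 0 < (quot s / quotDen s).re := by
  rw [quot_div_quotDen]
  · exact re_num_div_den_pos hs
  · rintro rfl; norm_num at hs

lemma norm_quot_div_le {s : ℂ} (hs : 1 / 2 ≤ s.re) (h : 1000 ≤ ‖s‖) :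
    ‖quot s / quotDen s‖ ≤ 80 := by
  have h0 : s ≠ 2 / 3 := by rintro rfl; norm_num at h
  rw [quot_div_quotDen h0, norm_div, div_le_iff₀ (norm_pos_iff.2 (den_ne_zero hs h0))]
  have h8 : ‖s‖ / 2 ≤ ‖s + 8‖ := by
    have := norm_sub_le (s + 8) 8
    rw [add_sub_cancel_right] at this
    simp at this
    linarith
  have h9 : ‖s‖ / 2 ≤ ‖s - 2 / 3‖ := by
    refine le_trans ?_ (norm_sub_norm_le _ _)
    norm_num; linarith
  refine (norm_num_le hs (by linarith)).trans ?_
  have e : den s = entireXi (2 * s) * entireXi (s + 1) * entireXi (3 * s)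
      * (s * (s + 8) * (s - 2 / 3)) := by rw [den]; ring
  rw [e, norm_mul _ (s * (s + 8) * (s - 2 / 3)), mul_left_comm (80 : ℝ)]
  refine mul_le_mul_of_nonneg_left ?_ (norm_nonneg _)
  rw [norm_mul, norm_mul]
  calc 20 * ‖s‖ ^ 3 = 80 * (‖s‖ * (‖s‖ / 2) * (‖s‖ / 2)) := by ring
    _ ≤ _ := by gcongr

lemma re_quot_div_nonneg {z : ℂ} (hz : 0 ≤ z.re) :
    0 ≤ (quot (z + 1 / 2) / quotDen (z + 1 / 2)).re := by
  have hb (z : ℂ) (h0 : 0 ≤ z.re) (h : 1001 ≤ ‖z‖) :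
      ‖cexp (-(quot (z + 1 / 2) / quotDen (z + 1 / 2)))‖ ≤ Real.exp 80 := by
    refine (norm_exp_le_exp_norm _).trans (Real.exp_le_exp.2 ?_)
    rw [norm_neg]
    refine norm_quot_div_le (by simpa using h0) ?_
    have := norm_sub_le (z + 1 / 2) (1 / 2)
    rw [add_sub_cancel_right] at this
    norm_num at this ⊢
    linarith
  have key := norm_le_of_exp_growth
    (f := fun z => cexp (-(quot (z + 1 / 2) / quotDen (z + 1 / 2)))) (C := 1) (K := Real.exp 80)
    (A := 0) (M := 1001) ?_ ?_ ⟨Real.exp 80, 1001, fun x hx => hb x ?_ ?_⟩ ?_ hz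
  · rw [norm_exp, Real.exp_le_one_iff, neg_re] at key
    linarith
  · intro w hw
    have h1 : DifferentiableAt ℂ (fun z : ℂ => quot (z + 1 / 2)) w :=
      (differentiable_quot _).comp w (by fun_prop)
    have h2 : DifferentiableAt ℂ (fun z : ℂ => quotDen (z + 1 / 2)) w :=
      (differentiable_quotDen _).comp w (by fun_prop)
    exact (h1.div h2 (quotDen_ne_zero (by simpa using hw))).neg.cexp
  · intro w hw h
    simpa using hb w hw.le h
  · simp; linarith
  · rw [norm_real]; exact hx.trans (le_abs_self x)
  · intro x
    rw [norm_exp, Real.exp_le_one_iff, neg_re, neg_nonpos]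
    exact (re_quot_div_pos (by simp)).le

lemma quot_ne_zero {s : ℂ} (hs : 1 / 2 ≤ s.re) : quot s ≠ 0 := by
  intro h0
  rcases hs.eq_or_lt with h | h
  · have := re_quot_div_pos h.symm
    simp [h0] at this
  set f : ℂ → ℂ := fun w => cexp (-(quot w / quotDen w)) with hf
  have hn (w : ℂ) (hw : 1 / 2 ≤ w.re) : ‖f w‖ ≤ 1 := by
    rw [hf, norm_exp, Real.exp_le_one_iff, neg_re, neg_nonpos]
    have := re_quot_div_nonneg (z := w - 1 / 2) (by simpa using hw)
    rwa [sub_add_cancel] at this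
  have hcl : closure {w : ℂ | 1 / 2 < w.re} = {w : ℂ | 1 / 2 ≤ w.re} := closure_setOfPred_lt_re _
  have key := Complex.norm_eqOn_closure_of_isPreconnected_of_isMaxOn (f := f) (c := s)
    (U := {w : ℂ | 1 / 2 < w.re}) (convex_halfSpace_re_gt _).isPreconnected
    (isOpen_lt continuous_const continuous_re) ?_ h ?_
  · have h1 := key (x := 1 / 2) (by rw [hcl]; norm_num)
    have h2 : ‖f s‖ = 1 := by simp [hf, h0]
    simp only [Function.comp_apply, Function.const_apply, h2] at h1
    rw [hf, norm_exp, Real.exp_eq_one_iff, neg_re, neg_eq_zero] at h1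
    exact (re_quot_div_pos (s := 1 / 2) (by norm_num)).ne' h1
  · apply DifferentiableOn.diffContOnCl
    rw [hcl]
    intro w hw
    exact (((differentiable_quot w).div (differentiable_quotDen w)
      (quotDen_ne_zero hw)).neg.cexp).differentiableWithinAt
  · intro w hw
    have h2 : ‖f s‖ = 1 := by simp [hf, h0]
    simp only [Function.comp_apply, mem_ofPred_eq, h2]
    exact hn w (le_of_lt hw)

/-- The quotient of `num (1 - s)` by `(s - 1) * (s - 2 / 3)`. -/
noncomputable def reflQuot : ℂ → ℂ := dslope (dslope (fun s => num (1 - s)) 1) (2 / 3)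

lemma differentiable_reflQuot : Differentiable ℂ reflQuot := by
  have := differentiable_num
  exact differentiable_dslope (differentiable_dslope (by fun_prop) _) _

lemma mul_reflQuot (s : ℂ) : (s - 1) * ((s - 2 / 3) * reflQuot s) = num (1 - s) := by
  have h1 (s : ℂ) : (s - 1) * dslope (fun s => num (1 - s)) 1 s = num (1 - s) := by
    have := sub_smul_dslope (fun s => num (1 - s)) 1 s
    simpa [num_zero] using this
  have h2 : dslope (fun s => num (1 - s)) 1 (2 / 3) = 0 := by
    have := h1 (2 / 3)
    rw [show (1 - 2 / 3 : ℂ) = 1 / 3 by norm_num, num_one_third] at this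
    exact (mul_eq_zero.1 this).resolve_left (by norm_num)
  have h3 := sub_smul_dslope (dslope (fun s => num (1 - s)) 1) (2 / 3) s
  rw [h2, sub_zero, smul_eq_mul] at h3
  rw [← h1, ← h3, reflQuot]

/-- The quotient of `symNum (1 - s)` by `symNum s`, with removable singularities removed. -/
noncomputable def reflRatio (s : ℂ) : ℂ := -s * reflQuot s / quot s

lemma differentiableAt_reflRatio {s : ℂ} (hs : 1 / 2 ≤ s.re) : DifferentiableAt ℂ reflRatio s :=
  ((differentiableAt_id.neg).mul (differentiable_reflQuot s)).div (differentiable_quot s)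
    (quot_ne_zero hs)

lemma reflRatio_mul_symNum {s : ℂ} (hs : 1 / 2 ≤ s.re) :
    reflRatio s * symNum s = symNum (1 - s) := by
  have h := quot_ne_zero hs
  rw [symNum, symNum, ← mul_reflQuot, ← sub_mul_quot, reflRatio]
  field_simp
  ring

lemma symNum_ne_zero {s : ℂ} (hs : 1 / 2 ≤ s.re) (h1 : s ≠ 1) (h2 : s ≠ 2 / 3) :
    symNum s ≠ 0 := by
  rw [symNum, ← sub_mul_quot]
  exact mul_ne_zero (sub_ne_zero.2 h1) (mul_ne_zero (sub_ne_zero.2 h2) (quot_ne_zero hs))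

lemma norm_reflRatio_of_re_eq_half {s : ℂ} (hs : s.re = 1 / 2) : ‖reflRatio s‖ = 1 := by
  have h0 := symNum_ne_zero hs.ge (by rintro rfl; norm_num at hs) (by rintro rfl; norm_num at hs)
  have h1 := congrArg norm (reflRatio_mul_symNum hs.ge)
  have h2 : 1 - s = conj s := by
    apply Complex.ext <;> simp [hs]; norm_num
  have h3 : ‖symNum (1 - s)‖ = ‖symNum s‖ := by
    have : s - 1 = -conj s := by rw [← h2]; ring
    rw [symNum, symNum, sub_sub_cancel_left, h2, num_conj, this]
    simp
  rw [norm_mul, h3] at h1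
  exact (mul_eq_right₀ (norm_ne_zero_iff.2 h0)).1 h1

lemma norm_num_one_sub_le {s : ℂ} {L : ℝ} (hs : 1 / 2 ≤ s.re) (h : 4 ≤ ‖s‖) (hL : 1 ≤ L)
    (h1 : ‖entireXi (s - 1)‖ ≤ L * ‖entireXi (s + 1)‖)
    (h2 : ‖entireXi (3 * s - 2)‖ ≤ L * ‖entireXi (3 * s)‖) :
    ‖num (1 - s)‖ ≤ ‖entireXi (2 * s) * entireXi (s + 1) * entireXi (3 * s)‖
      * (10 * L ^ 2 * ‖s‖ ^ 3) := by
  have hm : ‖entireXi s‖ ≤ ‖entireXi (s + 1)‖ := by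
    simpa using norm_entireXi_sub_one_le (w := s + 1) (by simp; linarith)
  have hX := norm_entireXi_sub_one_le (w := 3 * s) (by simp; linarith)
  have ha := norm_entireXi_sub_one_le (w := 2 * s) (by simp; linarith)
  have e0 : ‖(eps : ℂ) * (1 - s) + (1 - eps)‖ ≤ ‖s‖ := by
    have : ‖1 - (eps : ℂ) * s‖ ≤ 1 + eps * ‖s‖ := by
      refine (norm_sub_le _ _).trans ?_
      rw [norm_mul, norm_real, Real.norm_of_nonneg (by linarith [eps_gt]), norm_one]
    rw [show (eps : ℂ) * (1 - s) + (1 - eps) = 1 - eps * s by ring]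
    nlinarith [eps_lt]
  have e1 : ‖1 - s‖ ≤ 2 * ‖s‖ := (norm_sub_le _ _).trans (by simp; linarith)
  have e2 : ‖2 - s‖ ≤ 2 * ‖s‖ := (norm_sub_le _ _).trans (by simp; linarith)
  have e3 : ‖-1 - s‖ ≤ 2 * ‖s‖ := (norm_sub_le _ _).trans (by simp; linarith)
  have e4 : ‖1 - 3 * s‖ ≤ 4 * ‖s‖ := (norm_sub_le _ _).trans (by simp; linarith)
  have hl : ‖(lam : ℂ)‖ ≤ 1 := by
    rw [norm_real, Real.norm_of_nonneg lam_nonneg]; exact lam_le_one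
  have hL2 : 1 ≤ L ^ 2 := one_le_pow₀ hL
  set Q := ‖entireXi (2 * s)‖ * ‖entireXi (s + 1)‖ * ‖entireXi (3 * s)‖ with hQ
  have hQ0 : 0 ≤ Q := by positivity
  have t1 : ‖entireXi (2 * s - 1) * entireXi (s - 1) * entireXi (3 * s - 2)
      * ((eps * (1 - s) + (1 - eps)) * (-s * (1 - 3 * s)))‖ ≤ Q * (4 * L ^ 2 * ‖s‖ ^ 3) := by
    simp only [norm_mul, norm_neg]
    calc _ ≤ ‖entireXi (2 * s)‖ * (L * ‖entireXi (s + 1)‖) * (L * ‖entireXi (3 * s)‖)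
          * (‖s‖ * (‖s‖ * (4 * ‖s‖))) := by gcongr
      _ = _ := by rw [hQ]; ring
  have t2 : ‖entireXi (2 * s - 1) * entireXi s * entireXi (3 * s - 1) * ((2 - s) * (-1 - s))‖
      ≤ Q * (4 * ‖s‖ ^ 2) := by
    simp only [norm_mul]
    calc _ ≤ ‖entireXi (2 * s)‖ * ‖entireXi (s + 1)‖ * ‖entireXi (3 * s)‖
          * ((2 * ‖s‖) * (2 * ‖s‖)) := by gcongr
      _ = _ := by rw [hQ]; ring
  have t3 : ‖2 * entireXi (2 * s - 1) * entireXi s * entireXi (3 * s - 2) * (-s * (-1 - s))‖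
      ≤ Q * (4 * L * ‖s‖ ^ 2) := by
    simp only [norm_mul, norm_neg, Complex.norm_ofNat]
    calc _ ≤ 2 * ‖entireXi (2 * s)‖ * ‖entireXi (s + 1)‖ * (L * ‖entireXi (3 * s)‖)
          * (‖s‖ * (2 * ‖s‖)) := by gcongr
      _ = _ := by rw [hQ]; ring
  have t4 : ‖lam * (1 - s) * (entireXi s * entireXi (3 * s - 1)
      * (entireXi (2 * s - 1) + entireXi (2 * s)))‖ ≤ Q * (4 * ‖s‖) := by
    have h4 : ‖entireXi (2 * s - 1) + entireXi (2 * s)‖ ≤ 2 * ‖entireXi (2 * s)‖ :=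
      (norm_add_le _ _).trans (by linarith)
    simp only [norm_mul]
    calc _ ≤ 1 * (2 * ‖s‖) * (‖entireXi (s + 1)‖ * ‖entireXi (3 * s)‖
          * (2 * ‖entireXi (2 * s)‖)) := by gcongr
      _ = _ := by rw [hQ]; ring
  have hsum : 4 * L ^ 2 * ‖s‖ ^ 3 + 4 * ‖s‖ ^ 2 + 4 * L * ‖s‖ ^ 2 + 4 * ‖s‖
      ≤ 10 * L ^ 2 * ‖s‖ ^ 3 := by
    have p1 : 4 * ‖s‖ ^ 2 ≤ ‖s‖ ^ 3 := by nlinarith [sq_nonneg ‖s‖]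
    have p2 : 4 * ‖s‖ ≤ ‖s‖ ^ 2 := by nlinarith
    have p3 : ‖s‖ ^ 3 ≤ L ^ 2 * ‖s‖ ^ 3 := le_mul_of_one_le_left (by positivity) hL2
    have p4 : L * (4 * ‖s‖ ^ 2) ≤ L ^ 2 * ‖s‖ ^ 3 :=
      mul_le_mul (le_self_pow₀ hL two_ne_zero) p1 (by positivity) (by positivity)
    linarith [show 0 ≤ ‖s‖ ^ 2 by positivity]
  rw [num_one_sub, norm_mul (entireXi (2 * s) * entireXi (s + 1)), norm_mul (entireXi (2 * s))]
  refine (norm_sub_le _ _).trans ((add_le_add ((norm_sub_le _ _).trans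
    (add_le_add ((norm_sub_le _ _).trans (add_le_add t1 t2)) t3)) t4).trans ?_)
  rw [← mul_add, ← mul_add, ← mul_add]
  exact mul_le_mul_of_nonneg_left hsum hQ0

lemma norm_reflRatio_le_of_le {s : ℂ} {L : ℝ} (hs : 1 / 2 ≤ s.re) (h : 1000 ≤ ‖s‖) (hL : 1 ≤ L)
    (h1 : ‖entireXi (s - 1)‖ ≤ L * ‖entireXi (s + 1)‖)
    (h2 : ‖entireXi (3 * s - 2)‖ ≤ L * ‖entireXi (3 * s)‖) :
    ‖reflRatio s‖ ≤ 2000 * L ^ 2 := by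
  have b1 := norm_num_one_sub_le hs (by linarith) hL h1 h2
  have b2 := le_norm_num hs h
  have h0 := symNum_ne_zero hs (by rintro rfl; norm_num at h) (by rintro rfl; norm_num at h)
  have h3 := congrArg norm (reflRatio_mul_symNum hs)
  rw [norm_mul] at h3
  refine le_of_mul_le_mul_right ?_ (norm_pos_iff.2 h0)
  rw [h3, symNum, symNum, norm_mul, norm_mul, sub_sub_cancel_left, norm_neg]
  have e1 : 1 / 2 * ‖s‖ ≤ ‖s - 1‖ := le_trans (by simp; linarith) (norm_sub_norm_le _ _)
  set Q := ‖entireXi (2 * s) * entireXi (s + 1) * entireXi (3 * s)‖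
  calc ‖s‖ * ‖num (1 - s)‖ ≤ ‖s‖ * (Q * (10 * L ^ 2 * ‖s‖ ^ 3)) := by gcongr
    _ = 2000 * L ^ 2 * ((1 / 2 * ‖s‖) * (Q * (1 / 100 * ‖s‖ ^ 3))) := by ring
    _ ≤ _ := by gcongr

lemma norm_reflRatio_le_of_one_le_re {s : ℂ} (hs : 1 ≤ s.re) (h : 1000 ≤ ‖s‖) :
    ‖reflRatio s‖ ≤ 2000 := by
  have h1 := norm_entireXi_sub_one_le hs
  have h2 := norm_entireXi_sub_one_le (w := s + 1) (by simp; linarith)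
  have h3 := norm_entireXi_sub_one_le (w := 3 * s) (by simp; linarith)
  have h4 := norm_entireXi_sub_one_le (w := 3 * s - 1) (by simp; linarith)
  rw [add_sub_cancel_right] at h2
  rw [sub_sub, one_add_one_eq_two] at h4
  simpa using norm_reflRatio_le_of_le (L := 1) (by linarith) h le_rfl
    (by simpa using h1.trans h2) (by simpa using h4.trans h3)

lemma norm_reflRatio_le_exp : ∃ K : ℝ, ∀ s : ℂ, 1 / 2 ≤ s.re → 1000 ≤ ‖s‖ →
    ‖reflRatio s‖ ≤ K * Real.exp (18 * π * ‖s‖) := by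
  obtain ⟨K, hK, hb⟩ := norm_entireXi_sub_two_div_le_exp
  refine ⟨2000 * (max K 1) ^ 2, fun s hs h => ?_⟩
  have hL : 1 ≤ max K 1 * Real.exp (9 * π * ‖s‖) :=
    one_le_mul_of_one_le_of_one_le (le_max_right _ _)
      (Real.one_le_exp (by have := Real.pi_pos; positivity))
  have key (w : ℂ) (hw : 3 / 2 ≤ w.re) (hn : ‖w‖ ≤ 3 * ‖s‖) :
      ‖entireXi (w - 2)‖ ≤ max K 1 * Real.exp (9 * π * ‖s‖) * ‖entireXi w‖ := by
    have h1 := hb w hw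
    rw [norm_div, div_le_iff₀ (norm_pos_iff.2 (entireXi_ne_zero (by linarith)))] at h1
    refine h1.trans (mul_le_mul_of_nonneg_right ?_ (norm_nonneg _))
    refine mul_le_mul (le_max_left _ _) (Real.exp_le_exp.2 ?_) (Real.exp_nonneg _)
      (by positivity)
    have := mul_le_mul_of_nonneg_left hn (by have := Real.pi_pos; positivity : 0 ≤ 3 * π)
    linarith
  have h1 := key (s + 1) (by simp; linarith) ((norm_add_le _ _).trans (by simp; linarith))
  have h2 := key (3 * s) (by simp; linarith) (by simp)
  rw [show s + 1 - 2 = s - 1 by ring] at h1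
  refine (norm_reflRatio_le_of_le hs h hL h1 h2).trans (le_of_eq ?_)
  rw [mul_pow, ← Real.exp_nat_mul, ← mul_assoc]
  congr 2
  push_cast; ring

lemma norm_reflRatio_le_one {s : ℂ} (hs : 1 / 2 ≤ s.re) : ‖reflRatio s‖ ≤ 1 := by
  obtain ⟨K, hK⟩ := norm_reflRatio_le_exp
  have hn (z : ℂ) (h : 1001 ≤ ‖z‖) : 1000 ≤ ‖z + 1 / 2‖ := by
    have := norm_sub_le (z + 1 / 2) (1 / 2)
    rw [add_sub_cancel_right] at this
    norm_num at this ⊢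
    linarith
  have key := norm_le_of_exp_growth (f := fun z => reflRatio (z + 1 / 2)) (C := 1)
    (K := |K| * Real.exp (9 * π)) (A := 18 * π) (M := 1001) (z := s - 1 / 2) ?_ ?_
    ⟨2000, 1001, fun x hx => norm_reflRatio_le_of_one_le_re ?_ (hn x ?_)⟩ ?_ (by simpa using hs)
  · simpa using key
  · intro z hz
    exact (differentiableAt_reflRatio (by simpa using hz)).comp z (by fun_prop)
  · intro z hz h
    refine (hK _ (by simpa using hz.le) (hn z h)).trans ?_
    rw [mul_assoc |K|, ← Real.exp_add]
    have h2 : ‖z + 1 / 2‖ ≤ ‖z‖ + 1 / 2 := (norm_add_le _ _).trans (by norm_num)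
    refine mul_le_mul (le_abs_self K) (Real.exp_le_exp.2 ?_) (Real.exp_nonneg _) (abs_nonneg _)
    have := mul_le_mul_of_nonneg_left h2 (by have := Real.pi_pos; positivity : 0 ≤ 18 * π)
    linarith
  · simp; linarith
  · rw [norm_real]; exact hx.trans (le_abs_self x)
  · intro x
    exact (norm_reflRatio_of_re_eq_half (by simp)).le

lemma entireXi_six_gt : ∃ x : ℝ, 1.9 < x ∧ entireXi 6 = x := by
  refine ⟨(entireXi (6 : ℝ)).re, ?_, by rw [ofReal_entireXi_re]; norm_num⟩
  have h6 : riemannZeta 6 = ((∑' n : ℕ, 1 / (n : ℝ) ^ 6 : ℝ) : ℂ) := by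
    have := zeta_nat_eq_tsum_of_gt_one (k := 6) (by norm_num)
    push_cast at this ⊢
    exact this
  have h1 : (1 : ℝ) ≤ ∑' n : ℕ, 1 / (n : ℝ) ^ 6 := by
    have hs : Summable fun n : ℕ => 1 / (n : ℝ) ^ 6 :=
      Real.summable_one_div_nat_pow.2 (by norm_num)
    have := hs.le_tsum 1 (fun n _ => by positivity)
    simpa using this
  have hG : Gamma (6 / 2 + 1) = 6 := by
    have := Complex.Gamma_nat_eq_factorial 3
    rw [show (6 / 2 + 1 : ℂ) = (3 : ℕ) + 1 by norm_num, this]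
    norm_num [Nat.factorial]
  have hp : (π : ℂ) ^ (-6 / 2 : ℂ) = ((π ^ 3)⁻¹ : ℝ) := by
    rw [show (-6 / 2 : ℂ) = -((3 : ℕ) : ℂ) by norm_num, cpow_neg, cpow_natCast]
    push_cast; rfl
  have h : entireXi (6 : ℝ) = (60 * (π ^ 3)⁻¹ * (∑' n : ℕ, 1 / (n : ℝ) ^ 6) : ℝ) := by
    rw [show ((6 : ℝ) : ℂ) = 6 by norm_num, entireXi_eq_Gamma (by norm_num) (by norm_num), hG, hp,
      h6]
    push_cast; ring
  rw [h, ofReal_re]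
  have hpi : π ^ 3 < 31.1 := by
    have h3 := Real.pi_lt_d4
    have h4 : π ^ 3 ≤ 3.1416 ^ 3 := pow_le_pow_left₀ Real.pi_pos.le h3.le 3
    norm_num at h4 ⊢; linarith
  have h5 : 1.9 < 60 * (π ^ 3)⁻¹ := by
    rw [← div_eq_mul_inv, lt_div_iff₀ (by have := Real.pi_pos; positivity)]
    linarith
  nlinarith

lemma symNum_two_ne : symNum 2 ≠ symNum (1 - 2) := by
  intro h
  obtain ⟨x, hx, h6⟩ := entireXi_six_gt
  have h3 : entireXi 3 ≠ 0 := entireXi_ne_zero (by norm_num)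
  have h4 : entireXi 4 ≠ 0 := entireXi_ne_zero (by norm_num)
  have e1 : num 2 = entireXi 4 * entireXi 3 * entireXi 6 * ((1 + eps) * 4)
      - 2 * lam * (entireXi 2 * entireXi 5 * (entireXi 4 + entireXi 3)) := by
    rw [num]; norm_num; ring
  have e2 : num (1 - 2) = entireXi 3 * entireXi 4 * (-2 - 32 * eps)
      + lam * (entireXi 2 * entireXi 5 * (entireXi 4 + entireXi 3)) := by
    rw [num_one_sub, entireXi_two_eq_eps]; norm_num; ring
  rw [symNum, symNum, e1, e2] at h
  have h7 : entireXi 3 * entireXi 4 * (x * ((1 + eps) * 4) - (4 + 64 * eps)) = 0 := by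
    rw [← h6]; linear_combination h
  have h8 := (mul_eq_zero.1 h7).resolve_left (mul_ne_zero h3 h4)
  have h9 : x * ((1 + eps) * 4) - (4 + 64 * eps) = 0 := by exact_mod_cast h8
  nlinarith [eps_gt, eps_lt]

lemma symNum_ne_symNum_one_sub {s : ℂ} (hs : 1 / 2 < s.re) (h1 : s ≠ 1) (h2 : s ≠ 2 / 3) :
    symNum s ≠ symNum (1 - s) := by
  intro h
  rw [← reflRatio_mul_symNum hs.le] at h
  have hone : reflRatio s = 1 := (mul_eq_right₀ (symNum_ne_zero hs.le h1 h2)).1 h.symm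
  have key := Complex.eqOn_of_isPreconnected_of_isMaxOn_norm (f := reflRatio) (c := s)
    (U := {w : ℂ | 1 / 2 < w.re}) (convex_halfSpace_re_gt _).isPreconnected
    (isOpen_lt continuous_const continuous_re)
    (fun w hw => (differentiableAt_reflRatio (le_of_lt hw)).differentiableWithinAt) hs
    (fun w hw => by
      simpa [hone] using norm_reflRatio_le_one (le_of_lt hw))
  have h3 := key (x := 2) (by norm_num)
  rw [Function.const_apply, hone] at h3
  have h4 := reflRatio_mul_symNum (s := 2) (by norm_num)
  rw [h3, one_mul] at h4
  exact symNum_two_ne h4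

end WengG2

/-- The Riemann Hypothesis for Weng's zeta of `(G₂, P_long)` (Suzuki–Weng):
all zeros lie on `Re s = 1/2`. -/
theorem wengG2Plong_riemann_hypothesis (s : ℂ)
    (hs : s ∉ ({-1, 0, 1/3, 1/2, 2/3, 1, 2} : Set ℂ)) (hzero : wengG2Plong s = 0) :
    s.re = 1/2 := by
  have h := WengG2.symNum_eq_of_wengG2Plong_eq_zero hs hzero
  simp only [Set.mem_insert_iff, Set.mem_singleton_iff, not_or] at hs
  obtain ⟨-, h0, h3, -, h2, h1, -⟩ := hs
  rcases lt_trichotomy s.re (1 / 2) with hlt | heq | hgt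
  · refine absurd ?_ (WengG2.symNum_ne_symNum_one_sub (s := 1 - s) (by simp; linarith)
      (fun h => h0 (by linear_combination -h)) (fun h => h3 (by linear_combination -h)))
    rw [sub_sub_cancel, h]
  · exact heq
  · exact absurd h (WengG2.symNum_ne_symNum_one_sub hgt h1 h2)
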